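/- arXiv:2002.08644 — 2 statements merged into one kernel-verified Lean document; each statement's English description precedes it below -/
import Mathlib

section
/- Let Ω ⊆ ℂ be a bounded domain. Then: (i) if every point of ∂Ω is locally accessible from Ω, then ∂Ω is a Peano compactum; (ii) ∂Ω is a Peano compactum if and only if every point of ∂Ω is locally sequentially accessible. -/
open Set Metric Filter MeasureTheory Topology

noncomputable section

/-- A planar domain: a nonempty open connected subset of ℂ. -/
def IsPlanarDomain (D : Set ℂ) : Prop := D.Nonempty ∧ IsOpen D ∧ IsConnected D

/-- A Peano compactum: a compact subset of ℂ all of whose connected components are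
locally connected (as subspaces of ℂ) and such that for every `C > 0` only finitely
many components have diameter greater than `C`. -/
def IsPeanoCompactum (K : Set ℂ) : Prop :=
  IsCompact K ∧
  (∀ x ∈ K, LocallyConnectedSpace ↥(connectedComponentIn K x)) ∧
  ∀ C : ℝ, 0 < C →
    {Q : Set ℂ | (∃ x ∈ K, Q = connectedComponentIn K x) ∧ C < Metric.diam Q}.Finite

/-- A Jordan curve: a subset of ℂ homeomorphic to the unit circle. -/
def IsJordanCurve (J : Set ℂ) : Prop :=
  Nonempty (↥J ≃ₜ ↥(Metric.sphere (0:ℂ) 1))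

/-- A generalized Jordan domain: a bounded domain whose boundary is a Peano compactum,
each of whose boundary components is a single point or a Jordan curve. -/
def IsGeneralizedJordanDomain (D : Set ℂ) : Prop :=
  IsPlanarDomain D ∧ Bornology.IsBounded D ∧
  IsPeanoCompactum (frontier D) ∧
  ∀ x ∈ frontier D,
    connectedComponentIn (frontier D) x = {x} ∨
    IsJordanCurve (connectedComponentIn (frontier D) x)

/-- `φ` restricts to a homeomorphism of `D` onto `Ω`. -/
def IsHomeoOnto (φ : ℂ → ℂ) (D Ω : Set ℂ) : Prop :=
  ContinuousOn φ D ∧ Set.BijOn φ D Ω ∧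
  ∃ ψ : ℂ → ℂ, ContinuousOn ψ Ω ∧ Set.InvOn ψ φ D Ω

/-- `φ` is a conformal homeomorphism (holomorphic bijection) of `D` onto `Ω`. -/
def IsConformalHomeoOnto (φ : ℂ → ℂ) (D Ω : Set ℂ) : Prop :=
  DifferentiableOn ℂ φ D ∧ Set.BijOn φ D Ω

/-- `φb` is a continuous extension of `φ : D → Ω` to `closure D`, with values in `closure Ω`. -/
def ExtendsContinuously (φ φb : ℂ → ℂ) (D Ω : Set ℂ) : Prop :=
  ContinuousOn φb (closure D) ∧ Set.EqOn φb φ D ∧ Set.MapsTo φb (closure D) (closure Ω)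

/-- The oscDiam `σ_r(z₀) = diam φ(D ∩ C_r(z₀))`. -/
def oscDiam (φ : ℂ → ℂ) (D : Set ℂ) (z₀ : ℂ) (r : ℝ) : ℝ :=
  Metric.diam (φ '' (D ∩ Metric.sphere z₀ r))

/-- `liminf_{r→0⁺} σ_r(z₀) = 0`. -/
def OscLiminfZero (φ : ℂ → ℂ) (D : Set ℂ) (z₀ : ℂ) : Prop :=
  Filter.liminf (oscDiam φ D z₀) (nhdsWithin (0:ℝ) (Set.Ioi 0)) = 0

/-- A circle domain (normalized so that ∞ lies in a complementary disk): every bounded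
complementary component is a point or a closed round disk, and the unbounded
complementary component is the complement of an open round disk. -/
def IsCircleDomain (D : Set ℂ) : Prop :=
  IsPlanarDomain D ∧ Bornology.IsBounded D ∧
  ∀ x ∈ Dᶜ,
    (Bornology.IsBounded (connectedComponentIn Dᶜ x) →
      connectedComponentIn Dᶜ x = {x} ∨
      ∃ c : ℂ, ∃ rad : ℝ, 0 < rad ∧ connectedComponentIn Dᶜ x = Metric.closedBall c rad) ∧
    (¬ Bornology.IsBounded (connectedComponentIn Dᶜ x) →
      ∃ c : ℂ, ∃ rad : ℝ, 0 < rad ∧ connectedComponentIn Dᶜ x = (Metric.ball c rad)ᶜ)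

/-- A set has σ-finite linear (1-dimensional Hausdorff) measure. -/
def SigmaFiniteH1 (E : Set ℂ) : Prop :=
  ∃ f : ℕ → Set ℂ, (⋃ n, f n) = E ∧ ∀ n, μH[1] (f n) < ⊤

/-- The set of connected components of `K` containing more than one point. -/
def NondegComponents (K : Set ℂ) : Set (Set ℂ) :=
  {Q | (∃ x ∈ K, Q = connectedComponentIn K x) ∧ ∃ a ∈ Q, ∃ b ∈ Q, a ≠ b}

/-- The union of the singleton connected components of `K`. -/
def SingletonPart (K : Set ℂ) : Set ℂ :=
  {x | x ∈ K ∧ connectedComponentIn K x = {x}}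

/-- The cluster set `C(h, z₀) = ⋂_{r>0} closure h({z ∈ U : |z − z₀| < r})`. -/
def clusterSet (h : ℂ → ℂ) (U : Set ℂ) (z₀ : ℂ) : Set ℂ :=
  ⋂ r ∈ Set.Ioi (0:ℝ), closure (h '' (U ∩ Metric.ball z₀ r))

/-- The boundary component of `Ω` corresponding (under `φ : D → Ω`) to a boundary
component `Q` of `D`: `φ^B(Q) = ⋃_{z ∈ Q} C(φ, z)`. -/
def boundaryComp (φ : ℂ → ℂ) (D : Set ℂ) (Q : Set ℂ) : Set ℂ :=
  ⋃ z ∈ Q, clusterSet φ D z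

/-- An arc: the image of a continuous injective map from `[0,1]`. -/
def IsArc (A : Set ℂ) : Prop :=
  ∃ f : ℝ → ℂ, ContinuousOn f (Set.Icc 0 1) ∧ Set.InjOn f (Set.Icc 0 1) ∧
    f '' Set.Icc 0 1 = A

/-- An arc from `a` to `b`. -/
def IsArcFromTo (A : Set ℂ) (a b : ℂ) : Prop :=
  ∃ f : ℝ → ℂ, ContinuousOn f (Set.Icc 0 1) ∧ Set.InjOn f (Set.Icc 0 1) ∧
    f '' Set.Icc 0 1 = A ∧ f 0 = a ∧ f 1 = b

/-- Property S: for every `ε > 0`, `Ω` is a finite union of connected sets of diameter `< ε`. -/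
def PropertyS (Ω : Set ℂ) : Prop :=
  ∀ ε > (0:ℝ), ∃ (k : ℕ) (N : Fin k → Set ℂ),
    (∀ i, IsConnected (N i) ∧ Metric.diam (N i) < ε) ∧ (⋃ i, N i) = Ω

/-- `x ∈ ∂Ω` is locally accessible from `Ω`. -/
def LocallyAccessible (Ω : Set ℂ) (x : ℂ) : Prop :=
  ∀ ε > (0:ℝ), ∃ δ > (0:ℝ), ∀ z ∈ Ω, dist z x < δ →
    ∃ A : Set ℂ, IsArcFromTo A z x ∧ A ⊆ Ω ∪ {x} ∧ Metric.diam A < ε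

/-- `ξ ∈ ∂Ω` is locally sequentially accessible. -/
def LocallySeqAccessible (Ω : Set ℂ) (ξ : ℂ) : Prop :=
  ∀ r > (0:ℝ), ∀ ξn : ℕ → ℂ, (∀ n, ξn n ∈ Ω) → Filter.Tendsto ξn Filter.atTop (nhds ξ) →
    ∃ x ∈ Ω ∩ Metric.ball ξ r,
      {n : ℕ | ξn n ∈ connectedComponentIn (Ω ∩ Metric.ball ξ r) x}.Infinite

/-- `Ω` is finitely connected at the boundary point `x`. -/
def FinitelyConnectedAt (Ω : Set ℂ) (x : ℂ) : Prop :=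
  ∀ r > (0:ℝ), ∃ U : Set ℂ, IsOpen U ∧ x ∈ U ∧ U ⊆ Metric.ball x r ∧
    {Q : Set ℂ | ∃ y ∈ U ∩ Ω, Q = connectedComponentIn (U ∩ Ω) y}.Finite

/-- The diameter (Mazurkiewicz) distance on `Ω`. -/
def mazDist (Ω : Set ℂ) (x y : ℂ) : ℝ :=
  sInf (Metric.diam '' {E : Set ℂ | E ⊆ Ω ∧ IsConnected E ∧ x ∈ E ∧ y ∈ E})

/-- `Ω` is totally bounded for the Mazurkiewicz distance; for a metric space this is
equivalent to compactness of the metric completion of `(Ω, mazDist)`. -/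
def MazCompletionCompact (Ω : Set ℂ) : Prop :=
  ∀ ε > (0:ℝ), ∃ F : Finset ℂ, ↑F ⊆ Ω ∧ ∀ x ∈ Ω, ∃ y ∈ F, mazDist Ω x y < ε

/-- `f : A → B` is non-alternating: there are no `x, y ∈ B` and no separation of
`A \ f⁻¹({x})` into two disjoint nonempty relatively open sets `A₁, A₂` with
`y ∈ f(A₁) ∩ f(A₂)`. -/
def NonAlternatingOn (f : ℂ → ℂ) (A B : Set ℂ) : Prop :=
  ¬ ∃ x ∈ B, ∃ y ∈ B, ∃ A₁ A₂ : Set ℂ,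
      A₁.Nonempty ∧ A₂.Nonempty ∧ Disjoint A₁ A₂ ∧
      A₁ ∪ A₂ = {z | z ∈ A ∧ f z ≠ x} ∧
      (∃ U₁ : Set ℂ, IsOpen U₁ ∧ A₁ = U₁ ∩ {z | z ∈ A ∧ f z ≠ x}) ∧
      (∃ U₂ : Set ℂ, IsOpen U₂ ∧ A₂ = U₂ ∩ {z | z ∈ A ∧ f z ≠ x}) ∧
      y ∈ f '' A₁ ∧ y ∈ f '' A₂

/-! ### Continuous logarithms -/

/-- `f` has a continuous logarithm on `s`. -/
def HasLogOn {X : Type*} [TopologicalSpace X] (f : X → ℂ) (s : Set X) : Prop :=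
  ∃ g : X → ℂ, ContinuousOn g s ∧ ∀ x ∈ s, Complex.exp (g x) = f x

namespace HasLogOn

variable {X : Type*} [TopologicalSpace X] {f g : X → ℂ} {s t : Set X}

lemma mono (h : HasLogOn f s) (hts : t ⊆ s) : HasLogOn f t :=
  let ⟨l, hl, hl'⟩ := h
  ⟨l, hl.mono hts, fun x hx => hl' x (hts hx)⟩

lemma congr (h : HasLogOn f s) (hfg : ∀ x ∈ s, f x = g x) : HasLogOn g s :=
  let ⟨l, hl, hl'⟩ := h
  ⟨l, hl, fun x hx => (hl' x hx).trans (hfg x hx)⟩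

lemma mul (hf : HasLogOn f s) (hg : HasLogOn g s) : HasLogOn (fun x => f x * g x) s :=
  let ⟨l, hl, hl'⟩ := hf
  let ⟨m, hm, hm'⟩ := hg
  ⟨fun x => l x + m x, hl.add hm, fun x hx => by rw [Complex.exp_add, hl' x hx, hm' x hx]⟩

lemma inv (hf : HasLogOn f s) : HasLogOn (fun x => (f x)⁻¹) s :=
  let ⟨l, hl, hl'⟩ := hf
  ⟨fun x => -l x, hl.neg, fun x hx => by rw [Complex.exp_neg, hl' x hx]⟩

lemma of_slitPlane (hf : ContinuousOn f s) (h : ∀ x ∈ s, f x ∈ Complex.slitPlane) :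
    HasLogOn f s :=
  ⟨fun x => Complex.log (f x), hf.clog h, fun x hx =>
    Complex.exp_log (Complex.slitPlane_ne_zero (h x hx))⟩

lemma of_contractible {X : Type*} [TopologicalSpace X] [LocallyPathConnectedSpace X]
    [ContractibleSpace X] {f : X → ℂ} (hf : Continuous f) (h0 : ∀ x, f x ≠ 0) :
    HasLogOn f univ := by
  have := (Homeomorph.Set.univ X).contractibleSpace
  obtain ⟨g, hg, hgf⟩ := Complex.exists_continuousOn_eqOn_exp_comp (U := (univ : Set X))
    (SimplyConnectedSpace.ofContractible (univ : Set X)) isOpen_univ hf.continuousOn (by simpa using h0)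
  exact ⟨g, hg, hgf⟩

end HasLogOn

lemma IsPreconnected.exists_int_abs_sub_lt {X : Type*} [TopologicalSpace X] {s : Set X}
    (hs : IsPreconnected s) (hne : s.Nonempty) {φ : X → ℝ} (hφ : ContinuousOn φ s) (c : ℝ)
    (hcos : ∀ x ∈ s, 0 < Real.cos (φ x - c)) :
    ∃ k : ℤ, ∀ x ∈ s, |φ x - c - k * (2 * Real.pi)| < Real.pi / 2 := by
  have hπ := Real.pi_pos
  obtain ⟨x₀, hx₀⟩ := hne
  obtain ⟨k, hk⟩ : ∃ k : ℤ, |φ x₀ - c - k * (2 * Real.pi)| ≤ Real.pi := by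
    refine ⟨round ((φ x₀ - c) / (2 * Real.pi)), ?_⟩
    have := abs_sub_round ((φ x₀ - c) / (2 * Real.pi))
    have h2 : φ x₀ - c - round ((φ x₀ - c) / (2 * Real.pi)) * (2 * Real.pi) =
      ((φ x₀ - c) / (2 * Real.pi) - round ((φ x₀ - c) / (2 * Real.pi))) * (2 * Real.pi) := by
      field_simp
    rw [h2, abs_mul, abs_of_pos (by positivity : 0 < 2 * Real.pi)]
    nlinarith
  refine ⟨k, ?_⟩
  set ψ : X → ℝ := fun x => φ x - c - k * (2 * Real.pi) with hψ
  have hψc : ContinuousOn ψ s := (hφ.sub continuousOn_const).sub continuousOn_const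
  have hcos' : ∀ x ∈ s, 0 < Real.cos (ψ x) := fun x hx => by
    rw [hψ]; simpa only [Real.cos_sub_int_mul_two_pi] using hcos x hx
  have hne : ∀ x ∈ s, |ψ x| ≠ Real.pi / 2 := fun x hx h => by
    have := hcos' x hx
    rw [← Real.cos_abs, h, Real.cos_pi_div_two] at this
    exact lt_irrefl _ this
  have h0 : |ψ x₀| < Real.pi / 2 := by
    by_contra! h
    have h2 : Real.cos (|ψ x₀|) ≤ 0 := Real.cos_nonpos_of_pi_div_two_le_of_le h (by
      have : |ψ x₀| ≤ Real.pi := hk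
      linarith)
    rw [Real.cos_abs] at h2
    exact absurd (hcos' x₀ hx₀) (not_lt.2 h2)
  intro x hx
  by_contra! h
  obtain ⟨y, hy, hy'⟩ := hs.intermediate_value hx₀ hx (continuous_abs.comp_continuousOn hψc)
    ⟨h0.le, h⟩
  exact hne y hy hy'

lemma intCast_eq_zero_of_abs_add_lt {n : ℤ} {a : ℝ} (ha : |a| ≤ Real.pi)
    (h : |n * (2 * Real.pi) + a| < Real.pi) : n = 0 := by
  have hπ := Real.pi_pos
  rw [abs_lt] at h
  rw [abs_le] at ha
  have h1 : (n : ℝ) < 1 := by nlinarith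
  have h2 : (-1 : ℝ) < n := by nlinarith
  have h3 : n < 1 := by exact_mod_cast h1
  have h4 : -1 < n := by exact_mod_cast h2
  omega

/-- A path joining the left and right sides of a rectangle meets a path joining its bottom and top
sides. -/
lemma Path.exists_eq_of_cross {a b c d : ℂ} (α : Path a b) (β : Path c d)
    (ha : ∀ t, a.re < (β t).re) (hb : ∀ t, (β t).re < b.re)
    (hc : ∀ t, c.im < (α t).im) (hd : ∀ t, (α t).im < d.im) : ∃ s t, α s = β t := by
  by_contra! hne
  have hF : Continuous fun p : ℝ × ℝ => α.extend p.1 - β.extend p.2 := by fun_prop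
  obtain ⟨g, hg, hgF⟩ := HasLogOn.of_contractible hF (fun p => by
    rw [sub_ne_zero]
    exact hne _ _)
  replace hgF : ∀ p, Complex.exp (g p) = α.extend p.1 - β.extend p.2 := fun x => hgF x (mem_univ x)
  have hφ : Continuous fun p => (g p).im :=
    Complex.continuous_im.comp (continuousOn_univ.1 hg)
  have hre : ∀ p, (α.extend p.1 - β.extend p.2).re = Real.exp (g p).re * Real.cos (g p).im :=
    fun p => by rw [← hgF, Complex.exp_re]
  have him : ∀ p, (α.extend p.1 - β.extend p.2).im = Real.exp (g p).re * Real.sin (g p).im :=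
    fun p => by rw [← hgF, Complex.exp_im]
  have hα0 : α.extend 0 = a := α.extend_zero
  have hα1 : α.extend 1 = b := α.extend_one
  have hβ0 : β.extend 0 = c := β.extend_zero
  have hβ1 : β.extend 1 = d := β.extend_one
  have hI : IsPreconnected (univ : Set ℝ) := isPreconnected_univ
  have hcos1 : ∀ t : ℝ, 0 < Real.cos ((g (1, t)).im - 0) := fun t => by
    have h := hre (1, t)
    have h2 := hb (projIcc 0 1 zero_le_one t)
    simp only [hα1, Complex.sub_re] at h
    have h3 : (β.extend t).re < b.re := h2
    rw [sub_zero]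
    exact pos_of_mul_pos_right (by rw [← h]; linarith) (Real.exp_pos _).le
  have hcos2 : ∀ s : ℝ, 0 < Real.cos ((g (s, 0)).im - Real.pi / 2) := fun s => by
    have h := him (s, 0)
    have h2 : c.im < (α.extend s).im := hc (projIcc 0 1 zero_le_one s)
    simp only [hβ0, Complex.sub_im] at h
    rw [Real.cos_sub_pi_div_two]
    exact pos_of_mul_pos_right (by rw [← h]; linarith) (Real.exp_pos _).le
  have hcos3 : ∀ t : ℝ, 0 < Real.cos ((g (0, t)).im - Real.pi) := fun t => by
    have h := hre (0, t)
    have h2 : a.re < (β.extend t).re := ha (projIcc 0 1 zero_le_one t)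
    simp only [hα0, Complex.sub_re] at h
    rw [Real.cos_sub_pi]
    refine pos_of_mul_pos_right (a := Real.exp (g (0, t)).re) ?_ (Real.exp_pos _).le
    rw [mul_neg, ← h]; linarith
  have hcos4 : ∀ s : ℝ, 0 < Real.cos ((g (s, 1)).im - (Real.pi + Real.pi / 2)) := fun s => by
    have h := him (s, 1)
    have h2 : (α.extend s).im < d.im := hd (projIcc 0 1 zero_le_one s)
    simp only [hβ1, Complex.sub_im] at h
    rw [← sub_sub, Real.cos_sub_pi_div_two, Real.sin_sub_pi]
    refine pos_of_mul_pos_right (a := Real.exp (g (s, 1)).re) ?_ (Real.exp_pos _).le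
    rw [mul_neg, ← h]; linarith
  have hne : (univ : Set ℝ).Nonempty := univ_nonempty
  obtain ⟨k1, h1⟩ := hI.exists_int_abs_sub_lt hne
    (φ := fun t => (g (1, t)).im) (hφ.comp (by fun_prop)).continuousOn 0 fun t _ => hcos1 t
  obtain ⟨k2, h2⟩ := hI.exists_int_abs_sub_lt hne
    (φ := fun s => (g (s, 0)).im) (hφ.comp (by fun_prop)).continuousOn _ fun t _ => hcos2 t
  obtain ⟨k3, h3⟩ := hI.exists_int_abs_sub_lt hne
    (φ := fun t => (g (0, t)).im) (hφ.comp (by fun_prop)).continuousOn _ fun t _ => hcos3 t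
  obtain ⟨k4, h4⟩ := hI.exists_int_abs_sub_lt hne
    (φ := fun s => (g (s, 1)).im) (hφ.comp (by fun_prop)).continuousOn _ fun t _ => hcos4 t
  have hπ := Real.pi_pos
  have e12 : k1 - k2 = 0 := by
    refine intCast_eq_zero_of_abs_add_lt (a := -(Real.pi / 2))
      (by rw [abs_neg, abs_of_pos] <;> linarith) ?_
    have u := abs_lt.1 (h1 0 trivial)
    have v := abs_lt.1 (h2 1 trivial)
    rw [abs_lt]; push_cast; constructor <;> linarith
  have e23 : k2 - k3 = 0 := by
    refine intCast_eq_zero_of_abs_add_lt (a := -(Real.pi / 2))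
      (by rw [abs_neg, abs_of_pos] <;> linarith) ?_
    have u := abs_lt.1 (h2 0 trivial)
    have v := abs_lt.1 (h3 0 trivial)
    rw [abs_lt]; push_cast; constructor <;> linarith
  have e34 : k3 - k4 = 0 := by
    refine intCast_eq_zero_of_abs_add_lt (a := -(Real.pi / 2))
      (by rw [abs_neg, abs_of_pos] <;> linarith) ?_
    have u := abs_lt.1 (h3 1 trivial)
    have v := abs_lt.1 (h4 0 trivial)
    rw [abs_lt]; push_cast; constructor <;> linarith
  have e41 : k4 - k1 + 1 = 0 := by
    refine intCast_eq_zero_of_abs_add_lt (a := -(Real.pi / 2))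
      (by rw [abs_neg, abs_of_pos] <;> linarith) ?_
    have u := abs_lt.1 (h4 1 trivial)
    have v := abs_lt.1 (h1 1 trivial)
    rw [abs_lt]; push_cast; constructor <;> linarith
  omega

/-- A connected set joining the left and right sides of a rectangle meets a connected set joining
its bottom and top sides. -/
lemma not_disjoint_of_cross {A B : Set ℂ} (hA : IsCompact A) (hAc : IsPreconnected A)
    (hB : IsCompact B) (hBc : IsPreconnected B) {a₀ a₁ b₀ b₁ : ℂ}
    (ha₀ : a₀ ∈ A) (ha₁ : a₁ ∈ A) (hb₀ : b₀ ∈ B) (hb₁ : b₁ ∈ B)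
    (hl : ∀ z ∈ B, a₀.re < z.re) (hr : ∀ z ∈ B, z.re < a₁.re)
    (hd : ∀ z ∈ A, b₀.im < z.im) (hu : ∀ z ∈ A, z.im < b₁.im) : ¬ Disjoint A B := by
  intro hdisj
  obtain ⟨ε₁, hε₁, h1⟩ := hdisj.exists_thickenings hA hB.isClosed
  obtain ⟨ε₂, hε₂, h2⟩ := hB.exists_thickening_subset_open
    (t := {z : ℂ | a₀.re < z.re} ∩ {z : ℂ | z.re < a₁.re})
    ((isOpen_lt continuous_const Complex.continuous_re).inter
      (isOpen_lt Complex.continuous_re continuous_const)) fun z hz => ⟨hl z hz, hr z hz⟩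
  obtain ⟨ε₃, hε₃, h3⟩ := hA.exists_thickening_subset_open
    (t := {z : ℂ | b₀.im < z.im} ∩ {z : ℂ | z.im < b₁.im})
    ((isOpen_lt continuous_const Complex.continuous_im).inter
      (isOpen_lt Complex.continuous_im continuous_const)) fun z hz => ⟨hd z hz, hu z hz⟩
  have key : ∀ {S : Set ℂ} {ε : ℝ}, 0 < ε → IsPreconnected S → ∀ x ∈ S, ∀ y ∈ S,
      JoinedIn (thickening ε S) x y := by
    intro S ε hε hS x hx y hy
    have : IsPathConnected (thickening ε S) := by
      rw [← isOpen_thickening.isConnected_iff_isPathConnected]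
      refine ⟨⟨x, self_subset_thickening hε _ hx⟩, ?_⟩
      refine isPreconnected_of_forall x fun w hw => ?_
      obtain ⟨z, hz, hwz⟩ := mem_thickening_iff.1 hw
      refine ⟨S ∪ ball z ε, union_subset (self_subset_thickening hε _)
        (ball_subset_thickening hz _), Or.inl hx, Or.inr hwz, ?_⟩
      exact hS.union z hz (mem_ball_self hε) (convex_ball z ε).isPreconnected
    exact this.joinedIn _ (self_subset_thickening hε _ hx) _ (self_subset_thickening hε _ hy)
  obtain ⟨α, hα⟩ := key (lt_min hε₁ hε₃) hAc a₀ ha₀ a₁ ha₁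
  obtain ⟨β, hβ⟩ := key (lt_min hε₁ hε₂) hBc b₀ hb₀ b₁ hb₁
  have hα1 := fun t => thickening_mono (min_le_left _ _) _ (hα t)
  have hα3 := fun t => h3 (thickening_mono (min_le_right _ _) _ (hα t))
  have hβ1 := fun t => thickening_mono (min_le_left _ _) _ (hβ t)
  have hβ2 := fun t => h2 (thickening_mono (min_le_right _ _) _ (hβ t))
  obtain ⟨s, t, hst⟩ := α.exists_eq_of_cross β (fun t => (hβ2 t).1) (fun t => (hβ2 t).2)
    (fun t => (hα3 t).1) (fun t => (hα3 t).2)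
  exact disjoint_left.1 h1 (hα1 s) (hst ▸ hβ1 t)

/-! ### Crossing a horizontal strip -/

/-- `P` is a continuum in the strip `c ≤ im z ≤ d` meeting both boundary lines. -/
structure CrossesStrip (P : Set ℂ) (c d : ℝ) : Prop where
  isCompact : IsCompact P
  isPreconnected : IsPreconnected P
  le_im : ∀ z ∈ P, c ≤ z.im
  im_le : ∀ z ∈ P, z.im ≤ d
  exists_bot : ∃ z ∈ P, z.im = c
  exists_top : ∃ z ∈ P, z.im = d

open Complex in
lemma isPreconnected_reProdIm_Icc (a b c d : ℝ) : IsPreconnected (Icc a b ×ℂ Icc c d) := by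
  have : Icc a b ×ℂ Icc c d = Complex.reCLM ⁻¹' Icc a b ∩ Complex.imCLM ⁻¹' Icc c d := rfl
  rw [this]
  exact (((convex_Icc a b).is_linear_preimage Complex.reCLM.isBoundedLinearMap.toIsLinearMap).inter
    ((convex_Icc c d).is_linear_preimage Complex.imCLM.isBoundedLinearMap.toIsLinearMap)).isPreconnected

lemma IsCompact.exists_norm_lt {A : Set ℂ} (hA : IsCompact A) : ∃ R, ∀ z ∈ A, ‖z‖ < R := by
  obtain ⟨R, hR⟩ := hA.isBounded.exists_norm_le
  exact ⟨R + 1, fun z hz => (hR z hz).trans_lt (lt_add_one R)⟩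

namespace CrossesStrip

variable {P A : Set ℂ} {c d : ℝ}

open Complex in
/-- A continuum crossing a strip separates bottom points to its left from bottom points to its
right. -/
lemma not_disjoint (hP : CrossesStrip P c d) (hA : IsCompact A) (hAc : IsPreconnected A)
    (hAl : ∀ z ∈ A, c ≤ z.im) (hAu : ∀ z ∈ A, z.im ≤ d) {a b a' : ℂ} (ha : a ∈ A) (hac : a.im = c)
    (ha' : a' ∈ A) (hac' : a'.im = c) (hb : b ∈ P) (hbc : b.im = c)
    (hab : a.re < b.re) (hba : b.re < a'.re) : ¬ Disjoint A P := by
  intro hdisj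
  obtain ⟨t, ht, htd⟩ := hP.exists_top
  obtain ⟨L, hL⟩ := (hA.union hP.isCompact).exists_norm_lt
  have hLre : ∀ z ∈ A ∪ P, -L < z.re ∧ z.re < L := fun z hz =>
    abs_lt.1 ((Complex.abs_re_le_norm z).trans_lt (hL z hz))
  set A₁ : Set ℂ := A ∪ Icc a.re a.re ×ℂ Icc (c - 1) c with hA₁
  set A₂ : Set ℂ := A₁ ∪ Icc (-L) a.re ×ℂ Icc (c - 1) (c - 1) with hA₂
  set A₃ : Set ℂ := A₂ ∪ Icc a'.re a'.re ×ℂ Icc (c - 1) c with hA₃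
  set A₄ : Set ℂ := A₃ ∪ Icc a'.re L ×ℂ Icc (c - 1) (c - 1) with hA₄
  set B₁ : Set ℂ := P ∪ Icc b.re b.re ×ℂ Icc (c - 2) c with hB₁
  set B₂ : Set ℂ := B₁ ∪ Icc t.re t.re ×ℂ Icc d (d + 1) with hB₂
  have hIcc : ∀ x₀ x₁ y₀ y₁ : ℝ, IsCompact (Icc x₀ x₁ ×ℂ Icc y₀ y₁) :=
    fun _ _ _ _ => isCompact_Icc.reProdIm isCompact_Icc
  have hpre := isPreconnected_reProdIm_Icc
  have haL := hLre a (Or.inl ha)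
  have haL' := hLre a' (Or.inl ha')
  have hbL := hLre b (Or.inr hb)
  have htL := hLre t (Or.inr ht)
  have hcd : c ≤ d := hbc ▸ hP.im_le b hb
  have hA₁c : IsPreconnected A₁ := hAc.union a ha
    (by simp [Complex.mem_reProdIm, hac]) (hpre _ _ _ _)
  have hA₂c : IsPreconnected A₂ := hA₁c.union ⟨a.re, c - 1⟩
    (Or.inr (by simp [Complex.mem_reProdIm])) (by simp [Complex.mem_reProdIm]; linarith) (hpre _ _ _ _)
  have hA₃c : IsPreconnected A₃ := hA₂c.union a' (Or.inl (Or.inl ha'))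
    (by simp [Complex.mem_reProdIm, hac']) (hpre _ _ _ _)
  have hA₄c : IsPreconnected A₄ := hA₃c.union ⟨a'.re, c - 1⟩
    (Or.inr (by simp [Complex.mem_reProdIm])) (by simp [Complex.mem_reProdIm]; linarith) (hpre _ _ _ _)
  have hB₁c : IsPreconnected B₁ := hP.isPreconnected.union b hb
    (by simp [Complex.mem_reProdIm, hbc]) (hpre _ _ _ _)
  have hB₂c : IsPreconnected B₂ := hB₁c.union t (Or.inl ht)
    (by simp [Complex.mem_reProdIm, htd]) (hpre _ _ _ _)
  have hcases : ∀ z ∈ A₄, z ∈ A ∨ (z.re = a.re ∧ c - 1 ≤ z.im ∧ z.im ≤ c) ∨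
      (z.re ≤ a.re ∧ z.im = c - 1) ∨ (z.re = a'.re ∧ c - 1 ≤ z.im ∧ z.im ≤ c) ∨
      (a'.re ≤ z.re ∧ z.im = c - 1) := by
    rintro z ((((h | h) | h) | h) | h)
    · exact Or.inl h
    all_goals
      simp only [Complex.mem_reProdIm, mem_Icc] at h
      grind
  have hcasesB : ∀ z ∈ B₂, z ∈ P ∨ (z.re = b.re ∧ c - 2 ≤ z.im ∧ z.im ≤ c) ∨
      (z.re = t.re ∧ d ≤ z.im ∧ z.im ≤ d + 1) := by
    rintro z ((h | h) | h)
    · exact Or.inl h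
    all_goals
      simp only [Complex.mem_reProdIm, mem_Icc] at h
      grind
  refine not_disjoint_of_cross (A := A₄) (B := B₂) (a₀ := ⟨-L, c - 1⟩) (a₁ := ⟨L, c - 1⟩)
    (b₀ := ⟨b.re, c - 2⟩) (b₁ := ⟨t.re, d + 1⟩) ((((hA.union (hIcc _ _ _ _)).union
    (hIcc _ _ _ _)).union (hIcc _ _ _ _)).union (hIcc _ _ _ _)) hA₄c
    ((hP.isCompact.union (hIcc _ _ _ _)).union (hIcc _ _ _ _)) hB₂c
    ?_ ?_ ?_ ?_ ?_ ?_ ?_ ?_ ?_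
  · exact Or.inl (Or.inl (Or.inr (by simp [Complex.mem_reProdIm]; linarith)))
  · exact Or.inr (by simp [Complex.mem_reProdIm]; linarith)
  · exact Or.inl (Or.inr (by simp [Complex.mem_reProdIm]))
  · exact Or.inr (by simp [Complex.mem_reProdIm])
  · intro z hz
    rcases hcasesB z hz with h | h | h
    · exact (hLre z (Or.inr h)).1
    · exact hbL.1.trans_eq h.1.symm
    · exact htL.1.trans_eq h.1.symm
  · intro z hz
    rcases hcasesB z hz with h | h | h
    · exact (hLre z (Or.inr h)).2
    · exact h.1.trans_lt hbL.2
    · exact h.1.trans_lt htL.2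
  · intro z hz
    change c - 2 < z.im
    rcases hcases z hz with h | h | h | h | h
    · linarith [hAl z h]
    all_goals linarith [h.2]
  · intro z hz
    change z.im < d + 1
    rcases hcases z hz with h | h | h | h | h
    · linarith [hAu z h]
    all_goals linarith [h.2]
  · rw [disjoint_left]
    intro z hzA hzB
    have hnot : ∀ w : ℂ, w ∈ A → w ∉ P := fun w h => disjoint_left.1 hdisj h
    have e : ∀ w : ℂ, z.re = w.re → z.im = w.im → z = w := fun w => Complex.ext
    have hPl := hP.le_im z
    have hPu := hP.im_le z
    have hAl' := hAl z
    have hAu' := hAu z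
    rcases hcases z hzA with h | h | h | h | h <;> rcases hcasesB z hzB with h' | h' | h'
    · exact hnot z h h'
    · exact hnot z h (e b h'.1 (by linarith [hAl' h]) ▸ hb)
    · exact hnot z h (e t h'.1 (by linarith [hAu' h]) ▸ ht)
    · exact hnot z (e a h.1 (by linarith [hPl h']) ▸ ha) h'
    · linarith
    · exact hnot a ha (by rwa [← e t h'.1 (by linarith), e a h.1 (by linarith)] at ht)
    · linarith [hPl h']
    · linarith
    · linarith
    · exact hnot z (e a' h.1 (by linarith [hPl h']) ▸ ha') h'
    · linarith
    · exact hnot a' ha' (by rwa [← e t h'.1 (by linarith), e a' h.1 (by linarith)] at ht)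
    · linarith [hPl h']
    · linarith
    · linarith

open Complex in
/-- A continuum crossing a strip separates points to the left of all its points from bottom points
to its right. -/
lemma not_disjoint_of_left (hP : CrossesStrip P c d) (hA : IsCompact A) (hAc : IsPreconnected A)
    (hAl : ∀ z ∈ A, c ≤ z.im) (hAu : ∀ z ∈ A, z.im ≤ d) {a b a' : ℂ} (ha : a ∈ A)
    (haP : ∀ z ∈ P, a.re < z.re)
    (ha' : a' ∈ A) (hac' : a'.im = c) (hb : b ∈ P) (hbc : b.im = c)
    (hba : b.re < a'.re) : ¬ Disjoint A P := by
  intro hdisj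
  have hca := hAl a ha
  refine hP.not_disjoint (A := A ∪ Icc a.re a.re ×ℂ Icc c a.im) (a := ⟨a.re, c⟩)
    (hA.union (isCompact_Icc.reProdIm isCompact_Icc))
    (hAc.union a ha (by simpa [Complex.mem_reProdIm]) (isPreconnected_reProdIm_Icc _ _ _ _)) ?_ ?_
    (Or.inr (by simpa [Complex.mem_reProdIm])) rfl (Or.inl ha') hac' hb hbc (haP b hb) hba ?_
  · rintro z (h | h)
    · exact hAl z h
    · exact h.2.1
  · rintro z (h | h)
    · exact hAu z h
    · exact h.2.2.trans (hAu a ha)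
  · refine disjoint_union_left.2 ⟨hdisj, disjoint_left.2 fun z hz hzP => ?_⟩
    exact (haP z hzP).not_ge hz.1.2

/-- A connected set in a strip which comes close to three disjoint continua crossing the strip
meets one of them. -/
lemma false_of_lt_of_lt {K₁ K₂ K₃ N : Set ℂ} (h1 : CrossesStrip K₁ c d) (h2 : CrossesStrip K₂ c d)
    (h3 : CrossesStrip K₃ c d) (h12 : Disjoint K₁ K₂) (h32 : Disjoint K₃ K₂)
    (hN : IsPathConnected N) (hNl : ∀ z ∈ N, c ≤ z.im) (hNu : ∀ z ∈ N, z.im ≤ d)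
    (hN2 : Disjoint N K₂) {k₁ k₃ b₁ b₂ b₃ : ℂ} (hk1 : k₁ ∈ K₁) (hk3 : k₃ ∈ K₃)
    (hkN1 : k₁ ∈ closure N) (hkN3 : k₃ ∈ closure N) (hb1 : b₁ ∈ K₁) (hb2 : b₂ ∈ K₂) (hb3 : b₃ ∈ K₃)
    (hc1 : b₁.im = c) (hc2 : b₂.im = c) (hc3 : b₃.im = c) (hlt : b₁.re < b₂.re)
    (hlt' : b₂.re < b₃.re) : False := by
  have near : ∀ k, k ∉ K₂ → k ∈ closure N → ∃ n ∈ N, Disjoint (segment ℝ k n) K₂ := by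
    intro k hk hkN
    obtain ⟨ε, hε, hball⟩ := Metric.isOpen_iff.1 h2.isCompact.isClosed.isOpen_compl k hk
    obtain ⟨n, hn, hnk⟩ := Metric.mem_closure_iff.1 hkN ε hε
    refine ⟨n, hn, ?_⟩
    rw [← subset_compl_iff_disjoint_right]
    refine ((convex_ball k ε).segment_subset (mem_ball_self hε) ?_).trans hball
    rwa [mem_ball, dist_comm]
  have hstrip : Convex ℝ {z : ℂ | c ≤ z.im ∧ z.im ≤ d} :=
    (convex_halfSpace_im_ge c).inter (convex_halfSpace_im_le d)
  obtain ⟨n₁, hn1, hs1⟩ := near k₁ (disjoint_left.1 h12 hk1) hkN1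
  obtain ⟨n₃, hn3, hs3⟩ := near k₃ (disjoint_left.1 h32 hk3) hkN3
  obtain ⟨γ, hγ⟩ := hN.joinedIn n₁ hn1 n₃ hn3
  have hseg : ∀ x y : ℂ, IsCompact (segment ℝ x y) := fun x y => by
    rw [segment_eq_image_lineMap]
    exact isCompact_Icc.image AffineMap.lineMap_continuous
  have hpre : ∀ x y : ℂ, IsPreconnected (segment ℝ x y) := fun x y =>
    (convex_segment x y).isPreconnected
  have hK1 : ∀ z ∈ K₁, z ∈ {z : ℂ | c ≤ z.im ∧ z.im ≤ d} := fun z hz => ⟨h1.le_im z hz, h1.im_le z hz⟩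
  have hK3 : ∀ z ∈ K₃, z ∈ {z : ℂ | c ≤ z.im ∧ z.im ≤ d} := fun z hz => ⟨h3.le_im z hz, h3.im_le z hz⟩
  have hNs : ∀ z ∈ N, z ∈ {z : ℂ | c ≤ z.im ∧ z.im ≤ d} := fun z hz => ⟨hNl z hz, hNu z hz⟩
  set A := K₁ ∪ segment ℝ k₁ n₁ ∪ range γ ∪ segment ℝ k₃ n₃ ∪ K₃ with hA
  have hAs : A ⊆ {z : ℂ | c ≤ z.im ∧ z.im ≤ d} := by
    refine union_subset (union_subset (union_subset (union_subset hK1 ?_) ?_) ?_) hK3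
    · exact hstrip.segment_subset (hK1 _ hk1) (hNs _ hn1)
    · rintro _ ⟨t, rfl⟩
      exact hNs _ (hγ t)
    · exact hstrip.segment_subset (hK3 _ hk3) (hNs _ hn3)
  refine h2.not_disjoint (A := A) ?_ ?_ (fun z hz => (hAs hz).1) (fun z hz => (hAs hz).2)
    (Or.inl (Or.inl (Or.inl (Or.inl hb1)))) hc1 (Or.inr hb3) hc3 hb2 hc2 hlt hlt' ?_
  · exact (((h1.isCompact.union (hseg _ _)).union (isCompact_range γ.continuous)).union
      (hseg _ _)).union h3.isCompact
  · refine ((((h1.isPreconnected.union k₁ hk1 (left_mem_segment ℝ _ _) (hpre _ _)).union n₁ ?_ ?_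
      (isPreconnected_range γ.continuous)).union n₃ ?_ (right_mem_segment ℝ _ _)
      (hpre _ _)).union k₃ ?_ hk3 h3.isPreconnected)
    · exact Or.inr (right_mem_segment ℝ _ _)
    · exact ⟨0, γ.source⟩
    · exact Or.inr ⟨1, γ.target⟩
    · exact Or.inr (left_mem_segment ℝ _ _)
  · simp only [hA, disjoint_union_left]
    refine ⟨⟨⟨⟨h12, hs1⟩, ?_⟩, hs3⟩, h32⟩
    refine hN2.mono_left ?_
    rintro _ ⟨t, rfl⟩
    exact hγ t

lemma false_of_mem_closure {ι : Type*} {K : ι → Set ℂ} {N : Set ℂ} {i j k : ι}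
    (hK : ∀ i, CrossesStrip (K i) c d) (hdisj : Pairwise fun i j => Disjoint (K i) (K j))
    (hij : i ≠ j) (hik : i ≠ k) (hjk : j ≠ k) (hN : IsPathConnected N)
    (hNl : ∀ z ∈ N, c ≤ z.im) (hNu : ∀ z ∈ N, z.im ≤ d)
    (hcl : ∀ l ∈ ({i, j, k} : Set ι), Disjoint N (K l) ∧ ∃ z ∈ K l, z ∈ closure N) : False := by
  choose b hbK hbc using fun i => (hK i).exists_bot
  have hne : ∀ i j, i ≠ j → (b i).re ≠ (b j).re := fun i j hij h =>
    disjoint_left.1 (hdisj hij) (hbK i) (by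
      rw [Complex.ext h ((hbc i).trans (hbc j).symm)]
      exact hbK j)
  have key : ∀ p q r, p ∈ ({i, j, k} : Set ι) → q ∈ ({i, j, k} : Set ι) →
      r ∈ ({i, j, k} : Set ι) → p ≠ q → r ≠ q → (b p).re < (b q).re → (b q).re < (b r).re →
      False := by
    intro p q r hp hq hr hpq hrq h h'
    obtain ⟨-, z, hz, hzN⟩ := hcl p hp
    obtain ⟨-, w, hw, hwN⟩ := hcl r hr
    exact false_of_lt_of_lt (hK p) (hK q) (hK r) (hdisj hpq) (hdisj hrq) hN hNl hNu (hcl q hq).1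
      hz hw hzN hwN (hbK p) (hbK q) (hbK r) (hbc p) (hbc q) (hbc r) h h'
  have hi : i ∈ ({i, j, k} : Set ι) := by simp
  have hj : j ∈ ({i, j, k} : Set ι) := by simp
  have hk : k ∈ ({i, j, k} : Set ι) := by simp
  rcases lt_or_gt_of_ne (hne i j hij) with h1 | h1 <;>
  rcases lt_or_gt_of_ne (hne i k hik) with h2 | h2 <;>
  rcases lt_or_gt_of_ne (hne j k hjk) with h3 | h3
  · exact key i j k hi hj hk hij hjk.symm h1 h3
  · exact key i k j hi hk hj hik hjk h2 h3
  · linarith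
  · exact key k i j hk hi hj hik.symm hij.symm h2 h1
  · exact key j i k hj hi hk hij.symm hik.symm h1 h2
  · linarith
  · exact key j k i hj hk hi hjk hik h3 h2
  · exact key k j i hk hj hi hjk.symm hij h3 h1

open Complex in
/-- Finitely many small continua do not suffice to separate every two of infinitely many
disjoint continua crossing a strip. -/
lemma false_of_segment_inter {P : ℕ → Set ℂ} (hP : ∀ n, CrossesStrip (P n) c d)
    (hdisj : Pairwise fun i j => Disjoint (P i) (P j)) {ℳ : Set (Set ℂ)} (hfin : ℳ.Finite)
    (hcpt : ∀ M ∈ ℳ, IsCompact M) (hpre : ∀ M ∈ ℳ, IsPreconnected M)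
    (hMP : ∀ M ∈ ℳ, ∀ n, Disjoint M (P n))
    (hsmall : ∀ M ∈ ℳ, ∀ x ∈ M, ∀ y ∈ M, |x.im - y.im| ≤ (d - c) / 2)
    (hmeet : ∀ i j, i ≠ j → ∀ p ∈ P i, ∀ q ∈ P j, ∃ M ∈ ℳ, (segment ℝ p q ∩ M).Nonempty) :
    False := by
  choose b hbP hbc using fun n => (hP n).exists_bot
  choose t htP htd using fun n => (hP n).exists_top
  set m : ℝ := (c + d) / 2 with hm
  have hcd : c ≤ d := hbc 0 ▸ (hP 0).im_le _ (hbP 0)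
  have hz : ∀ n, ∃ z ∈ P n, z.im = m ∧ ∀ w ∈ P n, w.im = m → z.re ≤ w.re := by
    intro n
    have hne : (P n ∩ Complex.im ⁻¹' {m}).Nonempty := by
      obtain ⟨w, hw, hwm⟩ := (hP n).isPreconnected.intermediate_value (hbP n) (htP n)
        Complex.continuous_im.continuousOn (show m ∈ Icc (b n).im (t n).im by
          rw [hbc, htd]; constructor <;> linarith)
      exact ⟨w, hw, hwm⟩
    obtain ⟨z, hz, hmin⟩ := ((hP n).isCompact.inter_right
      (isClosed_singleton.preimage Complex.continuous_im)).exists_isMinOn hne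
      Complex.continuous_re.continuousOn
    exact ⟨z, hz.1, hz.2, fun w hw hwm => hmin ⟨hw, hwm⟩⟩
  choose z hzP hzm hzmin using hz
  have hfar : ∀ n, ∃ X : ℝ, ∀ w ∈ P n, X < w.re := fun n => by
    obtain ⟨R, hR⟩ := (hP n).isCompact.exists_norm_lt
    exact ⟨-R, fun w hw => (abs_lt.1 ((Complex.abs_re_le_norm w).trans_lt (hR w hw))).1⟩
  have hmono : ∀ i j, (b i).re < (b j).re → (z i).re < (z j).re := by
    intro i j hij
    by_contra! hji
    obtain ⟨X, hX⟩ := hfar i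
    have hne : i ≠ j := by rintro rfl; exact lt_irrefl _ hij
    have hXz : min X (z j).re ≤ (z j).re := min_le_right _ _
    refine (hP i).not_disjoint_of_left
      (A := P j ∪ Icc (min X (z j).re) (z j).re ×ℂ Icc m m) (a := ⟨min X (z j).re, m⟩)
      ((hP j).isCompact.union (isCompact_Icc.reProdIm isCompact_Icc))
      ((hP j).isPreconnected.union (z j) (hzP j) (by simp [Complex.mem_reProdIm, hzm])
        (isPreconnected_reProdIm_Icc _ _ _ _)) ?_ ?_ (Or.inr (by simp [Complex.mem_reProdIm]))
      (fun w hw => (min_le_left _ _).trans_lt (hX w hw)) (Or.inl (hbP j)) (hbc j) (hbP i) (hbc i)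
      hij ?_
    · rintro w (hw | hw)
      · exact (hP j).le_im w hw
      · have := hw.2.1
        linarith
    · rintro w (hw | hw)
      · exact (hP j).im_le w hw
      · have := hw.2.2
        linarith
    · refine disjoint_union_left.2 ⟨hdisj hne.symm, disjoint_left.2 fun w hw hwP => ?_⟩
      have hwm : w.im = m := le_antisymm hw.2.2 hw.2.1
      have h1 := hzmin i w hwP hwm
      have h2 : w.re ≤ (z j).re := hw.1.2
      refine disjoint_left.1 (hdisj hne) hwP ?_
      rw [show w = z j from Complex.ext (by linarith) (hwm.trans (hzm j).symm)]
      exact hzP j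
  have hbinj : ∀ i j, i ≠ j → (b i).re ≠ (b j).re := fun i j hij h =>
    disjoint_left.1 (hdisj hij) (hbP i) (by
      rw [Complex.ext h ((hbc i).trans (hbc j).symm)]
      exact hbP j)
  have hgap : ∀ i j, (b i).re < (b j).re → ∃ M ∈ ℳ, ∃ g ∈ M, g.im = m ∧ g.re ≤ (z j).re ∧
      ∀ w ∈ P i, w.im = m → w.re ≤ (z j).re → w.re ≤ g.re := by
    intro i j hij
    have hne : i ≠ j := by rintro rfl; exact lt_irrefl _ hij
    obtain ⟨y, hy, hmax⟩ := ((hP i).isCompact.inter_right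
      ((isClosed_singleton (x := m)).preimage Complex.continuous_im) |>.inter_right
      (isClosed_Iic (a := (z j).re) |>.preimage Complex.continuous_re)).exists_isMaxOn
      ⟨z i, ⟨hzP i, hzm i⟩, (hmono i j hij).le⟩ Complex.continuous_re.continuousOn
    obtain ⟨M, hM, g, hg, hgM⟩ := hmeet i j hne y hy.1.1 (z j) (hzP j)
    have hseg : segment ℝ y (z j) ⊆ Icc y.re (z j).re ×ℂ Icc m m := by
      have hconv : Convex ℝ (Icc y.re (z j).re ×ℂ Icc m m) :=
        ((convex_Icc y.re (z j).re).is_linear_preimage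
          Complex.reCLM.isBoundedLinearMap.toIsLinearMap).inter
        ((convex_Icc m m).is_linear_preimage Complex.imCLM.isBoundedLinearMap.toIsLinearMap)
      have hyr : y.re ≤ (z j).re := hy.2
      have hym : y.im = m := hy.1.2
      exact hconv.segment_subset (by simp [Complex.mem_reProdIm, hym, hyr])
        (by simp [Complex.mem_reProdIm, hzm, hyr])
    have := hseg hg
    exact ⟨M, hM, g, hgM, le_antisymm this.2.2 this.2.1, this.1.2,
      fun w hw hwm hwz => (hmax ⟨⟨hw, hwm⟩, hwz⟩ : w.re ≤ y.re).trans this.1.1⟩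
  obtain ⟨σ, hσ⟩ : ∃ σ : ℕ → ℕ, ∀ i j, i < j → j ≤ hfin.toFinset.card + 1 →
      (b (σ i)).re < (b (σ j)).re := by
    obtain ⟨g, hg | hg⟩ := exists_increasing_or_nonincreasing_subseq (· < ·) fun n => (b n).re
    · exact ⟨g, fun i j hij _ => hg i j hij⟩
    · refine ⟨fun i => g (hfin.toFinset.card + 1 - i), fun i j hij hj => ?_⟩
      have hlt : hfin.toFinset.card + 1 - j < hfin.toFinset.card + 1 - i := by omega
      exact lt_of_le_of_ne (not_lt.1 (hg _ _ hlt)) (hbinj _ _ (g.injective.ne hlt.ne'))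
  have hgap' : ∀ i, ∃ M, i ≤ hfin.toFinset.card → M ∈ ℳ ∧ ∃ g ∈ M, g.im = m ∧
      g.re ≤ (z (σ (i + 1))).re ∧
      ∀ w ∈ P (σ i), w.im = m → w.re ≤ (z (σ (i + 1))).re → w.re ≤ g.re := by
    intro i
    by_cases hi : i ≤ hfin.toFinset.card
    · obtain ⟨M, hM⟩ := hgap _ _ (hσ i (i + 1) i.lt_succ_self (by omega))
      exact ⟨M, fun _ => hM⟩
    · exact ⟨∅, fun h => absurd h hi⟩
  choose M hM using hgap'
  obtain ⟨i, hi, j, hj, hij, hMij⟩ := Finset.exists_ne_map_eq_of_card_lt_of_maps_to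
    (s := Finset.range (hfin.toFinset.card + 1)) (t := hfin.toFinset) (by simp) (f := M)
    fun i hi => by
      simpa using (hM i (Nat.lt_succ_iff.1 (Finset.mem_range.1 hi))).1
  wlog hlt : i < j generalizing i j
  · exact this j hj i hi hij.symm hMij.symm (by omega)
  rw [Finset.mem_range, Nat.lt_succ_iff] at hi hj
  obtain ⟨hMi, g, hgM, hgm, hgz, -⟩ := hM i hi
  obtain ⟨-, h, hhM, hhm, hhz, hhmax⟩ := hM j hj
  rw [← hMij] at hhM
  have hgzj : g.re ≤ (z (σ j)).re := by
    refine hgz.trans ?_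
    rcases (Nat.succ_le_of_lt hlt).eq_or_lt with heq | h'
    · rw [← heq]
    · exact (hmono _ _ (hσ _ _ h' (by omega))).le
  have hlast := hσ j (j + 1) j.lt_succ_self (by omega)
  have hne : σ j ≠ σ (j + 1) := fun h => by rw [h] at hlast; exact lt_irrefl _ hlast
  obtain ⟨X, hX⟩ := hfar (σ j)
  have hcp : ∀ x₀ x₁ y₀ y₁ : ℝ, IsCompact (Icc x₀ x₁ ×ℂ Icc y₀ y₁) :=
    fun _ _ _ _ => isCompact_Icc.reProdIm isCompact_Icc
  refine (hP (σ j)).not_disjoint_of_left (A := Icc (min X g.re) g.re ×ℂ Icc m m ∪ M i ∪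
    Icc h.re (z (σ (j + 1))).re ×ℂ Icc m m ∪ P (σ (j + 1))) (a := ⟨min X g.re, m⟩)
    ((((hcp _ _ _ _).union (hcpt _ hMi)).union (hcp _ _ _ _)).union (hP _).isCompact)
    ((((isPreconnected_reProdIm_Icc _ _ _ _).union g ?_ hgM (hpre _ hMi)).union h
      (Or.inr hhM) ?_ (isPreconnected_reProdIm_Icc _ _ _ _)).union (z (σ (j + 1))) (Or.inr ?_)
      (hzP _) (hP _).isPreconnected) ?_ ?_ (Or.inl (Or.inl (Or.inl ?_)))
    (fun w hw => (min_le_left _ _).trans_lt (hX w hw)) (Or.inr (hbP _)) (hbc _) (hbP _) (hbc _)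
    hlast ?_
  · simp [Complex.mem_reProdIm, hgm]
  · simp [Complex.mem_reProdIm, hhm, hhz]
  · simp [Complex.mem_reProdIm, hzm, hhz]
  · rintro w (((hw | hw) | hw) | hw)
    · have := hw.2.1
      linarith
    · have := abs_le.1 (hsmall _ hMi w hw g hgM)
      linarith
    · have := hw.2.1
      linarith
    · exact (hP _).le_im w hw
  · rintro w (((hw | hw) | hw) | hw)
    · have := hw.2.2
      linarith
    · have := abs_le.1 (hsmall _ hMi w hw g hgM)
      linarith
    · have := hw.2.2
      linarith
    · exact (hP _).im_le w hw
  · simp [Complex.mem_reProdIm]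
  · have hnot : ∀ w ∈ M i, w ∉ P (σ j) := fun w hw => disjoint_left.1 (hMP _ hMi _) hw
    simp only [disjoint_union_left]
    refine ⟨⟨⟨disjoint_left.2 fun w hw hwP => ?_, hMP _ hMi _⟩,
      disjoint_left.2 fun w hw hwP => ?_⟩, hdisj hne.symm⟩
    · have hwm : w.im = m := le_antisymm hw.2.2 hw.2.1
      have h1 := hzmin _ w hwP hwm
      have h2 : w.re ≤ g.re := hw.1.2
      exact hnot w ((Complex.ext (by linarith) (hwm.trans hgm.symm) : w = g) ▸ hgM) hwP
    · have hwm : w.im = m := le_antisymm hw.2.2 hw.2.1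
      have h1 := hhmax w hwP hwm hw.1.2
      have h2 : h.re ≤ w.re := hw.1.1
      exact hnot w ((Complex.ext (by linarith) (hwm.trans hhm.symm) : w = h) ▸ hhM) hwP

end CrossesStrip

/-! ### Boundary bumping -/

lemma exists_isClopen_mem_subset {X : Type*} [TopologicalSpace X] [CompactSpace X] [T2Space X]
    {x : X} {O : Set X} (hO : IsOpen O) (h : connectedComponent x ⊆ O) :
    ∃ W, IsClopen W ∧ x ∈ W ∧ W ⊆ O := by
  rw [connectedComponent_eq_iInter_isClopen] at h
  have : Nonempty { s : Set X // IsClopen s ∧ x ∈ s } := ⟨⟨univ, isClopen_univ, mem_univ x⟩⟩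
  obtain ⟨⟨W, hW, hxW⟩, hWO⟩ := hO.isClosed_compl.isCompact.elim_directed_family_closed
    (fun s : { s : Set X // IsClopen s ∧ x ∈ s } => (s : Set X)) (fun s => s.2.1.1)
    (by rwa [inter_comm, ← disjoint_iff_inter_eq_empty, disjoint_compl_right_iff_subset])
    (fun s t => ⟨⟨s ∩ t, s.2.1.inter t.2.1, s.2.2, t.2.2⟩, inter_subset_left, inter_subset_right⟩)
  refine ⟨W, hW, hxW, ?_⟩
  rwa [inter_comm, ← disjoint_iff_inter_eq_empty, disjoint_compl_right_iff_subset] at hWO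

/-- Boundary bumping: a component of a sublevel set of a continuum reaches the level set. -/
lemma exists_mem_connectedComponentIn_eq {E : Type*} [TopologicalSpace E] [T2Space E] {Q : Set E}
    (hQ : IsCompact Q) (hQc : IsPreconnected Q) {f : E → ℝ} (hf : Continuous f) {x y : E} {d : ℝ}
    (hx : x ∈ Q) (hxd : f x ≤ d) (hy : y ∈ Q) (hyd : d ≤ f y) :
    ∃ z ∈ connectedComponentIn (Q ∩ {w | f w ≤ d}) x, f z = d := by
  by_contra! hne
  set S : Set E := Q ∩ {w | f w ≤ d} with hS
  have hScpt : IsCompact S := hQ.inter_right (isClosed_le hf continuous_const)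
  have hxS : x ∈ S := ⟨hx, hxd⟩
  have : CompactSpace S := isCompact_iff_compactSpace.1 hScpt
  rw [connectedComponentIn_eq_image hxS] at hne
  obtain ⟨W, hW, hxW, hWO⟩ := exists_isClopen_mem_subset (x := (⟨x, hxS⟩ : S))
    (O := {w : S | f w < d}) (isOpen_lt (by fun_prop) continuous_const) fun w hw =>
      lt_of_le_of_ne w.2.2 (hne w ⟨w, hw, rfl⟩)
  have hVc : IsClosed ((↑) '' W : Set E) :=
    (hW.1.isCompact.image continuous_subtype_val).isClosed
  have hVc' : IsClosed ((↑) '' Wᶜ : Set E) :=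
    (hW.2.isClosed_compl.isCompact.image continuous_subtype_val).isClosed
  have hcover : Q ⊆ (↑) '' W ∪ ((↑) '' Wᶜ ∪ {w | d ≤ f w}) := by
    intro w hw
    rcases le_total d (f w) with h | h
    · exact Or.inr (Or.inr h)
    · by_cases hwW : (⟨w, hw, h⟩ : S) ∈ W
      · exact Or.inl ⟨_, hwW, rfl⟩
      · exact Or.inr (Or.inl ⟨_, hwW, rfl⟩)
  obtain ⟨w, -, ⟨u, hu, rfl⟩, hw⟩ := isPreconnected_closed_iff.1 hQc _ _ hVc
    (hVc'.union (isClosed_le continuous_const hf)) hcover ⟨x, hx, ⟨_, hxW, rfl⟩⟩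
    ⟨y, hy, Or.inr hyd⟩
  rcases hw with ⟨v, hv, hvu⟩ | hw
  · exact hv (Subtype.ext hvu ▸ hu)
  · exact absurd (show f u < d from hWO hu) (not_lt.2 hw)

lemma IsCompact.connectedComponentIn {E : Type*} [TopologicalSpace E] [T2Space E] {S : Set E}
    (hS : IsCompact S) (x : E) : IsCompact (_root_.connectedComponentIn S x) := by
  by_cases hx : x ∈ S
  · have : CompactSpace S := isCompact_iff_compactSpace.1 hS
    rw [connectedComponentIn_eq_image hx]
    exact isClosed_connectedComponent.isCompact.image continuous_subtype_val
  · rw [connectedComponentIn_eq_empty hx]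
    exact isCompact_empty

/-- A continuum with points on both sides of a strip contains a continuum crossing the strip. -/
lemma exists_subset_crossing {E : Type*} [TopologicalSpace E] [T2Space E] {Q : Set E}
    (hQ : IsCompact Q) (hQc : IsPreconnected Q) {f : E → ℝ} (hf : Continuous f) {x y : E} {c d : ℝ}
    (hcd : c ≤ d) (hx : x ∈ Q) (hxc : f x ≤ c) (hy : y ∈ Q) (hyd : d ≤ f y) :
    ∃ P ⊆ Q, IsCompact P ∧ IsPreconnected P ∧ (∀ z ∈ P, c ≤ f z) ∧ (∀ z ∈ P, f z ≤ d) ∧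
      (∃ z ∈ P, f z = c) ∧ ∃ z ∈ P, f z = d := by
  obtain ⟨z, hz, hzd⟩ := exists_mem_connectedComponentIn_eq hQ hQc hf hx (hxc.trans hcd) hy hyd
  have hScpt : IsCompact (Q ∩ {w | f w ≤ d}) := hQ.inter_right (isClosed_le hf continuous_const)
  set Q' := connectedComponentIn (Q ∩ {w | f w ≤ d}) x with hQ'
  have hQ'cpt : IsCompact Q' := hScpt.connectedComponentIn x
  obtain ⟨w, hw, hwc⟩ := exists_mem_connectedComponentIn_eq (f := fun w => -f w) (d := -c)
    hQ'cpt isPreconnected_connectedComponentIn hf.neg hz (by linarith)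
    (mem_connectedComponentIn ⟨hx, hxc.trans hcd⟩) (by linarith)
  have hsub := connectedComponentIn_subset (Q' ∩ {w | -f w ≤ -c}) z
  have hsub' := connectedComponentIn_subset (Q ∩ {w | f w ≤ d}) x
  refine ⟨connectedComponentIn (Q' ∩ {w | -f w ≤ -c}) z, fun u hu => (hsub' (hsub hu).1).1,
    (hQ'cpt.inter_right (isClosed_le hf.neg continuous_const)).connectedComponentIn z,
    isPreconnected_connectedComponentIn, fun u hu => ?_, fun u hu => (hsub' (hsub hu).1).2,
    ⟨w, hw, by linarith⟩, ⟨z, mem_connectedComponentIn ⟨hz, ?_⟩, hzd⟩⟩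
  · have : -f u ≤ -c := (hsub hu).2
    linarith
  · change -f z ≤ -c
    linarith

/-- Among infinitely many uniformly large continua in a bounded set, infinitely many cross a common
strip, possibly after a rotation. -/
lemma exists_crossesStrip {D : ℕ → Set ℂ} {K : Set ℂ} (hK : IsCompact K) (hDK : ∀ n, D n ⊆ K)
    (hD : ∀ n, IsCompact (D n)) (hDc : ∀ n, IsPreconnected (D n)) {C : ℝ} (hC : 0 < C)
    (hlarge : ∀ n, ∃ p ∈ D n, ∃ q ∈ D n, C ≤ dist p q) :
    ∃ θ : ℂ, ‖θ‖ = 1 ∧ ∃ c d : ℝ, c < d ∧ ∃ φ : ℕ → ℕ, StrictMono φ ∧ ∃ P : ℕ → Set ℂ,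
      (∀ n, P n ⊆ D (φ n)) ∧ ∀ n, CrossesStrip ((fun z => θ * z) '' P n) c d := by
  choose p hp q hq hpq using hlarge
  have hdir : ∀ n, C / 2 ≤ |(1 * p n).im - (1 * q n).im| ∨
      C / 2 ≤ |(Complex.I * p n).im - (Complex.I * q n).im| := by
    intro n
    by_contra! h
    have h1 := Complex.norm_le_abs_re_add_abs_im (p n - q n)
    have h2 := hpq n
    rw [dist_eq_norm] at h2
    simp only [one_mul, Complex.I_mul_im, Complex.sub_re, Complex.sub_im] at h h1
    linarith
  obtain ⟨θ, hθ, hfreq⟩ : ∃ θ : ℂ, ‖θ‖ = 1 ∧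
      ∃ᶠ n in atTop, C / 2 ≤ |(θ * p n).im - (θ * q n).im| := by
    have : ∃ᶠ n in (atTop : Filter ℕ), C / 2 ≤ |(1 * p n).im - (1 * q n).im| ∨
      C / 2 ≤ |(Complex.I * p n).im - (Complex.I * q n).im| := (Eventually.of_forall hdir).frequently
    rcases frequently_or_distrib.1 this with h | h
    · exact ⟨1, by simp, h⟩
    · exact ⟨Complex.I, by simp, h⟩
  obtain ⟨φ, hφ, hφC⟩ := extraction_of_frequently_atTop hfreq
  have hswap : ∀ n, ∃ x ∈ D (φ n), ∃ y ∈ D (φ n), (θ * x).im + C / 2 ≤ (θ * y).im := by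
    intro n
    rcases le_abs.1 (hφC n) with h | h
    · exact ⟨q _, hq _, p _, hp _, by linarith⟩
    · exact ⟨p _, hp _, q _, hq _, by linarith⟩
  choose x hx y hy hxy using hswap
  obtain ⟨a, -, ψ, hψ, hlim⟩ := hK.tendsto_subseq fun n => hDK _ (hx n)
  have hcont : Continuous fun z : ℂ => (θ * z).im :=
    Complex.continuous_im.comp (continuous_const.mul continuous_id)
  have hlim' := (hcont.tendsto a).comp hlim
  obtain ⟨N, hN⟩ := (Metric.tendsto_atTop.1 hlim') (C / 8) (by positivity)
  set ℓ := (θ * a).im with hℓ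
  have hcross : ∀ n, ∃ P ⊆ D (φ (ψ (n + N))), IsCompact P ∧ IsPreconnected P ∧
      (∀ z ∈ P, ℓ + C / 8 ≤ (θ * z).im) ∧ (∀ z ∈ P, (θ * z).im ≤ ℓ + C / 4) ∧
      (∃ z ∈ P, (θ * z).im = ℓ + C / 8) ∧ ∃ z ∈ P, (θ * z).im = ℓ + C / 4 := by
    intro n
    have h := hN (n + N) (Nat.le_add_left _ _)
    rw [Real.dist_eq, abs_lt] at h
    simp only [Function.comp_apply] at h
    have h2 := hxy (ψ (n + N))
    exact exists_subset_crossing (hD _) (hDc _) hcont (by linarith) (hx _) (by linarith)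
      (hy (ψ (n + N))) (by linarith)
  choose P hPD hPc hPp h1 h2 h3 h4 using hcross
  refine ⟨θ, hθ, ℓ + C / 8, ℓ + C / 4, by linarith, fun n => φ (ψ (n + N)),
    fun i j hij => hφ (hψ (by omega)), P, hPD, fun n => ?_⟩
  have hcont' : Continuous fun z : ℂ => θ * z := continuous_const.mul continuous_id
  exact ⟨(hPc n).image hcont', (hPp n).image _ hcont'.continuousOn, forall_mem_image.2 (h1 n),
    forall_mem_image.2 (h2 n), exists_mem_image.2 (h3 n), exists_mem_image.2 (h4 n)⟩

/-! ### Families of disjoint large continua -/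

/-- `K` contains no infinite family of disjoint continua with diameters bounded below. -/
def NoLargeFamily (K : Set ℂ) : Prop :=
  ∀ C > (0 : ℝ), ∀ D : ℕ → Set ℂ, (∀ n, D n ⊆ K) → (∀ n, IsCompact (D n)) →
    (∀ n, IsPreconnected (D n)) → (Pairwise fun i j => Disjoint (D i) (D j)) →
    ¬ ∀ n, ∃ p ∈ D n, ∃ q ∈ D n, C ≤ dist p q

/-- Every point of `K` has a neighbourhood in `K` contained in the closure of finitely many small
path connected sets which avoid the other points of `K`. -/
def LocallyReachable (K : Set ℂ) : Prop :=
  ∀ k ∈ K, ∀ ε > (0 : ℝ), ∃ δ > (0 : ℝ), ∃ 𝒩 : Set (Set ℂ), 𝒩.Finite ∧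
    (∀ N ∈ 𝒩, IsPathConnected N ∧ N ⊆ ball k ε ∧ N ∩ K ⊆ {k}) ∧
    K ∩ ball k δ ⊆ ⋃ N ∈ 𝒩, closure N

lemma LocallyReachable.noLargeFamily {K : Set ℂ} (hK : IsCompact K) (h : LocallyReachable K) :
    NoLargeFamily K := by
  intro C hC D hDK hD hDc hdisj hlarge
  obtain ⟨θ, hθ, c, d, hcd, φ, hφ, P, hPD, hP⟩ := exists_crossesStrip hK hDK hD hDc hC hlarge
  have hθ0 : θ ≠ 0 := norm_ne_zero_iff.1 (by simp [hθ])
  have hinj : Function.Injective fun z : ℂ => θ * z := mul_right_injective₀ hθ0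
  have hcont : Continuous fun z : ℂ => θ * z := continuous_const.mul continuous_id
  have hPdisj : Pairwise fun i j => Disjoint (P i) (P j) := fun i j hij =>
    (hdisj (hφ.injective.ne hij)).mono (hPD i) (hPD j)
  have hmid : ∀ n, ∃ z ∈ P n, (θ * z).im = (c + d) / 2 := by
    intro n
    obtain ⟨b, hb, hbc⟩ := (hP n).exists_bot
    obtain ⟨t, ht, htd⟩ := (hP n).exists_top
    obtain ⟨w, ⟨z, hz, rfl⟩, hwm⟩ := (hP n).isPreconnected.intermediate_value hb ht
      Complex.continuous_im.continuousOn (show (c + d) / 2 ∈ Icc b.im t.im by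
        rw [hbc, htd]; constructor <;> linarith)
    exact ⟨z, hz, hwm⟩
  choose z hzP hzm using hmid
  have hzK : ∀ n, z n ∈ K := fun n => hDK _ (hPD n (hzP n))
  obtain ⟨k, hk, ψ, hψ, hlim⟩ := hK.tendsto_subseq hzK
  have hkm : (θ * k).im = (c + d) / 2 := by
    have h1 := ((Complex.continuous_im.comp hcont).tendsto k).comp hlim
    refine tendsto_nhds_unique h1 ?_
    simp only [Function.comp_def, hzm, tendsto_const_nhds_iff]
  obtain ⟨δ, hδ, 𝒩, hfin, h𝒩, hcov⟩ := h k hk ((d - c) / 4) (by linarith)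
  have hev : ∀ᶠ n in atTop, ∃ N ∈ 𝒩, z (ψ n) ∈ closure N ∧ k ∉ P (ψ n) := by
    have h1 : ∀ᶠ n in atTop, z (ψ n) ∈ ball k δ := hlim (ball_mem_nhds k hδ)
    have h2 : ∀ᶠ n in atTop, k ∉ P (ψ n) := by
      by_cases hex : ∃ m, k ∈ P m
      · obtain ⟨m, hm⟩ := hex
        filter_upwards [hψ.tendsto_atTop.eventually_gt_atTop m] with n hn hkn
        exact disjoint_left.1 (hPdisj hn.ne) hm hkn
      · push Not at hex
        exact Eventually.of_forall fun n => hex _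
    filter_upwards [h1, h2] with n hn hn'
    obtain ⟨N, hN, hzN⟩ := mem_iUnion₂.1 (hcov ⟨hzK _, hn⟩)
    exact ⟨N, hN, hzN, hn'⟩
  obtain ⟨N, hN, hinf⟩ : ∃ N ∈ 𝒩, {n | z (ψ n) ∈ closure N ∧ k ∉ P (ψ n)}.Infinite := by
    by_contra! hno
    have hfin' : (⋃ N ∈ 𝒩, {n | z (ψ n) ∈ closure N ∧ k ∉ P (ψ n)}).Finite :=
      hfin.biUnion fun N hN => hno N hN
    obtain ⟨m, hm⟩ := eventually_atTop.1 hev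
    refine (infinite_of_injective_forall_mem (f := fun n => n + m) (add_left_injective m)
      fun n => ?_) hfin'
    obtain ⟨N, hN, hh⟩ := hm (n + m) (Nat.le_add_left _ _)
    exact mem_iUnion₂.2 ⟨N, hN, hh⟩
  obtain ⟨t, ht, htc⟩ := hinf.exists_subset_card_eq 3
  obtain ⟨i, j, l, hij, hil, hjl, rfl⟩ := Finset.card_eq_three.1 htc
  obtain ⟨hNp, hNb, hNK⟩ := h𝒩 N hN
  have him : ∀ w ∈ N, |(θ * w).im - (θ * k).im| < (d - c) / 4 := fun w hw => by
    have h1 := Complex.abs_im_le_norm (θ * w - θ * k)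
    rw [← mul_sub, norm_mul, hθ, one_mul, mul_sub, Complex.sub_im] at h1
    have h2 := mem_ball_iff_norm.1 (hNb hw)
    linarith
  have him' := fun w hw => abs_lt.1 (him w hw)
  refine CrossesStrip.false_of_mem_closure (N := (fun z => θ * z) '' N) (i := ψ i) (j := ψ j)
    (k := ψ l) hP
    (fun a b hab => (disjoint_image_iff hinj).2 (hPdisj hab)) (hψ.injective.ne hij)
    (hψ.injective.ne hil) (hψ.injective.ne hjl) (hNp.image hcont) ?_ ?_ ?_
  · rintro _ ⟨w, hw, rfl⟩
    have := him' w hw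
    change c ≤ (θ * w).im
    linarith
  · rintro _ ⟨w, hw, rfl⟩
    have := him' w hw
    change (θ * w).im ≤ d
    linarith
  · have key : ∀ n ∈ ({i, j, l} : Finset ℕ), Disjoint ((fun z => θ * z) '' N)
        ((fun z => θ * z) '' P (ψ n)) ∧
        ∃ z ∈ (fun z => θ * z) '' P (ψ n), z ∈ closure ((fun z => θ * z) '' N) := by
      intro n hn
      have hn' := ht hn
      refine ⟨(disjoint_image_iff hinj).2 (disjoint_left.2 fun w hw hwP => hn'.2 ?_),
        _, mem_image_of_mem _ (hzP _), image_closure_subset_closure_image hcont ⟨_, hn'.1, rfl⟩⟩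
      rwa [← (hNK ⟨hw, hDK _ (hPD _ hwP)⟩ : w = k)]
    rintro m (rfl | rfl | rfl)
    · exact key i (by simp)
    · exact key j (by simp)
    · exact key l (by simp)

lemma LocallyAccessible.locallyReachable {Ω : Set ℂ} (hΩ : IsOpen Ω)
    (h : ∀ x ∈ frontier Ω, LocallyAccessible Ω x) : LocallyReachable (frontier Ω) := by
  intro k hk ε hε
  obtain ⟨δ, hδ, hacc⟩ := h k hk ε hε
  set N : Set ℂ := ⋃₀ {A | (∃ z ∈ Ω, IsArcFromTo A z k) ∧ A ⊆ Ω ∪ {k} ∧ diam A < ε} with hN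
  have harc : ∀ A z, IsArcFromTo A z k → z ∈ A ∧ k ∈ A ∧ IsCompact A ∧ IsPathConnected A := by
    rintro A z ⟨f, hf, -, rfl, rfl, rfl⟩
    refine ⟨⟨0, by simp, rfl⟩, ⟨1, by simp, rfl⟩, isCompact_Icc.image_of_continuousOn hf, ?_⟩
    exact ((convex_Icc (0 : ℝ) 1).isPathConnected ⟨0, by simp⟩).image' hf
  obtain ⟨z₀, hz₀, hz₀k⟩ := Metric.mem_closure_iff.1 (frontier_subset_closure hk) δ hδ
  obtain ⟨A₀, hA₀, hA₀'⟩ := hacc z₀ hz₀ (by rwa [dist_comm])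
  have hsub : Ω ∩ ball k δ ⊆ N := fun z hz => by
    obtain ⟨A, hA, hA'⟩ := hacc z hz.1 hz.2
    exact mem_sUnion.2 ⟨A, ⟨⟨z, hz.1, hA⟩, hA'⟩, (harc A z hA).1⟩
  refine ⟨δ, hδ, {N}, finite_singleton N, ?_, ?_⟩
  · rintro _ rfl
    refine ⟨⟨k, ⟨A₀, ⟨⟨z₀, hz₀, hA₀⟩, hA₀'⟩, (harc A₀ z₀ hA₀).2.1⟩, ?_⟩, ?_, ?_⟩
    · rintro w ⟨A, hA, hw⟩
      obtain ⟨⟨z, -, hz⟩, -⟩ := id hA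
      obtain ⟨-, hkA, -, hpath⟩ := harc A z hz
      exact (hpath.joinedIn k hkA w hw).mono (subset_sUnion_of_mem hA)
    · rintro w ⟨A, ⟨⟨z, -, hz⟩, -, hd⟩, hw⟩
      obtain ⟨-, hkA, hcpt, -⟩ := harc A z hz
      exact (dist_le_diam_of_mem hcpt.isBounded hw hkA).trans_lt hd
    · rintro w ⟨⟨A, ⟨-, hA, -⟩, hw⟩, hwK⟩
      rcases hA hw with h | h
      · exact absurd hwK (by rw [hΩ.frontier_eq]; exact fun h' => h'.2 h)
      · exact h
  · rintro w ⟨hw, hwδ⟩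
    simp only [mem_singleton_iff, iUnion_iUnion_eq_left]
    refine closure_mono hsub ?_
    rw [inter_comm]
    exact isOpen_ball.inter_closure ⟨hwδ, frontier_subset_closure hw⟩

lemma LocallySeqAccessible.exists_finite {Ω : Set ℂ} {ξ : ℂ} (h : LocallySeqAccessible Ω ξ)
    {r : ℝ} (hr : 0 < r) : ∃ δ > 0, δ ≤ r ∧ ∃ F : Finset ℂ,
      Ω ∩ ball ξ δ ⊆ ⋃ x ∈ F, connectedComponentIn (Ω ∩ ball ξ r) x := by
  by_contra! hno
  have hstep : ∀ (n : ℕ) (F : Finset ℂ), ∃ y, (y ∈ Ω ∧ dist y ξ < 1 / (n + 1)) ∧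
      ∀ x ∈ F, y ∉ connectedComponentIn (Ω ∩ ball ξ r) x := by
    intro n F
    have hpos : (0 : ℝ) < 1 / (n + 1) := Nat.one_div_pos_of_nat
    obtain ⟨y, hy, hyF⟩ := not_subset.1 (hno (min r (1 / (n + 1))) (lt_min hr hpos)
      (min_le_left _ _) F)
    refine ⟨y, ⟨hy.1, (mem_ball.1 hy.2).trans_le (min_le_right _ _)⟩, fun x hx hxy => hyF ?_⟩
    exact mem_iUnion₂.2 ⟨x, hx, hxy⟩
  obtain ⟨f, hf, hf'⟩ := exists_seq_of_forall_finset_exists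
    (P := fun p : ℕ × ℂ => p.2 ∈ Ω ∧ dist p.2 ξ < 1 / (p.1 + 1))
    (fun p q : ℕ × ℂ => p.1 < q.1 ∧ q.2 ∉ connectedComponentIn (Ω ∩ ball ξ r) p.2) (by
      intro s _
      obtain ⟨y, hy, hys⟩ := hstep (s.sup Prod.fst + 1) (s.image Prod.snd)
      exact ⟨(s.sup Prod.fst + 1, y), hy, fun x hx =>
        ⟨Nat.lt_succ_of_le (Finset.le_sup (f := Prod.fst) hx),
          hys _ (Finset.mem_image_of_mem _ hx)⟩⟩)
  have hmono : StrictMono fun n => (f n).1 := fun i j hij => (hf' i j hij).1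
  obtain ⟨x, -, hx⟩ := h r hr (fun n => (f n).2) (fun n => (hf n).1) (by
    rw [tendsto_iff_dist_tendsto_zero]
    refine squeeze_zero (fun _ => dist_nonneg) (fun n => (hf n).2.le) ?_
    exact tendsto_one_div_add_atTop_nhds_zero_nat.comp hmono.tendsto_atTop)
  obtain ⟨i, hi⟩ := hx.nonempty
  obtain ⟨j, hj, hij⟩ := hx.exists_gt i
  refine (hf' i j hij).2 ?_
  rwa [← connectedComponentIn_eq hi]

lemma LocallySeqAccessible.locallyReachable {Ω : Set ℂ} (hΩ : IsOpen Ω)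
    (h : ∀ x ∈ frontier Ω, LocallySeqAccessible Ω x) : LocallyReachable (frontier Ω) := by
  intro k hk ε hε
  obtain ⟨δ, hδ, hδε, F, hF⟩ := (h k hk).exists_finite hε
  have hopen : IsOpen (Ω ∩ ball k ε) := hΩ.inter isOpen_ball
  refine ⟨δ, hδ, connectedComponentIn (Ω ∩ ball k ε) '' (F ∩ (Ω ∩ ball k ε)),
    (F.finite_toSet.inter_of_left _).image _, ?_, ?_⟩
  · rintro _ ⟨x, hx, rfl⟩
    have hsub := connectedComponentIn_subset (Ω ∩ ball k ε) x
    refine ⟨?_, hsub.trans inter_subset_right, ?_⟩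
    · rw [← hopen.connectedComponentIn.isConnected_iff_isPathConnected]
      exact ⟨⟨x, mem_connectedComponentIn hx.2⟩, isPreconnected_connectedComponentIn⟩
    · rintro w ⟨hw, hwK⟩
      rw [hΩ.frontier_eq] at hwK
      exact absurd (hsub hw).1 hwK.2
  · rintro w ⟨hw, hwδ⟩
    have h1 : w ∈ closure (⋃ x ∈ F, connectedComponentIn (Ω ∩ ball k ε) x) :=
      closure_mono (by rw [inter_comm]; exact hF)
        (isOpen_ball.inter_closure ⟨hwδ, frontier_subset_closure hw⟩)
    rw [Finset.closure_biUnion] at h1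
    obtain ⟨x, hx, hwx⟩ := mem_iUnion₂.1 h1
    have hxΩ : x ∈ Ω ∩ ball k ε := by
      by_contra hx'
      simp [connectedComponentIn_eq_empty hx'] at hwx
    exact mem_iUnion₂.2 ⟨_, ⟨x, ⟨hx, hxΩ⟩, rfl⟩, hwx⟩

lemma exists_le_dist_of_lt_diam {S : Set ℂ} {C : ℝ} (hC : 0 ≤ C) (h : C < diam S) :
    ∃ p ∈ S, ∃ q ∈ S, C ≤ dist p q := by
  by_contra! hno
  exact absurd (diam_le_of_forall_dist_le hC fun p hp q hq => (hno p hp q hq).le) (not_le.2 h)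

lemma connectedComponentIn_disjoint_of_ne {X : Type*} [TopologicalSpace X] {F : Set X} {x y : X}
    (h : connectedComponentIn F x ≠ connectedComponentIn F y) :
    Disjoint (connectedComponentIn F x) (connectedComponentIn F y) :=
  disjoint_left.2 fun _ hx hy => h ((connectedComponentIn_eq hx).trans (connectedComponentIn_eq hy).symm)

lemma NoLargeFamily.finite_setOf_lt_diam {K : Set ℂ} (hK : IsCompact K) (h : NoLargeFamily K)
    {C : ℝ} (hC : 0 < C) :
    {Q : Set ℂ | (∃ x ∈ K, Q = connectedComponentIn K x) ∧ C < diam Q}.Finite := by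
  by_contra hinf
  set e := Set.Infinite.natEmbedding _ hinf
  choose x hx hQ using fun n => (e n).2.1
  refine h C hC (fun n => e n) (fun n => ?_) (fun n => ?_) (fun n => ?_) (fun i j hij => ?_)
    fun n => exists_le_dist_of_lt_diam hC.le (e n).2.2
  · rw [hQ]
    exact connectedComponentIn_subset _ _
  · rw [hQ]
    exact hK.connectedComponentIn _
  · rw [hQ]
    exact isPreconnected_connectedComponentIn
  · have hne : (e i : Set ℂ) ≠ e j := fun h' => hij (e.injective (Subtype.ext h'))
    simp only [hQ] at hne ⊢
    exact connectedComponentIn_disjoint_of_ne hne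

lemma NoLargeFamily.exists_ball_subset {Q : Set ℂ} (hQ : IsCompact Q) (hQc : IsPreconnected Q)
    (h : NoLargeFamily Q) {y : ℂ} (hy : y ∈ Q) {ρ : ℝ} (hρ : 0 < ρ) :
    ∃ δ > 0, Q ∩ ball y δ ⊆ connectedComponentIn (Q ∩ closedBall y ρ) y := by
  by_contra! hno
  have hcl : {w | dist w y ≤ ρ} = closedBall y ρ := rfl
  set T := Q ∩ closedBall y ρ with hT
  have hTc : IsCompact T := hQ.inter_right isClosed_closedBall
  have hyT : y ∈ T := ⟨hy, mem_closedBall_self hρ.le⟩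
  obtain ⟨w, hw, hww⟩ := exists_seq_of_forall_finset_exists
    (P := fun w => w ∈ Q ∩ ball y (ρ / 2) ∧ w ∉ connectedComponentIn T y)
    (fun x w => w ∉ connectedComponentIn T x) (by
      intro s hs
      have hcc : IsClosed (⋃ x ∈ s, connectedComponentIn T x) :=
        s.finite_toSet.isClosed_biUnion fun x _ => (hTc.connectedComponentIn x).isClosed
      have hys : y ∉ ⋃ x ∈ s, connectedComponentIn T x := fun hys => by
        obtain ⟨x, hx, hyx⟩ := mem_iUnion₂.1 hys
        refine (hs x hx).2 ?_
        rw [← connectedComponentIn_eq hyx]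
        exact mem_connectedComponentIn ⟨(hs x hx).1.1,
          ball_subset_closedBall (ball_subset_ball (by linarith) (hs x hx).1.2)⟩
      obtain ⟨δ, hδ, hδs⟩ := Metric.isOpen_iff.1 hcc.isOpen_compl y hys
      obtain ⟨w, hw, hwy⟩ := not_subset.1 (hno (min δ (ρ / 2)) (lt_min hδ (by linarith)))
      refine ⟨w, ⟨⟨hw.1, ball_subset_ball (min_le_right _ _) hw.2⟩, hwy⟩, fun x hx hwx => ?_⟩
      exact hδs (ball_subset_ball (min_le_left _ _) hw.2) (mem_iUnion₂.2 ⟨x, hx, hwx⟩))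
  have hwT : ∀ n, w n ∈ T := fun n => ⟨(hw n).1.1,
    ball_subset_closedBall (ball_subset_ball (by linarith) (hw n).1.2)⟩
  have hsub : ∀ n, connectedComponentIn T (w n) ⊆ T := fun n => connectedComponentIn_subset _ _
  by_cases hex : ∃ q ∈ Q, ρ ≤ dist q y
  · obtain ⟨q, hq, hqρ⟩ := hex
    have hdisj : ∀ i j, i < j → Disjoint (connectedComponentIn T (w i))
        (connectedComponentIn T (w j)) := fun i j hij =>
      connectedComponentIn_disjoint_of_ne fun h' => hww i j hij (by
        rw [h']
        exact mem_connectedComponentIn (hwT j))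
    refine h (ρ / 2) (by linarith) (fun n => connectedComponentIn T (w n))
      (fun n => (hsub n).trans inter_subset_left) (fun n => hTc.connectedComponentIn _)
      (fun n => isPreconnected_connectedComponentIn) (fun i j hij => ?_) fun n => ?_
    · rcases lt_or_gt_of_ne hij with h' | h'
      · exact hdisj i j h'
      · exact (hdisj j i h').symm
    · obtain ⟨z, hz, hzρ⟩ := exists_mem_connectedComponentIn_eq hQ hQc
        (f := fun w => dist w y) (by fun_prop) (hwT n).1 (hwT n).2 hq hqρ
      refine ⟨z, hz, w n, mem_connectedComponentIn (hwT n), ?_⟩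
      have h1 := dist_triangle z (w n) y
      have h2 := mem_ball.1 (hw n).1.2
      linarith
  · push Not at hex
    have hTQ : T = Q := inter_eq_left.2 fun q hq => (hex q hq).le
    refine (hw 0).2 ?_
    rw [hTQ]
    exact hQc.subset_connectedComponentIn hy subset_rfl (hw 0).1.1

lemma locallyConnectedSpace_of_exists_ball_subset {Q : Set ℂ}
    (h : ∀ y ∈ Q, ∀ ρ > (0 : ℝ), ∃ δ > 0,
      Q ∩ ball y δ ⊆ connectedComponentIn (Q ∩ closedBall y ρ) y) : LocallyConnectedSpace Q := by
  rw [locallyConnectedSpace_iff_connected_subsets]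
  rintro ⟨y, hy⟩ U hU
  obtain ⟨ρ, hρ, hρU⟩ := Metric.nhds_basis_closedBall.mem_iff.1 hU
  obtain ⟨δ, hδ, hδs⟩ := h y hy ρ hρ
  have hsub := connectedComponentIn_subset (Q ∩ closedBall y ρ) y
  refine ⟨(↑) ⁻¹' connectedComponentIn (Q ∩ closedBall y ρ) y, ?_, ?_, ?_⟩
  · filter_upwards [ball_mem_nhds (⟨y, hy⟩ : Q) hδ] with w hw
    exact hδs ⟨w.2, hw⟩
  · refine Topology.IsInducing.subtypeVal.isPreconnected_image.1 ?_
    rw [Subtype.image_preimage_coe, inter_eq_right.2 (hsub.trans inter_subset_left)]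
    exact isPreconnected_connectedComponentIn
  · exact fun w hw => hρU (hsub hw).2

lemma NoLargeFamily.isPeanoCompactum {K : Set ℂ} (hK : IsCompact K) (h : NoLargeFamily K) :
    IsPeanoCompactum K := by
  refine ⟨hK, fun x _ => locallyConnectedSpace_of_exists_ball_subset fun y hy ρ hρ => ?_,
    fun C hC => h.finite_setOf_lt_diam hK hC⟩
  refine NoLargeFamily.exists_ball_subset (hK.connectedComponentIn x)
    isPreconnected_connectedComponentIn (fun C hC D hD => ?_) hy hρ
  exact h C hC D fun n => (hD n).trans (connectedComponentIn_subset _ _)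

/-! ### Separation of points by compact sets -/

lemma HasLogOn.exists_continuousMap {X : Type*} [TopologicalSpace X] [NormalSpace X] {f : X → ℂ}
    {s : Set X} (hs : IsClosed s) (h : HasLogOn f s) :
    ∃ G : C(X, ℂ), ∀ x ∈ s, Complex.exp (G x) = f x := by
  obtain ⟨g, hg, hgf⟩ := h
  obtain ⟨G, hG⟩ := ContinuousMap.exists_restrict_eq hs ⟨s.domRestrict g, hg.domRestrict⟩
  exact ⟨G, fun x hx => by rw [← hgf x hx]; exact congrArg _ (DFunLike.congr_fun hG ⟨x, hx⟩)⟩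

lemma HasLogOn.union_of_isClopen {X : Type*} [TopologicalSpace X] {f : X → ℂ} {s t : Set X}
    (hs : IsClopen s) (ht : IsClopen t) (hfs : HasLogOn f s) (hft : HasLogOn f t) :
    HasLogOn f (s ∪ t) := by
  classical
  obtain ⟨g, hg, hgf⟩ := hfs
  obtain ⟨l, hl, hlf⟩ := hft
  refine ⟨s.piecewise g l, ?_, fun x hx => ?_⟩
  · rw [← union_sdiff_self]
    refine ContinuousOn.union_of_isOpen (hg.congr (piecewise_eqOn s g l)) ?_ hs.isOpen
      (ht.isOpen.sdiff hs.isClosed)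
    exact (hl.mono sdiff_subset).congr fun x hx => piecewise_eq_of_notMem _ _ _ hx.2
  · by_cases h : x ∈ s
    · rw [piecewise_eq_of_mem _ _ _ h, hgf x h]
    · rw [piecewise_eq_of_notMem _ _ _ h, hlf x (hx.resolve_left h)]

/-- On a compact space, a function with a logarithm on each component has a global logarithm. -/
lemma HasLogOn.univ_of_connectedComponent {X : Type*} [TopologicalSpace X] [CompactSpace X]
    [T2Space X] {f : X → ℂ} (hf : Continuous f) (h : ∀ x, HasLogOn f (connectedComponent x)) :
    HasLogOn f univ := by
  have hloc : ∀ x, ∃ W, IsClopen W ∧ x ∈ W ∧ HasLogOn f W := by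
    intro x
    obtain ⟨G, hG⟩ := (h x).exists_continuousMap isClosed_connectedComponent
    obtain ⟨W, hW, hxW, hWO⟩ := exists_isClopen_mem_subset (x := x)
      (O := {w | ‖f w * Complex.exp (-G w) - 1‖ < 1})
      (isOpen_lt (by fun_prop) continuous_const) fun w hw => by
        change ‖f w * Complex.exp (-G w) - 1‖ < 1
        rw [← hG w hw, ← Complex.exp_add, add_neg_cancel, Complex.exp_zero, sub_self, norm_zero]
        exact one_pos
    refine ⟨W, hW, hxW, ?_⟩
    have h1 : HasLogOn (fun w => Complex.exp (G w)) W :=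
      ⟨G, G.continuous.continuousOn, fun _ _ => rfl⟩
    have h2 : HasLogOn (fun w => f w * Complex.exp (-G w)) W := by
      refine HasLogOn.of_slitPlane (by fun_prop) fun w hw => ?_
      have := Complex.mem_slitPlane_of_norm_lt_one (hWO hw)
      rwa [add_sub_cancel] at this
    refine (h1.mul h2).congr fun w _ => ?_
    rw [mul_left_comm, ← Complex.exp_add, add_neg_cancel, Complex.exp_zero, mul_one]
  obtain ⟨V, -, hV, hfV⟩ := isCompact_univ.induction_on
    (p := fun s => ∃ V, IsClopen V ∧ s ⊆ V ∧ HasLogOn f V)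
    ⟨∅, isClopen_empty, subset_rfl, f, continuousOn_empty f, by simp⟩
    (fun s t hst ⟨V, hV, htV, hfV⟩ => ⟨V, hV, hst.trans htV, hfV⟩)
    (fun s t ⟨V, hV, hsV, hfV⟩ ⟨W, hW, htW, hfW⟩ => ⟨V ∪ W, hV.union hW,
      union_subset_union hsV htW, hfV.union_of_isClopen hV hW hfW⟩)
    (fun x _ => by
      obtain ⟨W, hW, hxW, hfW⟩ := hloc x
      exact ⟨W, mem_nhdsWithin_of_mem_nhds (hW.isOpen.mem_nhds hxW), W, hW, subset_rfl, hfW⟩)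
  exact hfV.mono hV

lemma HasLogOn.sub_div_sub {F S : Set ℂ} (hF : IsClosed F) (hS : IsPreconnected S)
    (hSF : Disjoint S F) {p q : ℂ} (hp : p ∈ S) (hq : q ∈ S) :
    HasLogOn (fun z => (z - p) / (z - q)) F := by
  have hne : ∀ x ∈ S, ∀ z ∈ F, z - x ≠ 0 := fun x hx z hz h =>
    disjoint_left.1 hSF hx (sub_eq_zero.1 h ▸ hz)
  refine hS.induction₂ (fun x y => HasLogOn (fun z => (z - x) / (z - y)) F) (fun x hx => ?_)
    (fun x y w hx hy hw hxy hyw => ?_) (fun x y hx hy hxy => ?_) hp hq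
  · obtain ⟨ε, hε, hball⟩ := Metric.isOpen_iff.1 hF.isOpen_compl x (disjoint_left.1 hSF hx)
    filter_upwards [inter_mem_nhdsWithin S (ball_mem_nhds x hε)] with y hy
    have h1 : HasLogOn (fun z => (z - y) / (z - x)) F := by
      refine HasLogOn.of_slitPlane (ContinuousOn.div (by fun_prop) (by fun_prop) (hne x hx))
        fun z hz => ?_
      have h2 : ‖(x - y) / (z - x)‖ < 1 := by
        rw [norm_div, div_lt_one (norm_pos_iff.2 (hne x hx z hz)), ← dist_eq_norm, ← dist_eq_norm,
          dist_comm]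
        refine (mem_ball.1 hy.2).trans_le (not_lt.1 fun h => hball (mem_ball.2 h) hz)
      have h3 := Complex.mem_slitPlane_of_norm_lt_one h2
      rwa [one_add_div (hne x hx z hz), sub_add_sub_cancel] at h3
    exact h1.inv.congr fun z _ => inv_div _ _
  · refine (hxy.mul hyw).congr fun z hz => ?_
    exact div_mul_div_cancel₀ (hne y hy z hz)
  · exact hxy.inv.congr fun z _ => inv_div _ _

lemma not_hasLogOn_sphere {R : ℝ} (hR : 0 < R) : ¬ HasLogOn (fun z => z) (sphere (0 : ℂ) R) := by
  rintro ⟨g, hg, hgf⟩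
  have hmem : ∀ t : ℝ, R * Complex.exp (t * Complex.I) ∈ sphere (0 : ℂ) R := fun t => by
    simp [Complex.norm_exp_ofReal_mul_I, abs_of_pos hR]
  set γ : ℝ → ℂ := fun t => g (R * Complex.exp (t * Complex.I)) with hγ
  have hγc : Continuous γ := hg.comp_continuous (by fun_prop) hmem
  obtain ⟨k, hk⟩ := (isPreconnected_univ (α := ℝ)).exists_int_abs_sub_lt univ_nonempty
    (φ := fun t => (γ t).im - t) ((Complex.continuous_im.comp hγc).sub continuous_id).continuousOn 0
    fun t _ => by
      have h1 : Complex.exp (γ t - t * Complex.I) = R := by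
        rw [Complex.exp_sub, hγ, hgf _ (hmem t), mul_div_cancel_right₀ _ (Complex.exp_ne_zero _)]
      have h2 := congrArg Complex.re h1
      rw [Complex.exp_re] at h2
      simp only [Complex.sub_im, Complex.mul_im, Complex.ofReal_re, Complex.I_im, mul_one,
        Complex.ofReal_im, Complex.I_re, mul_zero, add_zero, Complex.ofReal_re] at h2
      rw [sub_zero]
      exact pos_of_mul_pos_right (h2 ▸ hR) (Real.exp_pos _).le
  have h0 := abs_lt.1 (hk 0 trivial)
  have h1 := abs_lt.1 (hk (2 * Real.pi) trivial)
  have h2 : γ (2 * Real.pi) = γ 0 := by simp [hγ]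
  rw [h2] at h1
  linarith [Real.pi_pos]

lemma frontier_connectedComponentIn_compl_subset {F : Set ℂ} (hF : IsClosed F) (p : ℂ) :
    frontier (connectedComponentIn Fᶜ p) ⊆ F := by
  intro w hw
  by_contra hwF
  rw [hF.isOpen_compl.connectedComponentIn.frontier_eq] at hw
  obtain ⟨z, hzw, hzp⟩ := mem_closure_iff.1 hw.1 _ hF.isOpen_compl.connectedComponentIn
    (mem_connectedComponentIn hwF)
  refine hw.2 ?_
  rw [connectedComponentIn_eq hzp, ← connectedComponentIn_eq hzw]
  exact mem_connectedComponentIn hwF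

lemma false_of_exp_eq {F U : Set ℂ} (hU : frontier U ⊆ F) {p q : ℂ} (hq : q ∉ F)
    (hpU : p ∈ U) (hqU : q ∉ U) {R : ℝ} (hpR : ‖p‖ < R) (hUR : Disjoint (sphere 0 R) U)
    {G : ℂ → ℂ} (hG : Continuous G) (hGF : ∀ z ∈ F, Complex.exp (G z) = (z - p) / (z - q)) :
    False := by
  classical
  have hR : 0 < R := (norm_nonneg p).trans_lt hpR
  set H : ℂ → ℂ := U.piecewise (fun z => Complex.exp (G z) * (z - q)) (fun z => z - p) with hH
  have hHc : Continuous H := by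
    refine Continuous.piecewise (fun z hz => ?_) (by fun_prop) (by fun_prop)
    rw [hGF z (hU hz), div_mul_cancel₀]
    rw [sub_ne_zero]
    rintro rfl
    exact hq (hU hz)
  have hH0 : ∀ z, H z ≠ 0 := by
    intro z
    by_cases hz : z ∈ U
    · rw [hH, piecewise_eq_of_mem _ _ _ hz]
      exact mul_ne_zero (Complex.exp_ne_zero _) (sub_ne_zero.2 fun h => hqU (h ▸ hz))
    · rw [hH, piecewise_eq_of_notMem _ _ _ hz]
      exact sub_ne_zero.2 fun h => hz (h ▸ hpU)
  have hz0 : ∀ z ∈ sphere (0 : ℂ) R, z ≠ 0 := fun z hz => ne_zero_of_mem_sphere hR.ne' ⟨z, hz⟩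
  have h1 : HasLogOn (fun z => z - p) (sphere (0 : ℂ) R) :=
    ((HasLogOn.of_contractible hHc hH0).mono (subset_univ _)).congr fun z hz =>
      piecewise_eq_of_notMem _ _ _ (disjoint_left.1 hUR hz)
  have h2 : HasLogOn (fun z => (z - p) / z) (sphere (0 : ℂ) R) := by
    refine HasLogOn.of_slitPlane (ContinuousOn.div (by fun_prop) (by fun_prop) hz0) fun z hz => ?_
    have h3 : ‖-p / z‖ < 1 := by
      rw [norm_div, norm_neg, mem_sphere_zero_iff_norm.1 hz]
      exact (div_lt_one hR).2 hpR
    have h4 := Complex.mem_slitPlane_of_norm_lt_one h3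
    rwa [one_add_div (hz0 z hz), ← sub_eq_add_neg] at h4
  refine not_hasLogOn_sphere hR ((h1.mul h2.inv).congr fun z hz => ?_)
  have h3 : z - p ≠ 0 := sub_ne_zero.2 fun h => hpR.ne (h ▸ mem_sphere_zero_iff_norm.1 hz)
  rw [inv_div, mul_div_cancel₀ _ h3]

/-- Eilenberg's criterion: if `(z - p) / (z - q)` has a continuous logarithm on a compact set `F`,
then `F` does not separate `p` from `q`. -/
lemma mem_connectedComponentIn_compl_of_exp_eq {F : Set ℂ} (hF : IsCompact F) {p q : ℂ}
    (hp : p ∉ F) (hq : q ∉ F) {G : ℂ → ℂ} (hG : Continuous G)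
    (hGF : ∀ z ∈ F, Complex.exp (G z) = (z - p) / (z - q)) :
    q ∈ connectedComponentIn Fᶜ p := by
  by_contra hqU
  have hpV : p ∉ connectedComponentIn Fᶜ q := fun h => hqU (by
    rw [← connectedComponentIn_eq h]
    exact mem_connectedComponentIn hq)
  have hdisj : Disjoint (connectedComponentIn Fᶜ p) (connectedComponentIn Fᶜ q) :=
    connectedComponentIn_disjoint_of_ne fun h => hqU (h ▸ mem_connectedComponentIn hq)
  obtain ⟨R, hR⟩ := (hF.union (isCompact_singleton (x := p) |>.union
    (isCompact_singleton (x := q)))).exists_norm_lt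
  have hpR : ‖p‖ < R := hR p (by simp)
  have hqR : ‖q‖ < R := hR q (by simp)
  have hS : IsPreconnected (sphere (0 : ℂ) R) :=
    isPreconnected_sphere (by simp [Complex.rank_real_complex]) 0 R
  have hSF : sphere (0 : ℂ) R ⊆ Fᶜ := fun z hz hzF =>
    (hR z (Or.inl hzF)).ne (mem_sphere_zero_iff_norm.1 hz)
  by_cases hU : Disjoint (sphere (0 : ℂ) R) (connectedComponentIn Fᶜ p)
  · exact false_of_exp_eq (frontier_connectedComponentIn_compl_subset hF.isClosed p) hq
      (mem_connectedComponentIn hp) hqU hpR hU hG hGF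
  · obtain ⟨w, hwS, hwU⟩ := not_disjoint_iff.1 hU
    have hSU : sphere (0 : ℂ) R ⊆ connectedComponentIn Fᶜ p := by
      rw [connectedComponentIn_eq hwU]
      exact hS.subset_connectedComponentIn hwS hSF
    refine false_of_exp_eq (G := fun z => -G z)
      (frontier_connectedComponentIn_compl_subset hF.isClosed q) hp
      (mem_connectedComponentIn hq) hpV hqR (hdisj.mono_left hSU) hG.neg fun z hz => ?_
    rw [Complex.exp_neg, hGF z hz, inv_div]

/-- A compact set separating two points has a component separating them. -/
lemma exists_connectedComponentIn_separates {F : Set ℂ} (hF : IsCompact F) {p q : ℂ}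
    (hp : p ∉ F) (hq : q ∉ F) (hpq : q ∉ connectedComponentIn Fᶜ p) :
    ∃ x ∈ F, q ∉ connectedComponentIn (connectedComponentIn F x)ᶜ p := by
  by_contra! hno
  have : CompactSpace F := isCompact_iff_compactSpace.1 hF
  have hlog : HasLogOn (fun z : F => ((z : ℂ) - p) / (z - q)) univ := by
    refine HasLogOn.univ_of_connectedComponent
      (Continuous.div (by fun_prop) (by fun_prop) fun z => ?_) fun x => ?_
    · exact sub_ne_zero.2 fun h => hq (h ▸ z.2)
    · have hsub := connectedComponentIn_subset F x
      obtain ⟨g, hg, hgf⟩ := HasLogOn.sub_div_sub (hF.connectedComponentIn x).isClosed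
        isPreconnected_connectedComponentIn
        (subset_compl_iff_disjoint_right.1 (connectedComponentIn_subset _ p))
        (mem_connectedComponentIn fun h => hp (hsub h)) (hno x x.2)
      have hmaps : MapsTo ((↑) : F → ℂ) (connectedComponent x) (connectedComponentIn F x) := by
        rw [connectedComponentIn_eq_image x.2]
        exact mapsTo_image _ _
      exact ⟨fun z => g z, hg.comp continuous_subtype_val.continuousOn hmaps,
        fun z hz => hgf z (hmaps hz)⟩
  obtain ⟨g, hg, hgf⟩ := hlog
  obtain ⟨G, hG⟩ := ContinuousMap.exists_restrict_eq hF.isClosed ⟨g, continuousOn_univ.1 hg⟩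
  refine hpq (mem_connectedComponentIn_compl_of_exp_eq hF hp hq G.continuous fun z hz => ?_)
  exact (congrArg Complex.exp (DFunLike.congr_fun hG ⟨z, hz⟩)).trans (hgf ⟨z, hz⟩ trivial)

/-! ### Peano compacta as boundaries -/

lemma exists_finite_cover_of_locallyConnectedSpace {Q : Set ℂ} (hQ : IsCompact Q)
    [LocallyConnectedSpace Q] {ε : ℝ} (hε : 0 < ε) :
    ∃ ℳ : Set (Set ℂ), ℳ.Finite ∧ (∀ M ∈ ℳ, IsCompact M ∧ IsPreconnected M ∧ M ⊆ Q ∧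
      ∀ x ∈ M, ∀ y ∈ M, dist x y ≤ ε) ∧ Q ⊆ ⋃₀ ℳ := by
  have : CompactSpace Q := isCompact_iff_compactSpace.1 hQ
  obtain ⟨ℳ, hfin, hℳ, hcov⟩ := (isCompact_univ (X := Q)).induction_on
    (p := fun s => ∃ ℳ : Set (Set ℂ), ℳ.Finite ∧ (∀ M ∈ ℳ, IsCompact M ∧ IsPreconnected M ∧
      M ⊆ Q ∧ ∀ x ∈ M, ∀ y ∈ M, dist x y ≤ ε) ∧ Subtype.val '' s ⊆ ⋃₀ ℳ)
    ⟨∅, finite_empty, by simp, by simp⟩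
    (fun s t hst ⟨ℳ, hfin, hℳ, hcov⟩ => ⟨ℳ, hfin, hℳ, (image_mono hst).trans hcov⟩)
    (fun s t ⟨ℳ, hfin, hℳ, hcov⟩ ⟨𝒩, hfin', h𝒩, hcov'⟩ => ⟨ℳ ∪ 𝒩, hfin.union hfin',
      fun M hM => hM.elim (hℳ M) (h𝒩 M), by
        rw [image_union, sUnion_union]
        exact union_subset_union hcov hcov'⟩)
    (fun x _ => by
      obtain ⟨V, hV, hVc, hVb⟩ := locallyConnectedSpace_iff_connected_subsets.1 ‹_› x
        (ball x (ε / 2)) (ball_mem_nhds x (half_pos hε))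
      refine ⟨V, mem_nhdsWithin_of_mem_nhds hV, {(↑) '' closure V}, finite_singleton _, ?_,
        by simpa using subset_closure⟩
      rintro _ rfl
      have hcl : closure V ⊆ closedBall x (ε / 2) :=
        closure_minimal (hVb.trans ball_subset_closedBall) isClosed_closedBall
      refine ⟨isClosed_closure.isCompact.image continuous_subtype_val,
        hVc.closure.image _ continuous_subtype_val.continuousOn, ?_, ?_⟩
      · rintro _ ⟨w, -, rfl⟩
        exact w.2
      · rintro _ ⟨w, hw, rfl⟩ _ ⟨y, hy, rfl⟩
        have h1 := dist_triangle_right w y x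
        have h2 := mem_closedBall.1 (hcl hw)
        have h3 := mem_closedBall.1 (hcl hy)
        change dist w y ≤ ε
        linarith)
  exact ⟨ℳ, hfin, hℳ, by simpa using hcov⟩

lemma IsPreconnected.subset_of_disjoint_frontier {X : Type*} [TopologicalSpace X] {s t : Set X}
    (hs : IsPreconnected s) (ht : IsOpen t) (hst : Disjoint s (frontier t))
    (hne : (s ∩ t).Nonempty) : s ⊆ t := by
  refine hs.subset_left_of_subset_union ht isClosed_closure.isOpen_compl
    (disjoint_compl_right.mono_left subset_closure |>.mono_right subset_rfl) (fun x hx => ?_) hne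
  by_contra h
  rw [mem_union, not_or, mem_compl_iff, not_not] at h
  refine disjoint_left.1 hst hx ?_
  rw [ht.frontier_eq]
  exact ⟨h.2, h.1⟩

/-- If two points of a domain are separated in a disc, then the segment between them meets a
large boundary component. -/
lemma exists_mem_segment_lt_diam {Ω : Set ℂ} (hΩ : IsOpen Ω) (hΩc : IsPreconnected Ω)
    (hK : IsCompact (frontier Ω)) {ξ p q : ℂ} {r : ℝ} (hr : 0 < r) (hp : p ∈ Ω) (hq : q ∈ Ω)
    (hpr : p ∈ closedBall ξ (r / 2)) (hqr : q ∈ closedBall ξ (r / 2))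
    (hpq : q ∉ connectedComponentIn (Ω ∩ ball ξ r) p) :
    ∃ g ∈ segment ℝ p q, g ∈ frontier Ω ∧ r / 8 < diam (connectedComponentIn (frontier Ω) g) := by
  have hFc : IsCompact (frontier Ω ∪ sphere ξ r) := hK.union (isCompact_sphere ξ r)
  have hΩK : ∀ z ∈ Ω, z ∉ frontier Ω := fun z hz h => by
    rw [hΩ.frontier_eq] at h
    exact h.2 hz
  have hin : ∀ z ∈ closedBall ξ (r / 2), z ∈ ball ξ r ∧ z ∉ sphere ξ r := fun z hz => by
    have h1 : dist z ξ < r := (mem_closedBall.1 hz).trans_lt (by linarith)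
    exact ⟨h1, fun h => h1.ne h⟩
  set F := frontier Ω ∪ sphere ξ r with hF
  have hpF : p ∉ F := fun h => h.elim (hΩK p hp) (hin p hpr).2
  have hqF : q ∉ F := fun h => h.elim (hΩK q hq) (hin q hqr).2
  have hsep : q ∉ connectedComponentIn Fᶜ p := fun hqW => by
    have hW : IsPreconnected (connectedComponentIn Fᶜ p) := isPreconnected_connectedComponentIn
    have hWF : Disjoint (connectedComponentIn Fᶜ p) F :=
      subset_compl_iff_disjoint_right.1 (connectedComponentIn_subset _ _)
    have hpW : p ∈ connectedComponentIn Fᶜ p := mem_connectedComponentIn hpF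
    have hfb : frontier (ball ξ r) ⊆ F := by
      rw [frontier_ball ξ hr.ne']
      exact subset_union_right
    refine hpq (hW.subset_connectedComponentIn hpW (subset_inter ?_ ?_) hqW)
    · exact hW.subset_of_disjoint_frontier hΩ (hWF.mono_right subset_union_left) ⟨p, hpW, hp⟩
    · exact hW.subset_of_disjoint_frontier isOpen_ball (hWF.mono_right hfb)
        ⟨p, hpW, (hin p hpr).1⟩
  obtain ⟨x, hx, hxsep⟩ := exists_connectedComponentIn_separates hFc hpF hqF hsep
  have hCF : connectedComponentIn F x ⊆ F := connectedComponentIn_subset F x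
  have hCc : IsPreconnected (connectedComponentIn F x) := isPreconnected_connectedComponentIn
  have hCcpt : IsCompact (connectedComponentIn F x) := hFc.connectedComponentIn x
  set C := connectedComponentIn F x with hC
  obtain ⟨y, hyC, hy⟩ : ∃ y ∈ C, r ≤ dist y ξ := by
    by_contra! hno
    have hΩC : Ω ⊆ Cᶜ := fun z hz hzC => (hCF hzC).elim (hΩK z hz) fun h => (hno z hzC).ne h
    exact hxsep (hΩc.subset_connectedComponentIn hp hΩC hq)
  obtain ⟨g, hg, hgC⟩ : ∃ g ∈ segment ℝ p q, g ∈ C := by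
    by_contra! hno
    exact hxsep ((convex_segment p q).isPreconnected.subset_connectedComponentIn
      (left_mem_segment ℝ p q) (fun z hz => hno z hz) (right_mem_segment ℝ p q))
  have hgr : dist g ξ ≤ r / 2 := (convex_closedBall ξ (r / 2)).segment_subset hpr hqr hg
  have hgK : g ∈ frontier Ω := (hCF hgC).resolve_right (hin g hgr).2
  obtain ⟨z, hz, hzr⟩ := exists_mem_connectedComponentIn_eq hCcpt hCc (f := fun w => dist w ξ)
    (d := 3 * r / 4) (by fun_prop) hgC (by linarith) hyC (by linarith)
  have hsub := connectedComponentIn_subset (C ∩ {w | dist w ξ ≤ 3 * r / 4}) g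
  have hzK : z ∈ connectedComponentIn (frontier Ω) g := by
    have hgr' : dist g ξ ≤ 3 * r / 4 := by linarith
    refine (isPreconnected_connectedComponentIn (F := C ∩ {w | dist w ξ ≤ 3 * r / 4})
      (x := g)).subset_connectedComponentIn (mem_connectedComponentIn ⟨hgC, hgr'⟩)
      (fun w hw => ?_) hz
    refine (hCF (hsub hw).1).resolve_right fun h => ?_
    have h1 : dist w ξ ≤ 3 * r / 4 := (hsub hw).2
    have h2 : dist w ξ = r := h
    linarith
  refine ⟨g, hg, hgK, ?_⟩
  have h1 := dist_le_diam_of_mem (hK.connectedComponentIn g).isBounded hzK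
    (mem_connectedComponentIn hgK)
  have h2 := dist_triangle z g ξ
  linarith

lemma exists_seq_notMem_connectedComponentIn {Ω : Set ℂ} {ξ : ℂ} {r ε : ℝ} (hε : 0 < ε)
    (hεr : ε ≤ r) {ξn : ℕ → ℂ} (hξn : ∀ n, ξn n ∈ Ω) (hlim : Tendsto ξn atTop (𝓝 ξ))
    (h : ∀ x ∈ Ω ∩ ball ξ r, {n | ξn n ∈ connectedComponentIn (Ω ∩ ball ξ r) x}.Finite) :
    ∃ u : ℕ → ℂ, (∀ n, u n ∈ Ω ∩ ball ξ ε) ∧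
      ∀ i j, i ≠ j → u j ∉ connectedComponentIn (Ω ∩ ball ξ r) (u i) := by
  obtain ⟨f, hf, hff⟩ := exists_seq_of_forall_finset_exists (P := fun n => ξn n ∈ ball ξ ε)
    (fun m n => ξn n ∉ connectedComponentIn (Ω ∩ ball ξ r) (ξn m)) (by
      intro s hs
      have hfin : (⋃ m ∈ s, {n | ξn n ∈ connectedComponentIn (Ω ∩ ball ξ r) (ξn m)}).Finite :=
        s.finite_toSet.biUnion fun m hm => h _ ⟨hξn m, ball_subset_ball hεr (hs m hm)⟩
      obtain ⟨n, hn, hns⟩ := ((hlim.eventually_mem (ball_mem_nhds ξ hε)).and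
        (Nat.cofinite_eq_atTop ▸ hfin.eventually_cofinite_notMem)).exists
      exact ⟨n, hn, fun m hm hmn => hns (mem_iUnion₂.2 ⟨m, hm, hmn⟩)⟩)
  refine ⟨fun n => ξn (f n), fun n => ⟨hξn _, hf n⟩, fun i j hij => ?_⟩
  rcases lt_or_gt_of_ne hij with h' | h'
  · exact hff i j h'
  · intro hmem
    refine hff j i h' ?_
    rw [← connectedComponentIn_eq hmem]
    exact mem_connectedComponentIn ⟨hξn _, ball_subset_ball hεr (hf i)⟩

lemma exists_continuum_subset_connectedComponentIn {Ω : Set ℂ} (hΩ : IsOpen Ω)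
    (hΩc : IsConnected Ω) {ξ p q : ℂ} {r : ℝ} (hr : 0 < r) (hp : p ∈ Ω) (hq : q ∈ Ω)
    (hpr : p ∈ ball ξ (r / 4)) (hpq : q ∉ connectedComponentIn (Ω ∩ ball ξ r) p) :
    ∃ D ⊆ connectedComponentIn (Ω ∩ ball ξ r) p ∩ closedBall ξ (r / 2), IsCompact D ∧
      IsPreconnected D ∧ ∃ x ∈ D, ∃ y ∈ D, r / 4 ≤ dist x y := by
  obtain ⟨γ, hγ⟩ := (hΩ.isConnected_iff_isPathConnected.1 hΩc).joinedIn p hp q hq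
  have hcpt := isCompact_range γ.continuous
  have hpre := isPreconnected_range γ.continuous
  have hsub : range γ ⊆ Ω := range_subset_iff.2 hγ
  have hpγ : p ∈ range γ := ⟨0, γ.source⟩
  have hpr' := mem_ball.1 hpr
  obtain ⟨y, hy, hyr⟩ : ∃ y ∈ range γ, r / 2 ≤ dist y ξ := by
    by_contra! hno
    have hγB : range γ ⊆ Ω ∩ ball ξ r := fun z hz =>
      ⟨hsub hz, mem_ball.2 ((hno z hz).trans (by linarith))⟩
    exact hpq (hpre.subset_connectedComponentIn hpγ hγB ⟨1, γ.target⟩)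
  obtain ⟨z, hz, hzr⟩ := exists_mem_connectedComponentIn_eq hcpt hpre (f := fun w => dist w ξ)
    (d := r / 2) (by fun_prop) hpγ (by linarith) hy hyr
  have hpD : p ∈ connectedComponentIn (range γ ∩ {w | dist w ξ ≤ r / 2}) p :=
    mem_connectedComponentIn ⟨hpγ, show dist p ξ ≤ r / 2 by linarith⟩
  have hDsub := connectedComponentIn_subset (range γ ∩ {w | dist w ξ ≤ r / 2}) p
  refine ⟨connectedComponentIn (range γ ∩ {w | dist w ξ ≤ r / 2}) p,
    subset_inter ?_ fun w hw => (hDsub hw).2,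
    (hcpt.inter_right isClosed_closedBall).connectedComponentIn p,
    isPreconnected_connectedComponentIn, z, hz, p, hpD, ?_⟩
  · refine (isPreconnected_connectedComponentIn (F := range γ ∩ {w | dist w ξ ≤ r / 2})
      (x := p)).subset_connectedComponentIn hpD fun w hw => ?_
    have hwr : dist w ξ ≤ r / 2 := (hDsub hw).2
    exact ⟨hsub (hDsub hw).1, mem_ball.2 (hwr.trans_lt (by linarith))⟩
  · have h1 := dist_triangle z p ξ
    linarith

lemma IsPeanoCompactum.locallySeqAccessible {Ω : Set ℂ} (hΩ : IsOpen Ω) (hΩc : IsConnected Ω)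
    (h : IsPeanoCompactum (frontier Ω)) (ξ : ℂ) : LocallySeqAccessible Ω ξ := by
  obtain ⟨hK, hlc, hfin⟩ := h
  intro r hr ξn hξn hlim
  by_contra! hno
  obtain ⟨u, hu, hdist⟩ := exists_seq_notMem_connectedComponentIn (ε := r / 4) (by positivity)
    (by linarith) hξn hlim hno
  choose D hDsub hD hDc hDl using fun n => exists_continuum_subset_connectedComponentIn hΩ hΩc hr
    (hu n).1 (hu (n + 1)).1 (hu n).2 (hdist n (n + 1) (by omega))
  obtain ⟨θ, hθ, c, d, hcd, φ, hφ, P, hPD, hP⟩ := exists_crossesStrip (isCompact_closedBall ξ (r / 2))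
    (fun n => (hDsub n).trans inter_subset_right) hD hDc (by positivity) hDl
  have hPU : ∀ n, ∀ z ∈ P n, z ∈ connectedComponentIn (Ω ∩ ball ξ r) (u (φ n)) :=
    fun n z hz => (hDsub _ (hPD n hz)).1
  have hPΩ : ∀ n, ∀ z ∈ P n, z ∈ Ω := fun n z hz =>
    (connectedComponentIn_subset _ _ (hPU n z hz)).1
  have hsep : ∀ i j, i ≠ j → ∀ p ∈ P i, ∀ q ∈ P j,
      q ∉ connectedComponentIn (Ω ∩ ball ξ r) p := by
    intro i j hij p hp q hq hpq
    refine hdist (φ i) (φ j) (hφ.injective.ne hij) ?_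
    rw [connectedComponentIn_eq (hPU i p hp), connectedComponentIn_eq hpq,
      ← connectedComponentIn_eq (hPU j q hq)]
    exact mem_connectedComponentIn ⟨(hu _).1, ball_subset_ball (by linarith) (hu _).2⟩
  have hcover : ∀ Q ∈ {Q : Set ℂ | (∃ x ∈ frontier Ω, Q = connectedComponentIn (frontier Ω) x) ∧
      r / 8 < diam Q}, ∃ ℳ : Set (Set ℂ), ℳ.Finite ∧ (∀ M ∈ ℳ, IsCompact M ∧ IsPreconnected M ∧
        M ⊆ Q ∧ ∀ x ∈ M, ∀ y ∈ M, dist x y ≤ (d - c) / 2) ∧ Q ⊆ ⋃₀ ℳ := by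
    rintro _ ⟨⟨x, hx, rfl⟩, -⟩
    have := hlc x hx
    exact exists_finite_cover_of_locallyConnectedSpace (hK.connectedComponentIn x) (by linarith)
  choose! ℳ hℳfin hℳ hℳcov using hcover
  have hcont : Continuous fun z : ℂ => θ * z := continuous_const.mul continuous_id
  have hinj : Function.Injective fun z : ℂ => θ * z :=
    mul_right_injective₀ (norm_ne_zero_iff.1 (by simp [hθ]))
  set 𝒬 := {Q : Set ℂ | (∃ x ∈ frontier Ω, Q = connectedComponentIn (frontier Ω) x) ∧
      r / 8 < diam Q} with h𝒬
  have hmem : ∀ {M}, M ∈ (fun M => (fun z => θ * z) '' M) '' ⋃ Q ∈ 𝒬, ℳ Q →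
      ∃ Q ∈ 𝒬, ∃ N ∈ ℳ Q, (fun z => θ * z) '' N = M := by
    rintro _ ⟨N, hN, rfl⟩
    obtain ⟨Q, hQ, hNQ⟩ := mem_iUnion₂.1 hN
    exact ⟨Q, hQ, N, hNQ, rfl⟩
  refine CrossesStrip.false_of_segment_inter
    (ℳ := (fun M => (fun z => θ * z) '' M) '' ⋃ Q ∈ 𝒬, ℳ Q) hP (fun i j hij => ?_)
    (((hfin (r / 8) (by positivity)).biUnion fun Q hQ => hℳfin Q hQ).image _) ?_ ?_ ?_ ?_ ?_
  · refine (disjoint_image_iff hinj).2 (disjoint_left.2 fun z hzi hzj => ?_)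
    exact hsep i j hij z hzi z hzj
      (mem_connectedComponentIn (connectedComponentIn_subset _ _ (hPU i z hzi)))
  · intro M hM
    obtain ⟨Q, hQ, N, hN, rfl⟩ := hmem hM
    exact (hℳ Q hQ N hN).1.image hcont
  · intro M hM
    obtain ⟨Q, hQ, N, hN, rfl⟩ := hmem hM
    exact (hℳ Q hQ N hN).2.1.image _ hcont.continuousOn
  · intro M hM n
    obtain ⟨Q, hQ, N, hN, rfl⟩ := hmem hM
    refine (disjoint_image_iff hinj).2 (disjoint_left.2 fun z hzN hzP => ?_)
    obtain ⟨⟨x, -, rfl⟩, -⟩ := id hQ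
    have h1 := connectedComponentIn_subset _ _ ((hℳ _ hQ N hN).2.2.1 hzN)
    rw [hΩ.frontier_eq] at h1
    exact h1.2 (hPΩ n z hzP)
  · intro M hM
    obtain ⟨Q, hQ, N, hN, rfl⟩ := hmem hM
    rintro _ ⟨x, hx, rfl⟩ _ ⟨y, hy, rfl⟩
    refine le_trans ?_ ((hℳ Q hQ N hN).2.2.2 x hx y hy)
    have h1 := Complex.abs_im_le_norm (θ * x - θ * y)
    rwa [← mul_sub, norm_mul, hθ, one_mul, ← dist_eq_norm, mul_sub, Complex.sub_im] at h1
  · rintro i j hij _ ⟨p, hp, rfl⟩ _ ⟨q, hq, rfl⟩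
    obtain ⟨g, hg, hgK, hgd⟩ := exists_mem_segment_lt_diam hΩ hΩc.isPreconnected hK hr
      (hPΩ i p hp) (hPΩ j q hq) (hDsub _ (hPD i hp)).2 (hDsub _ (hPD j hq)).2
      (hsep i j hij p hp q hq)
    have hQ : connectedComponentIn (frontier Ω) g ∈ 𝒬 := ⟨⟨g, hgK, rfl⟩, hgd⟩
    obtain ⟨M, hM, hgM⟩ := hℳcov _ hQ (mem_connectedComponentIn hgK)
    refine ⟨_, mem_image_of_mem _ (mem_iUnion₂.2 ⟨_, hQ, hM⟩), θ * g, ?_, mem_image_of_mem _ hgM⟩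
    have h1 := image_segment ℝ (LinearMap.mulLeft ℝ θ).toAffineMap p q
    simp only [LinearMap.coe_toAffineMap, LinearMap.mulLeft_apply] at h1
    rw [← h1]
    exact ⟨g, hg, rfl⟩

/-- Local accessibility implies a Peano compactum boundary; the boundary is a Peano
compactum iff every boundary point is locally sequentially accessible. -/
theorem stmt_13 (Ω : Set ℂ) (hΩ : IsPlanarDomain Ω) (hb : Bornology.IsBounded Ω) :
    ((∀ x ∈ frontier Ω, LocallyAccessible Ω x) → IsPeanoCompactum (frontier Ω)) ∧
    (IsPeanoCompactum (frontier Ω) ↔ ∀ x ∈ frontier Ω, LocallySeqAccessible Ω x) := by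
  obtain ⟨-, hopen, hconn⟩ := hΩ
  have hK : IsCompact (frontier Ω) :=
    hb.isCompact_closure.of_isClosed_subset isClosed_frontier frontier_subset_closure
  refine ⟨fun h => ?_, fun h x _ => h.locallySeqAccessible hopen hconn x, fun h => ?_⟩
  · exact ((LocallyAccessible.locallyReachable hopen h).noLargeFamily hK).isPeanoCompactum hK
  · exact ((LocallySeqAccessible.locallyReachable hopen h).noLargeFamily hK).isPeanoCompactum hK
end
end

section
/- Let D be a circle domain whose boundary ∂D has σ-finite linear measure, and let φ : D → Ω be a conformal homeomorphism of D onto a bounded domain Ω ⊆ ℂ such that the connected components of ∂Ω containing more than one point form a countable family {P_n}. Fix n, let Q_n be a connected component of ∂D with φ^B(Q_n) = P_n, and suppose there exists an open set U_n ⊆ ℂ with P_n ⊆ U_n and Σ_{k : P_k ⊆ U_n} diam(P_k) < ∞. Then liminf_{r→0⁺} σ_r(z₀) = 0 for every z₀ ∈ Q_n. -/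
open Set Metric Filter MeasureTheory Topology

noncomputable section

open scoped ENNReal

/-! ### Topology of the plane -/

/-- The plane is unicoherent: if two connected open sets cover it, they meet in a connected set. -/
theorem isPreconnected_inter_of_union_eq_univ {V W : Set ℂ} (hVo : IsOpen V) (hWo : IsOpen W)
    (hV : IsPreconnected V) (hW : IsPreconnected W) (hVW : V ∪ W = univ) :
    IsPreconnected (V ∩ W) := by
  classical
  rw [isPreconnected_iff_subset_of_disjoint]
  intro A' B' hA' hB' hcov hdisj
  by_contra hne
  push Not at hne
  set A := A' ∩ (V ∩ W) with hA
  set B := B' ∩ (V ∩ W) with hB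
  have hAo : IsOpen A := hA'.inter (hVo.inter hWo)
  have hBo : IsOpen B := hB'.inter (hVo.inter hWo)
  have hAB : Disjoint A B := by
    rw [Set.disjoint_left]
    rintro x ⟨hx, hx'⟩ ⟨hy, -⟩
    have : x ∈ V ∩ W ∩ (A' ∩ B') := ⟨hx', hx, hy⟩
    rw [hdisj] at this
    exact this
  obtain ⟨b, hbVW, hbA⟩ := Set.not_subset.1 hne.1
  obtain ⟨a, haVW, haB⟩ := Set.not_subset.1 hne.2
  have haA : a ∈ A := ⟨(hcov haVW).resolve_right haB, haVW⟩
  have hbB : b ∉ A := fun h => hbA h.1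
  have hd : Disjoint Vᶜ Wᶜ := by
    rw [Set.disjoint_left]
    intro x hx hx'
    have : x ∈ V ∪ W := by rw [hVW]; trivial
    exact this.elim hx hx'
  obtain ⟨f, hf0, hf1, -⟩ := exists_continuous_zero_one_of_isClosed hVo.isClosed_compl
    hWo.isClosed_compl hd
  have hfr : ∀ x ∈ frontier A, x ∉ V ∩ W := by
    intro x hx hxVW
    rw [frontier, hAo.interior_eq] at hx
    have hxB : x ∈ B := ⟨(hcov hxVW).resolve_left fun h => hx.2 ⟨h, hxVW⟩, hxVW⟩
    exact Set.disjoint_left.1 (hAB.closure_left hBo) hx.1 hxB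
  have hfrW : ∀ x ∈ frontier A, x ∈ W → f x = 0 := fun x hx hxW =>
    hf0 fun hxV => hfr x hx ⟨hxV, hxW⟩
  have hfrV : ∀ x ∈ frontier A, x ∈ V → f x = 1 := fun x hx hxV =>
    hf1 fun hxW => hfr x hx ⟨hxV, hxW⟩
  let FW : ℂ → ℝ := A.piecewise (fun x => 2 * Real.pi * f x) fun _ => 0
  let FV : ℂ → ℝ := A.piecewise (fun x => 2 * Real.pi * (f x - 1)) fun _ => 0
  have hFW : ContinuousOn FW W := by
    refine ContinuousOn.piecewise ?_ (by fun_prop) (by fun_prop)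
    rintro x ⟨hxW, hx⟩
    simp [hfrW x hx hxW]
  have hFV : ContinuousOn FV V := by
    refine ContinuousOn.piecewise ?_ (by fun_prop) (by fun_prop)
    rintro x ⟨hxV, hx⟩
    simp [hfrV x hx hxV]
  let g : ℂ → Circle := A.piecewise (fun x => Circle.exp (2 * Real.pi * f x)) fun _ => 1
  have hg : Continuous g := by
    refine Continuous.piecewise ?_ (by fun_prop) (by fun_prop)
    intro x hx
    have : x ∈ V ∪ W := by rw [hVW]; trivial
    rcases this with hxV | hxW
    · simp [hfrV x hx hxV]
    · simp [hfrW x hx hxW]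
  have hgW : ∀ x, Circle.exp (FW x) = g x := by
    intro x
    by_cases hx : x ∈ A <;> simp [FW, g, hx]
  have hgV : ∀ x, Circle.exp (FV x) = g x := by
    intro x
    by_cases hx : x ∈ A
    · simp [FV, g, hx, mul_sub, Circle.exp_sub]
    · simp [FV, g, hx]
  obtain ⟨e₀, he₀⟩ := Circle.exp_surjective (g 0)
  obtain ⟨h, ⟨-, hh⟩, -⟩ := Circle.isCoveringMap_exp.existsUnique_continuousMap_lifts
    (⟨g, hg⟩ : C(ℂ, Circle)) 0 e₀ he₀
  have hh' : ∀ x, Circle.exp (h x) = g x := fun x => congr_fun hh x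
  have key : ∀ (S : Set ℂ) (F : ℂ → ℝ), IsPreconnected S → ContinuousOn F S →
      (∀ x, Circle.exp (F x) = g x) → a ∈ S → b ∈ S → h b = F b + (h a - F a) := by
    intro S F hS hF hFg haS hbS
    refine Circle.isCoveringMap_exp.isSeparatedMap.eqOn_of_comp_eqOn
      Circle.isCoveringMap_exp.isLocalHomeomorph.isLocallyInjective hS
      (g₁ := h) (g₂ := fun x => F x + (h a - F a)) h.continuous.continuousOn
      (hF.add continuousOn_const) ?_ haS (by simp) hbS
    intro x _
    simp [Circle.exp_add, Circle.exp_sub, hh', hFg]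
  have h1 := key W FW hW hFW hgW haVW.2 hbVW.2
  have h2 := key V FV hV hFV hgV haVW.1 hbVW.1
  simp only [FW, FV, Set.piecewise_eq_of_notMem _ _ _ hbB,
    Set.piecewise_eq_of_mem _ _ _ haA] at h1 h2
  have := Real.pi_pos
  nlinarith

/-- A component of a compact set has arbitrarily small relatively clopen neighbourhoods. -/
theorem exists_isClosed_split_of_connectedComponentIn_subset {K O : Set ℂ} (hK : IsCompact K)
    {w : ℂ} (hw : w ∈ K) (hO : IsOpen O) (hKO : connectedComponentIn K w ⊆ O) :
    ∃ F₁ F₂ : Set ℂ, IsClosed F₁ ∧ IsClosed F₂ ∧ Disjoint F₁ F₂ ∧ F₁ ∪ F₂ = K ∧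
      w ∈ F₁ ∧ F₁ ⊆ O := by
  have : CompactSpace K := isCompact_iff_compactSpace.1 hK
  have hcc := connectedComponent_eq_iInter_isClopen (⟨w, hw⟩ : K)
  have : Nonempty {s : Set K // IsClopen s ∧ (⟨w, hw⟩ : K) ∈ s} :=
    ⟨⟨univ, isClopen_univ, trivial⟩⟩
  obtain ⟨⟨s, hs, hws⟩, hsO⟩ := exists_subset_nhds_of_compactSpace
    (V := fun s : {s : Set K // IsClopen s ∧ (⟨w, hw⟩ : K) ∈ s} => (s : Set K))
    (U := Subtype.val ⁻¹' O)
    (by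
      rintro ⟨s, hs, hws⟩ ⟨t, ht, hwt⟩
      exact ⟨⟨s ∩ t, hs.inter ht, hws, hwt⟩, inter_subset_left, inter_subset_right⟩)
    (fun s => s.2.1.isClosed)
    (by
      intro x hx
      rw [← hcc] at hx
      refine (hO.preimage continuous_subtype_val).mem_nhds (hKO ?_)
      rw [connectedComponentIn_eq_image hw]
      exact mem_image_of_mem _ hx)
  refine ⟨Subtype.val '' s, Subtype.val '' sᶜ,
    hK.isClosed.isClosedEmbedding_subtypeVal.isClosedMap _ hs.isClosed,
    hK.isClosed.isClosedEmbedding_subtypeVal.isClosedMap _ hs.compl.isClosed, ?_, ?_,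
    ⟨_, hws, rfl⟩, ?_⟩
  · exact (disjoint_image_iff Subtype.val_injective).2 disjoint_compl_right
  · rw [← image_union, union_compl_self, image_univ, Subtype.range_coe]
  · rintro _ ⟨x, hx, rfl⟩
    exact hsO hx

/-- The set obtained from a domain by filling in complementary components is connected. -/
theorem isPreconnected_compl_inter_compl {D V : Set ℂ} (hDo : IsOpen D) (hD : IsConnected D)
    (hV : ∀ C : Set ℂ, IsPreconnected C → C ⊆ Dᶜ → (C ∩ V).Nonempty → C ⊆ V) :
    IsPreconnected (V ∩ Dᶜ)ᶜ := by
  obtain ⟨x₀, hx₀⟩ := hD.nonempty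
  have hDW : D ⊆ (V ∩ Dᶜ)ᶜ := fun x hx h => h.2 hx
  refine isPreconnected_of_forall x₀ fun y hy => ?_
  by_cases hyD : y ∈ D
  · exact ⟨D, hDW, hx₀, hyD, hD.isPreconnected⟩
  let l : ℝ → ℂ := fun t => AffineMap.lineMap y x₀ t
  have hl : Continuous l := AffineMap.lineMap_continuous
  set E : Set ℝ := {t | 0 ≤ t ∧ l t ∈ D} with hE
  have h1E : (1 : ℝ) ∈ E := ⟨zero_le_one, by simpa [l] using hx₀⟩
  have hEb : BddBelow E := ⟨0, fun t ht => ht.1⟩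
  have hT0 : 0 ≤ sInf E := le_csInf ⟨1, h1E⟩ fun t ht => ht.1
  have hTcl : l (sInf E) ∈ closure D :=
    map_mem_closure hl (csInf_mem_closure ⟨1, h1E⟩ hEb) fun t ht => ht.2
  have hlt : ∀ t ∈ Ico 0 (sInf E), l t ∈ Dᶜ := fun t ht htD =>
    not_lt_of_ge (csInf_le hEb ⟨ht.1, htD⟩) ht.2
  have hC : l '' Icc 0 (sInf E) ⊆ Dᶜ := by
    rcases hT0.eq_or_lt with h0 | h0
    · rw [← h0]
      rintro _ ⟨t, ht, rfl⟩
      obtain rfl : t = 0 := le_antisymm ht.2 ht.1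
      simpa [l] using hyD
    · rw [← closure_Ico h0.ne]
      rintro _ ⟨t, ht, rfl⟩
      exact hDo.isClosed_compl.closure_subset (map_mem_closure hl ht hlt)
  have hCp : IsPreconnected (l '' Icc 0 (sInf E)) :=
    isPreconnected_Icc.image _ hl.continuousOn
  have hyC : y ∈ l '' Icc 0 (sInf E) := ⟨0, ⟨le_rfl, hT0⟩, by simp [l]⟩
  have hpC : l (sInf E) ∈ l '' Icc 0 (sInf E) := ⟨_, ⟨hT0, le_rfl⟩, rfl⟩
  have hCW : l '' Icc 0 (sInf E) ⊆ (V ∩ Dᶜ)ᶜ := by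
    intro x hx hxV
    exact hy ⟨hV _ hCp hC ⟨x, hx, hxV.1⟩ hyC, hyD⟩
  refine ⟨insert (l (sInf E)) D ∪ l '' Icc 0 (sInf E), ?_, Or.inl (Or.inr hx₀), Or.inr hyC,
    IsPreconnected.union (l (sInf E)) (mem_insert _ _) hpC ?_ hCp⟩
  · exact union_subset (insert_subset (hCW hpC) hDW) hCW
  · exact hD.isPreconnected.subset_closure (subset_insert _ _)
      (insert_subset hTcl subset_closure)

/-! ### Cluster sets -/

/-- `w` is a cluster value of `φ : D → ℂ` at `z`. -/
def IsClusterValue (φ : ℂ → ℂ) (D : Set ℂ) (z w : ℂ) : Prop :=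
  ∀ ε > (0 : ℝ), ∃ x ∈ D, dist x z < ε ∧ dist (φ x) w < ε

theorem mem_clusterSet_iff {φ : ℂ → ℂ} {D : Set ℂ} {z w : ℂ} :
    w ∈ clusterSet φ D z ↔ IsClusterValue φ D z w := by
  simp only [clusterSet, mem_iInter, Metric.mem_closure_iff, mem_Ioi]
  constructor
  · intro h ε hε
    obtain ⟨_, ⟨x, ⟨hx, hxz⟩, rfl⟩, hd⟩ := h ε hε ε hε
    exact ⟨x, hx, hxz, by rwa [dist_comm]⟩
  · intro h r hr ε hε
    obtain ⟨x, hx, hxz, hxw⟩ := h (min r ε) (lt_min hr hε)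
    exact ⟨φ x, ⟨x, ⟨hx, hxz.trans_le (min_le_left _ _)⟩, rfl⟩, by
      rw [dist_comm]; exact hxw.trans_le (min_le_right _ _)⟩

theorem IsClusterValue.exists_mem {φ : ℂ → ℂ} {D N O : Set ℂ} {z w : ℂ}
    (h : IsClusterValue φ D z w) (hN : N ∈ 𝓝 z) (hO : O ∈ 𝓝 w) : ∃ x ∈ D, x ∈ N ∧ φ x ∈ O := by
  obtain ⟨r, hr, hrN⟩ := Metric.mem_nhds_iff.1 hN
  obtain ⟨s, hs, hsO⟩ := Metric.mem_nhds_iff.1 hO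
  obtain ⟨x, hx, hxz, hxw⟩ := h (min r s) (lt_min hr hs)
  exact ⟨x, hx, hrN (hxz.trans_le (min_le_left _ _)), hsO (hxw.trans_le (min_le_right _ _))⟩

/-- A bounded map has cluster values along any set accumulating at a point. -/
theorem exists_isClusterValue_of_mem_closure {φ : ℂ → ℂ} {D A : Set ℂ} {z : ℂ}
    (hAD : A ⊆ D) (hz : z ∈ closure A) (hb : Bornology.IsBounded (φ '' A)) :
    ∃ w ∈ closure (φ '' A), IsClusterValue φ D z w := by
  have : (𝓝[A] z).NeBot := mem_closure_iff_nhdsWithin_neBot.1 hz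
  have hc : IsCompact (closure (φ '' A)) := hb.isCompact_closure
  obtain ⟨w, hw, hcl⟩ := hc (f := Filter.map φ (𝓝[A] z)) (by
    rw [le_principal_iff, Filter.mem_map]
    filter_upwards [self_mem_nhdsWithin] with x hx using subset_closure (mem_image_of_mem _ hx))
  refine ⟨w, hw, fun ε hε => ?_⟩
  have h1 : ∃ᶠ x in 𝓝[A] z, φ x ∈ ball w ε :=
    MapClusterPt.frequently (u := φ) hcl (Metric.ball_mem_nhds w hε)
  have h2 : ∀ᶠ x in 𝓝[A] z, x ∈ A ∧ x ∈ ball z ε :=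
    (eventually_mem_nhdsWithin).and (mem_nhdsWithin_of_mem_nhds (Metric.ball_mem_nhds z hε))
  obtain ⟨x, hx, hxA, hxz⟩ := (h1.and_eventually h2).exists
  exact ⟨x, hAD hxA, hxz, hx⟩

/-- A bijection `D → Ω` with inverse `ψ`, both continuous. -/
structure IsHomeoPair (φ ψ : ℂ → ℂ) (D Ω : Set ℂ) : Prop where
  continuousOn : ContinuousOn φ D
  continuousOn_symm : ContinuousOn ψ Ω
  mapsTo : MapsTo φ D Ω
  mapsTo_symm : MapsTo ψ Ω D
  leftInvOn : LeftInvOn ψ φ D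
  rightInvOn : RightInvOn ψ φ Ω

theorem IsHomeoPair.symm {φ ψ : ℂ → ℂ} {D Ω : Set ℂ} (h : IsHomeoPair φ ψ D Ω) :
    IsHomeoPair ψ φ Ω D :=
  ⟨h.continuousOn_symm, h.continuousOn, h.mapsTo_symm, h.mapsTo, h.rightInvOn, h.leftInvOn⟩

theorem IsHomeoPair.isClusterValue_symm {φ ψ : ℂ → ℂ} {D Ω : Set ℂ} (h : IsHomeoPair φ ψ D Ω)
    {z w : ℂ} (hzw : IsClusterValue φ D z w) : IsClusterValue ψ Ω w z := by
  intro ε hε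
  obtain ⟨x, hx, hxz, hxw⟩ := hzw ε hε
  exact ⟨φ x, h.mapsTo hx, hxw, by rwa [h.leftInvOn hx]⟩

/-- Cluster values at points outside the domain lie on the boundary of the image. -/
theorem IsHomeoPair.mem_frontier {φ ψ : ℂ → ℂ} {D Ω : Set ℂ} (h : IsHomeoPair φ ψ D Ω)
    (hΩo : IsOpen Ω) {z w : ℂ} (hz : z ∉ D) (hzw : IsClusterValue φ D z w) :
    w ∈ frontier Ω := by
  rw [frontier, hΩo.interior_eq]
  refine ⟨Metric.mem_closure_iff.2 fun ε hε => ?_, fun hwΩ => ?_⟩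
  · obtain ⟨x, hx, -, hxw⟩ := hzw ε hε
    exact ⟨φ x, h.mapsTo hx, by rwa [dist_comm]⟩
  · have hne : ψ w ≠ z := fun e => hz (e ▸ h.mapsTo_symm hwΩ)
    obtain ⟨N, O, hN, hO, hzN, hwO, hd⟩ := t2_separation hne
    have hc : ψ ⁻¹' N ∈ 𝓝 w :=
      (h.continuousOn_symm.continuousAt (hΩo.mem_nhds hwΩ)).preimage_mem_nhds (hN.mem_nhds hzN)
    obtain ⟨x, hx, hxO, hxN⟩ := hzw.exists_mem (hO.mem_nhds hwO) hc
    rw [mem_preimage, h.leftInvOn hx] at hxN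
    exact Set.disjoint_left.1 hd hxN hxO

/-- Cluster values at points of a connected subset of the complement of the domain all lie in the
same boundary component of the image. -/
theorem IsHomeoPair.mem_boundaryComponent {φ ψ : ℂ → ℂ} {D Ω : Set ℂ}
    (h : IsHomeoPair φ ψ D Ω) (hDo : IsOpen D) (hD : IsConnected D) (hΩo : IsOpen Ω)
    (hΩb : Bornology.IsBounded Ω) {C : Set ℂ} (hC : IsPreconnected C) (hCD : C ⊆ Dᶜ)
    {z₁ z₂ w₁ w₂ : ℂ} (hz₁ : z₁ ∈ C) (hz₂ : z₂ ∈ C) (h₁ : IsClusterValue φ D z₁ w₁)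
    (h₂ : IsClusterValue φ D z₂ w₂) : w₂ ∈ connectedComponentIn (frontier Ω) w₁ := by
  by_contra hw
  have hw₁ := h.mem_frontier hΩo (hCD hz₁) h₁
  have hw₂ := h.mem_frontier hΩo (hCD hz₂) h₂
  have hK : IsCompact (frontier Ω) := hΩb.isCompact_closure.of_isClosed_subset isClosed_frontier
    frontier_subset_closure
  obtain ⟨F₁, F₂, hF₁, hF₂, hFd, hFu, hwF₁, hFO⟩ :=
    exists_isClosed_split_of_connectedComponentIn_subset hK hw₁ (isOpen_compl_singleton (x := w₂))
      (fun x hx hxw => hw (hxw ▸ hx))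
  have hwF₂ : w₂ ∈ F₂ := by
    rw [← hFu] at hw₂
    exact hw₂.resolve_left fun hh => hFO hh rfl
  obtain ⟨O₁, O₂, hO₁, hO₂, hFO₁, hFO₂, hOd⟩ :=
    normal_separation hF₁ hF₂ hFd
  set L := closure Ω \ (O₁ ∪ O₂) with hL
  have hLc : IsCompact L := hΩb.isCompact_closure.diff (hO₁.union hO₂)
  have hLΩ : L ⊆ Ω := by
    rintro x ⟨hx, hxO⟩
    by_contra hxΩ
    have : x ∈ frontier Ω := by
      rw [frontier, hΩo.interior_eq]; exact ⟨hx, hxΩ⟩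
    rw [← hFu] at this
    exact hxO (this.imp (fun h => hFO₁ h) (fun h => hFO₂ h))
  set M := ψ '' L with hM
  have hMc : IsCompact M := hLc.image_of_continuousOn (h.continuousOn_symm.mono hLΩ)
  have hMD : M ⊆ D := by
    rintro _ ⟨x, hx, rfl⟩
    exact h.mapsTo_symm (hLΩ hx)
  have hDM : Dᶜ ⊆ Mᶜ := compl_subset_compl.2 hMD
  set V := connectedComponentIn Mᶜ z₁ with hV
  have hVo : IsOpen V := hMc.isClosed.isOpen_compl.connectedComponentIn
  have hVp : IsPreconnected V := isPreconnected_connectedComponentIn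
  have hCV : C ⊆ V := hC.subset_connectedComponentIn hz₁ (hCD.trans hDM)
  have hVM : V ⊆ Mᶜ := connectedComponentIn_subset _ _
  have hz₁V : z₁ ∈ V := hCV hz₁
  have hmax : ∀ T : Set ℂ, IsPreconnected T → T ⊆ Mᶜ → (T ∩ V).Nonempty → T ⊆ V := by
    rintro T hT hTM ⟨x, hxT, hxV⟩
    have := hT.subset_connectedComponentIn hxT hTM
    rwa [← connectedComponentIn_eq hxV] at this
  have hWo : IsOpen (V ∩ Dᶜ)ᶜ := by
    rw [isOpen_compl_iff]
    refine isClosed_of_closure_subset fun x hx => ?_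
    have hxD : x ∈ Dᶜ :=
      hDo.isClosed_compl.closure_subset (closure_mono inter_subset_right hx)
    refine ⟨?_, hxD⟩
    have hp : IsPreconnected (insert x V) := hVp.subset_closure (subset_insert _ _)
      (insert_subset (closure_mono inter_subset_left hx) subset_closure)
    exact hmax _ hp (insert_subset (hDM hxD) hVM) ⟨z₁, Or.inr hz₁V, hz₁V⟩ (mem_insert _ _)
  have hWp : IsPreconnected (V ∩ Dᶜ)ᶜ := isPreconnected_compl_inter_compl hDo hD
    fun T hT hTD hTV => hmax T hT (hTD.trans hDM) hTV
  have hVD : IsPreconnected (V ∩ D) := by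
    have := isPreconnected_inter_of_union_eq_univ hVo hWo hVp hWp (by
      ext x; by_cases hx : x ∈ V <;> simp [hx])
    convert this using 1
    ext x; by_cases hx : x ∈ V <;> simp [hx]
  have hφ : IsPreconnected (φ '' (V ∩ D)) :=
    hVD.image _ (h.continuousOn.mono inter_subset_right)
  obtain ⟨x₁, hx₁D, hx₁V, hx₁O⟩ := h₁.exists_mem (hVo.mem_nhds hz₁V) (hO₁.mem_nhds (hFO₁ hwF₁))
  obtain ⟨x₂, hx₂D, hx₂V, hx₂O⟩ :=
    h₂.exists_mem (hVo.mem_nhds (hCV hz₂)) (hO₂.mem_nhds (hFO₂ hwF₂))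
  obtain ⟨y, -, hy₁, hy₂⟩ := hφ O₁ O₂ hO₁ hO₂ (by
    rintro _ ⟨x, ⟨hxV, hxD⟩, rfl⟩
    by_contra hx
    refine hVM hxV ⟨φ x, ⟨subset_closure (h.mapsTo hxD), hx⟩, h.leftInvOn hxD⟩)
    ⟨φ x₁, ⟨x₁, ⟨hx₁V, hx₁D⟩, rfl⟩, hx₁O⟩ ⟨φ x₂, ⟨x₂, ⟨hx₂V, hx₂D⟩, rfl⟩, hx₂O⟩
  exact Set.disjoint_left.1 hOd hy₁ hy₂

/-- Along a path between two points of `D`, every intermediate value of `u ∘ φ` is attained either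
at a point of `D`, or on a boundary component of `Ω` met by the cluster set of `φ` at a boundary
point on the path. -/
theorem IsHomeoPair.exists_eq_or_mem_image_component {φ ψ : ℂ → ℂ} {D Ω : Set ℂ}
    (h : IsHomeoPair φ ψ D Ω) (hDo : IsOpen D) (hD : IsConnected D) (hΩo : IsOpen Ω)
    (hΩb : Bornology.IsBounded Ω) {γ : ℝ → ℂ} (hγ : Continuous γ) {u : ℂ → ℝ} (hu : Continuous u)
    {α β t : ℝ} (hαβ : α ≤ β) (hα : γ α ∈ D) (hβ : γ β ∈ D) (htα : u (φ (γ α)) ≤ t)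
    (htβ : t ≤ u (φ (γ β))) :
    (∃ s ∈ Icc α β, γ s ∈ D ∧ u (φ (γ s)) = t) ∨
      ∃ s ∈ Icc α β, γ s ∈ frontier D ∧ ∃ w, IsClusterValue φ D (γ s) w ∧
        t ∈ u '' connectedComponentIn (frontier Ω) w := by
  by_contra hcon
  push Not at hcon
  obtain ⟨hno, hno'⟩ := hcon
  have hcont : ∀ s, γ s ∈ D → ContinuousAt (fun s => u (φ (γ s))) s := fun s hs =>
    hu.continuousAt.comp ((h.continuousOn.continuousAt (hDo.mem_nhds hs)).comp hγ.continuousAt)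
  set A : Set ℝ := {s | s ∈ Icc α β ∧ γ s ∈ D ∧ u (φ (γ s)) ≤ t} with hA
  have hαA : α ∈ A := ⟨⟨le_rfl, hαβ⟩, hα, htα⟩
  have hAb : BddAbove A := ⟨β, fun s hs => hs.1.2⟩
  set p := sSup A with hp
  have hpA : p ∈ closure A := csSup_mem_closure ⟨α, hαA⟩ hAb
  have hpI : p ∈ Icc α β := ⟨le_csSup hAb hαA, csSup_le ⟨α, hαA⟩ fun s hs => hs.1.2⟩
  have hpD : γ p ∉ D := by
    intro hpD
    rcases lt_or_ge t (u (φ (γ p))) with hlt | hle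
    · have hev := (hcont p hpD).eventually (lt_mem_nhds hlt)
      obtain ⟨s, hs, hsA⟩ := (mem_closure_iff_frequently.1 hpA).and_eventually hev |>.exists
      exact absurd hs.2.2 (not_le.2 hsA)
    · have hlt : u (φ (γ p)) < t := lt_of_le_of_ne hle (hno p hpI hpD)
      have hpβ : p < β := lt_of_le_of_ne hpI.2 fun e => by
        rw [e] at hlt; exact absurd htβ (not_le.2 hlt)
      have hev : ∀ᶠ s in 𝓝[>] p, u (φ (γ s)) < t ∧ γ s ∈ D ∧ s < β :=
        nhdsWithin_le_nhds (((hcont p hpD).eventually (gt_mem_nhds hlt)).and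
          ((hγ.continuousAt.eventually (hDo.mem_nhds hpD)).and (gt_mem_nhds hpβ)))
      obtain ⟨s, ⟨hs1, hs2, hs3⟩, hsp⟩ := (hev.and self_mem_nhdsWithin).exists
      have hsp : p < s := hsp
      exact absurd (le_csSup hAb (show s ∈ A from ⟨⟨hpI.1.trans hsp.le, hs3.le⟩, hs2, hs1.le⟩))
        (not_le.2 hsp)
  set B : Set ℝ := {s | s ∈ Icc p β ∧ γ s ∈ D} with hB
  have hβB : β ∈ B := ⟨⟨hpI.2, le_rfl⟩, hβ⟩
  have hBb : BddBelow B := ⟨p, fun s hs => hs.1.1⟩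
  set q := sInf B with hq
  have hqB : q ∈ closure B := csInf_mem_closure ⟨β, hβB⟩ hBb
  have hqI : q ∈ Icc p β := ⟨le_csInf ⟨β, hβB⟩ fun s hs => hs.1.1, csInf_le hBb hβB⟩
  have hqD : γ q ∉ D := by
    intro hqD
    have hpq : p < q := lt_of_le_of_ne hqI.1 fun e => hpD (e ▸ hqD)
    have hev : ∀ᶠ s in 𝓝[<] q, γ s ∈ D ∧ p < s :=
      nhdsWithin_le_nhds ((hγ.continuousAt.eventually (hDo.mem_nhds hqD)).and (lt_mem_nhds hpq))
    obtain ⟨s, ⟨hs1, hs2⟩, hsq⟩ := (hev.and self_mem_nhdsWithin).exists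
    have hsq : s < q := hsq
    exact absurd (csInf_le hBb (show s ∈ B from ⟨⟨hs2.le, hsq.le.trans hqI.2⟩, hs1⟩))
      (not_le.2 hsq)
  have hC : γ '' Icc p q ⊆ Dᶜ := by
    rintro _ ⟨s, hs, rfl⟩ hsD
    have := csInf_le hBb (show s ∈ B from ⟨⟨hs.1, hs.2.trans hqI.2⟩, hsD⟩)
    exact hqD ((le_antisymm hs.2 this : s = q) ▸ hsD)
  have hCp : IsPreconnected (γ '' Icc p q) := isPreconnected_Icc.image _ hγ.continuousOn
  have hbd : ∀ S : Set ℝ, (∀ s ∈ S, γ s ∈ D) → Bornology.IsBounded (φ '' (γ '' S)) := by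
    intro S hS
    refine hΩb.subset ?_
    rintro _ ⟨_, ⟨s, hs, rfl⟩, rfl⟩
    exact h.mapsTo (hS s hs)
  obtain ⟨w₁, hw₁, hc₁⟩ := exists_isClusterValue_of_mem_closure (φ := φ) (D := D) (A := γ '' A)
    (z := γ p) (by rintro _ ⟨s, hs, rfl⟩; exact hs.2.1)
    (map_mem_closure hγ hpA fun s hs => mem_image_of_mem _ hs) (hbd A fun s hs => hs.2.1)
  obtain ⟨w₂, hw₂, hc₂⟩ := exists_isClusterValue_of_mem_closure (φ := φ) (D := D) (A := γ '' B)
    (z := γ q) (by rintro _ ⟨s, hs, rfl⟩; exact hs.2)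
    (map_mem_closure hγ hqB fun s hs => mem_image_of_mem _ hs) (hbd B fun s hs => hs.2)
  have hu₁ : u w₁ ≤ t := by
    refine closure_minimal ?_ (isClosed_le hu continuous_const) hw₁
    rintro _ ⟨_, ⟨s, hs, rfl⟩, rfl⟩
    exact hs.2.2
  have hu₂ : t ≤ u w₂ := by
    refine closure_minimal ?_ (isClosed_le continuous_const hu) hw₂
    rintro _ ⟨_, ⟨s, hs, rfl⟩, rfl⟩
    by_contra hlt
    rw [mem_ofPred_eq, not_le] at hlt
    have hsA : s ∈ A := ⟨⟨hpI.1.trans hs.1.1, hs.1.2⟩, hs.2, hlt.le⟩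
    have : s = p := le_antisymm (le_csSup hAb hsA) hs.1.1
    exact hpD (this ▸ hs.2)
  have hpC : γ p ∈ γ '' Icc p q := ⟨p, ⟨le_rfl, hqI.1⟩, rfl⟩
  have hqC : γ q ∈ γ '' Icc p q := ⟨q, ⟨hqI.1, le_rfl⟩, rfl⟩
  have hcc := h.mem_boundaryComponent hDo hD hΩo hΩb hCp hC hpC hqC hc₁ hc₂
  have hw₁Ω : w₁ ∈ frontier Ω := h.mem_frontier hΩo hpD hc₁
  have hpF : γ p ∈ frontier D := by
    rw [frontier, hDo.interior_eq]
    exact ⟨map_mem_closure hγ hpA fun s hs => hs.2.1, hpD⟩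
  refine hno' p hpI hpF w₁ hc₁ ?_
  exact isPreconnected_connectedComponentIn.intermediate_value (mem_connectedComponentIn hw₁Ω) hcc
    hu.continuousOn ⟨hu₁, hu₂⟩

/-! ### Arcs of circles -/

theorem min_cos_le_cos_lineMap {a b t : ℝ} (ha : |a| ≤ Real.pi) (hb : |b| ≤ Real.pi)
    (ht : t ∈ Icc (0 : ℝ) 1) :
    min (Real.cos a) (Real.cos b) ≤ Real.cos (AffineMap.lineMap a b t) := by
  have hle : |AffineMap.lineMap a b t| ≤ max |a| |b| := by
    have h1 : AffineMap.lineMap a b t = (1 - t) * a + t * b := by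
      rw [AffineMap.lineMap_apply_ring]
    rw [h1]
    calc |(1 - t) * a + t * b| ≤ |(1 - t) * a| + |t * b| := abs_add_le _ _
      _ = (1 - t) * |a| + t * |b| := by
        rw [abs_mul, abs_mul, abs_of_nonneg ht.1, abs_of_nonneg (sub_nonneg.2 ht.2)]
      _ ≤ (1 - t) * max |a| |b| + t * max |a| |b| := by
        gcongr
        · exact sub_nonneg.2 ht.2
        · exact le_max_left _ _
        · exact ht.1
        · exact le_max_right _ _
      _ = max |a| |b| := by ring
  rw [← Real.cos_abs a, ← Real.cos_abs b, ← Real.cos_abs (AffineMap.lineMap a b t)]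
  have := Real.cos_le_cos_of_nonneg_of_le_pi (abs_nonneg _) (max_le ha hb) hle
  refine le_trans ?_ this
  rcases max_choice |a| |b| with h | h <;> rw [h]
  · exact min_le_left _ _
  · exact min_le_right _ _

/-- Two points of a circle are joined by an arc on which a given linear functional is at least the
minimum of its values at the endpoints. -/
theorem exists_arc_min_inner_le {z₀ a b : ℂ} {r : ℝ} (ha : dist a z₀ = r) (hb : dist b z₀ = r)
    (v : ℂ) : ∃ γ : ℝ → ℂ, Continuous γ ∧ γ 0 = a ∧ γ 1 = b ∧ (∀ t, dist (γ t) z₀ = r) ∧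
      ∀ t ∈ Icc (0 : ℝ) 1,
        min (inner ℝ v (a - z₀)) (inner ℝ v (b - z₀)) ≤ inner ℝ v (γ t - z₀) := by
  obtain ⟨e, he, hv⟩ : ∃ e : ℂ, ‖e‖ = 1 ∧ v = ‖v‖ * e := by
    rcases eq_or_ne v 0 with rfl | hv
    · exact ⟨1, by simp, by simp⟩
    · have : (‖v‖ : ℂ) ≠ 0 := by simpa using hv
      exact ⟨v / ‖v‖, by simp [hv], by field_simp⟩
  have he0 : e ≠ 0 := by rintro rfl; simp at he
  have hr : 0 ≤ r := ha ▸ dist_nonneg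
  have hpar : ∀ x : ℂ, dist x z₀ = r →
      z₀ + r * e * Complex.exp (Complex.arg ((x - z₀) / e) * Complex.I) = x := by
    intro x hx
    have h1 := Complex.norm_mul_exp_arg_mul_I ((x - z₀) / e)
    rw [norm_div, he, div_one, ← dist_eq_norm, hx] at h1
    rw [mul_assoc, mul_left_comm, h1]
    field_simp
    ring
  have hin : ∀ θ : ℝ, inner ℝ v (z₀ + r * e * Complex.exp (θ * Complex.I) - z₀) =
      ‖v‖ * r * Real.cos θ := by
    intro θ
    rw [Complex.inner, hv]
    have hee : (starRingEnd ℂ) e * e = 1 := by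
      rw [mul_comm, Complex.mul_conj, Complex.normSq_eq_norm_sq, he]; simp
    have : (starRingEnd ℂ) (‖v‖ * e) * (z₀ + r * e * Complex.exp (θ * Complex.I) - z₀) =
        ((‖v‖ * r : ℝ) : ℂ) * Complex.exp (θ * Complex.I) := by
      rw [map_mul, Complex.conj_ofReal, add_sub_cancel_left]
      push_cast
      linear_combination (‖v‖ * r * Complex.exp (θ * Complex.I) : ℂ) * hee
    rw [add_sub_cancel_left] at this
    simp only [add_sub_cancel_left]
    rw [mul_comm, this, Complex.re_ofReal_mul, Complex.exp_ofReal_mul_I_re]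
    simp [he]
  set θa := Complex.arg ((a - z₀) / e)
  set θb := Complex.arg ((b - z₀) / e)
  refine ⟨fun t => z₀ + r * e * Complex.exp ((AffineMap.lineMap θa θb t : ℝ) * Complex.I),
    ?_, ?_, ?_, ?_, ?_⟩
  · have : Continuous fun t : ℝ => (AffineMap.lineMap θa θb t : ℝ) := AffineMap.lineMap_continuous
    fun_prop
  · simpa using hpar a ha
  · simpa using hpar b hb
  · intro t
    simp [dist_eq_norm, Complex.norm_exp_ofReal_mul_I, he, abs_of_nonneg hr]
  · intro t ht
    have h1 := min_cos_le_cos_lineMap (Complex.abs_arg_le_pi ((a - z₀) / e))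
      (Complex.abs_arg_le_pi ((b - z₀) / e)) ht
    have ha' := hin θa
    have hb' := hin θb
    rw [hpar a ha] at ha'
    rw [hpar b hb] at hb'
    rw [hin, ha', hb', ← mul_min_of_nonneg _ _ (by positivity)]
    exact mul_le_mul_of_nonneg_left h1 (by positivity)

/-- The shapes of complementary components of a circle domain. -/
def IsCircleShape (C : Set ℂ) : Prop :=
  (∃ c, C = {c}) ∨ ∃ c : ℂ, ∃ R : ℝ, 0 < R ∧ (C = closedBall c R ∨ C = (ball c R)ᶜ)

theorem IsCircleDomain.isCircleShape {D : Set ℂ} (hD : IsCircleDomain D) {x : ℂ} (hx : x ∈ Dᶜ) :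
    IsCircleShape (connectedComponentIn Dᶜ x) := by
  obtain ⟨hb, hu⟩ := hD.2.2 x hx
  by_cases h : Bornology.IsBounded (connectedComponentIn Dᶜ x)
  · rcases hb h with h | ⟨c, R, hR, h⟩
    · exact Or.inl ⟨x, h⟩
    · exact Or.inr ⟨c, R, hR, Or.inl h⟩
  · obtain ⟨c, R, hR, h⟩ := hu h
    exact Or.inr ⟨c, R, hR, Or.inr h⟩

/-- A circle minus a point, disk or complement of a disk is connected by arcs. -/
theorem IsCircleShape.exists_arc {C : Set ℂ} (hC : IsCircleShape C) {z₀ a b : ℂ} {r : ℝ}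
    (hz₀ : z₀ ∈ C) (hr : 0 < r) (ha : dist a z₀ = r) (hb : dist b z₀ = r)
    (haC : a ∉ C) (hbC : b ∉ C) : ∃ γ : ℝ → ℂ, Continuous γ ∧ γ 0 = a ∧ γ 1 = b ∧
      (∀ t, dist (γ t) z₀ = r) ∧ ∀ t ∈ Icc (0 : ℝ) 1, γ t ∉ C := by
  have hsq : ∀ c x : ℂ, dist x z₀ = r →
      dist x c ^ 2 = r ^ 2 + 2 * inner ℝ (z₀ - c) (x - z₀) + ‖z₀ - c‖ ^ 2 := by
    intro c x hx
    rw [dist_eq_norm, show x - c = (x - z₀) + (z₀ - c) by ring, norm_add_sq_real, ← dist_eq_norm,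
      hx, real_inner_comm]
  rcases hC with ⟨c, rfl⟩ | ⟨c, R, hR, rfl | rfl⟩
  · obtain ⟨γ, h1, h2, h3, h4, -⟩ := exists_arc_min_inner_le ha hb 0
    refine ⟨γ, h1, h2, h3, h4, fun t _ ht => ?_⟩
    rw [mem_singleton_iff] at hz₀ ht
    have := h4 t
    rw [ht, hz₀, dist_self] at this
    exact hr.ne this
  · obtain ⟨γ, h1, h2, h3, h4, h5⟩ := exists_arc_min_inner_le ha hb (z₀ - c)
    refine ⟨γ, h1, h2, h3, h4, fun t ht hmem => ?_⟩
    rw [mem_closedBall, ← sq_le_sq₀ dist_nonneg hR.le, hsq c _ (h4 t)] at hmem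
    rw [mem_closedBall, ← sq_le_sq₀ dist_nonneg hR.le, hsq c _ ha] at haC
    rw [mem_closedBall, ← sq_le_sq₀ dist_nonneg hR.le, hsq c _ hb] at hbC
    rcases min_le_iff.1 (h5 t ht) with h | h <;> linarith
  · obtain ⟨γ, h1, h2, h3, h4, h5⟩ := exists_arc_min_inner_le ha hb (-(z₀ - c))
    refine ⟨γ, h1, h2, h3, h4, fun t ht hmem => ?_⟩
    rw [mem_compl_iff, mem_ball, ← sq_lt_sq₀ dist_nonneg hR.le, hsq c _ (h4 t)] at hmem
    rw [mem_compl_iff, mem_ball, ← sq_lt_sq₀ dist_nonneg hR.le, hsq c _ ha] at haC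
    rw [mem_compl_iff, mem_ball, ← sq_lt_sq₀ dist_nonneg hR.le, hsq c _ hb] at hbC
    have h := h5 t ht
    simp only [inner_neg_left] at h
    rw [not_not] at haC hbC
    rw [not_lt] at hmem
    rcases min_le_iff.1 h with h | h <;> linarith

/-! ### Level sets of Lipschitz functions on sets of finite linear measure -/

/-- A Lipschitz function on a set of finite linear measure has finite fibres over almost every
value. -/
theorem ae_finite_inter_preimage_singleton {E : Set ℂ} (hE : μH[1] E < ⊤) {f : ℂ → ℝ}
    (hf : LipschitzWith 1 f) : ∀ᵐ r : ℝ, (E ∩ f ⁻¹' {r}).Finite := by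
  have hcover : ∀ n : ℕ, ∃ t : ℕ → Set ℂ, E ⊆ ⋃ i, t i ∧ (∀ i, ediam (t i) ≤ (n : ℝ≥0∞)⁻¹) ∧
      ∑' i, ediam (t i) ≤ μH[1] E + 1 := by
    intro n
    have hlt : μH[1] E < μH[1] E + 1 := ENNReal.lt_add_right hE.ne one_ne_zero
    have hle := le_iSup₂ (α := ℝ≥0∞) (f := fun (r : ℝ≥0∞) (_ : 0 < r) =>
      ⨅ (t : ℕ → Set ℂ) (_ : E ⊆ ⋃ n, t n) (_ : ∀ n, ediam (t n) ≤ r),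
          ∑' n, ⨆ _ : (t n).Nonempty, ediam (t n) ^ (1 : ℝ)) (n : ℝ≥0∞)⁻¹
        (ENNReal.inv_pos.2 (ENNReal.natCast_ne_top n))
    rw [← Measure.hausdorffMeasure_apply] at hle
    have := hle.trans_lt hlt
    simp only [iInf_lt_iff] at this
    obtain ⟨t, h1, h2, h3⟩ := this
    refine ⟨t, h1, h2, le_trans (ENNReal.tsum_le_tsum fun i => ?_) h3.le⟩
    rcases (t i).eq_empty_or_nonempty with h | h
    · simp [h]
    · simp [h]
  choose t ht1 ht2 ht3 using hcover
  let N : ℕ → ℝ → ℝ≥0∞ := fun n r => ∑' i, (closure (f '' t n i)).indicator 1 r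
  have hNm : ∀ n, Measurable (N n) := fun n =>
    Measurable.tsum fun i => measurable_one.indicator isClosed_closure.measurableSet
  have hNint : ∀ n, ∫⁻ r, N n r ≤ μH[1] E + 1 := by
    intro n
    rw [lintegral_tsum fun i =>
      (measurable_one.indicator isClosed_closure.measurableSet).aemeasurable]
    refine le_trans (ENNReal.tsum_le_tsum fun i => ?_) (ht3 n)
    rw [lintegral_indicator_one isClosed_closure.measurableSet]
    refine (Real.volume_le_diam _).trans ?_
    rw [Metric.ediam_closure]
    simpa using hf.ediam_image_le (t n i)
  have hfin : ∀ᵐ r, liminf (fun n => N n r) atTop < ⊤ := by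
    refine ae_lt_top (Measurable.liminf hNm) (ne_of_lt ?_)
    calc ∫⁻ r, liminf (fun n => N n r) atTop ≤ liminf (fun n => ∫⁻ r, N n r) atTop :=
          lintegral_liminf_le hNm
      _ ≤ liminf (fun _ : ℕ => μH[1] E + 1) atTop := liminf_le_liminf (.of_forall hNint)
      _ = μH[1] E + 1 := liminf_const _
      _ < ⊤ := ENNReal.add_lt_top.2 ⟨hE, ENNReal.one_lt_top⟩
  filter_upwards [hfin] with r hr
  by_contra hinf
  obtain ⟨m, hm⟩ := ENNReal.exists_nat_gt hr.ne
  obtain ⟨s, hsE, hsc⟩ := Set.Infinite.exists_subset_card_eq hinf m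
  have hpos : 0 < (s : Set ℂ).einfsep := s.finite_toSet.einfsep_pos
  have hev : ∀ᶠ n : ℕ in atTop, (m : ℝ≥0∞) ≤ N n r := by
    filter_upwards [ENNReal.tendsto_inv_nat_nhds_zero.eventually (gt_mem_nhds hpos)] with n hn
    have hmem : ∀ x ∈ s, ∃ i, x ∈ t n i := fun x hx => mem_iUnion.1 (ht1 n (hsE hx).1)
    choose! i hi using hmem
    have hinj : Set.InjOn i s := by
      intro x hx y hy hxy
      by_contra hne
      have h1 : edist x y ≤ ediam (t n (i x)) :=
        Metric.edist_le_ediam_of_mem (hi x hx) (by rw [hxy]; exact hi y hy)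
      have h2 : (s : Set ℂ).einfsep ≤ edist x y := Set.einfsep_le_edist_of_mem hx hy hne
      exact absurd (h2.trans (h1.trans (ht2 n _))) (not_le.2 hn)
    calc (m : ℝ≥0∞) = ∑ j ∈ s.image i, 1 := by
          rw [Finset.sum_const, Finset.card_image_of_injOn hinj, hsc]; simp
      _ = ∑ j ∈ s.image i, (closure (f '' t n j)).indicator 1 r := by
          refine Finset.sum_congr rfl fun j hj => ?_
          obtain ⟨x, hx, rfl⟩ := Finset.mem_image.1 hj
          have : r ∈ closure (f '' t n (i x)) := subset_closure ⟨x, hi x hx, (hsE hx).2⟩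
          rw [indicator_of_mem this]; rfl
      _ ≤ N n r := ENNReal.sum_le_tsum _
  exact absurd (le_liminf_of_le (by isBoundedDefault) hev) (not_le.2 hm)

/-- Almost every circle about a given point meets a set of σ-finite linear measure in a countable
set. -/
theorem SigmaFiniteH1.ae_countable_inter_sphere {E : Set ℂ} (hE : SigmaFiniteH1 E) (z₀ : ℂ) :
    ∀ᵐ r : ℝ, (E ∩ sphere z₀ r).Countable := by
  obtain ⟨f, rfl, hf⟩ := hE
  have := ae_all_iff.2 fun n =>
    ae_finite_inter_preimage_singleton (hf n) (LipschitzWith.dist_left z₀)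
  filter_upwards [this] with r hr
  rw [iUnion_inter]
  exact countable_iUnion fun n => (hr n).countable

/-! ### The length-area argument -/

theorem sq_lintegral_le_measure_univ_mul {α : Type*} [MeasurableSpace α] (μ : Measure α)
    {h : α → ℝ≥0∞} (hh : AEMeasurable h μ) :
    (∫⁻ x, h x ∂μ) ^ 2 ≤ μ univ * ∫⁻ x, h x ^ 2 ∂μ := by
  have h1 := ENNReal.lintegral_mul_le_Lp_mul_Lq μ Real.HolderConjugate.two_two
    (f := fun _ => 1) (g := h) aemeasurable_const hh
  simp only [Pi.mul_apply, one_mul, lintegral_const, ENNReal.rpow_two, one_pow] at h1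
  calc (∫⁻ x, h x ∂μ) ^ 2
      ≤ (μ univ ^ (1 / 2 : ℝ) * (∫⁻ x, h x ^ 2 ∂μ) ^ (1 / 2 : ℝ)) ^ 2 := by gcongr
    _ = μ univ * ∫⁻ x, h x ^ 2 ∂μ := by
      rw [mul_pow, ← ENNReal.rpow_two, ← ENNReal.rpow_two, ← ENNReal.rpow_mul, ← ENNReal.rpow_mul]
      norm_num

/-- Area formula for injective holomorphic maps. -/
theorem lintegral_enorm_deriv_sq_eq_volume_image {D : Set ℂ} {φ : ℂ → ℂ} (hD : IsOpen D)
    (hφ : DifferentiableOn ℂ φ D) (hinj : InjOn φ D) :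
    ∫⁻ z in D, ‖deriv φ z‖ₑ ^ 2 = volume (φ '' D) := by
  have hder : ∀ z ∈ D, HasFDerivWithinAt φ
      ((ContinuousLinearMap.toSpanSingleton ℂ (deriv φ z)).restrictScalars ℝ) D z := fun z hz =>
    ((hφ.differentiableAt (hD.mem_nhds hz)).hasDerivAt.hasFDerivAt.restrictScalars
      ℝ).hasFDerivWithinAt
  rw [← lintegral_abs_det_fderiv_eq_addHaar_image volume hD.measurableSet hder hinj]
  refine setLIntegral_congr_fun hD.measurableSet fun z _ => ?_
  have : ((ContinuousLinearMap.toSpanSingleton ℂ (deriv φ z)).restrictScalars ℝ).det =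
      ‖deriv φ z‖ ^ 2 := by
    simp [ContinuousLinearMap.det, LinearMap.det_restrictScalars, Algebra.norm_complex_eq,
      Complex.normSq_eq_norm_sq]
  simp only [this, abs_of_nonneg (sq_nonneg ‖deriv φ z‖)]
  rw [ENNReal.ofReal_pow (norm_nonneg _), ofReal_norm]

theorem lintegral_inv_Ioo_zero {δ : ℝ} (hδ : 0 < δ) :
    ∫⁻ r in Ioo 0 δ, ENNReal.ofReal r⁻¹ = ⊤ := by
  by_contra hne
  have hii : IntervalIntegrable (fun x : ℝ => x⁻¹) volume 0 δ := by
    rw [intervalIntegrable_iff_integrableOn_Ioo_of_le hδ.le]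
    refine ⟨measurable_inv.aestronglyMeasurable, ?_⟩
    rw [hasFiniteIntegral_iff_ofReal]
    · exact lt_top_iff_ne_top.2 hne
    · filter_upwards [ae_restrict_mem measurableSet_Ioo] with r hr
      exact inv_nonneg.2 hr.1.le
  rw [intervalIntegrable_inv_iff] at hii
  rcases hii with h | h
  · exact hδ.ne h
  · exact h left_mem_uIcc

/-- The length-area principle: a square integrable density has small integral over arbitrarily
small circles, and the radius may be chosen to satisfy a property that holds almost surely. -/
theorem exists_radius_lintegral_circle_lt {g : ℂ → ℝ≥0∞} (hg : Measurable g)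
    (hgi : ∫⁻ z, g z ^ 2 ≠ ⊤) (z₀ : ℂ) {p : ℝ → Prop} (hp : ∀ᵐ r, p r) {δ ε : ℝ} (hδ : 0 < δ)
    (hε : 0 < ε) : ∃ r ∈ Ioo 0 δ, p r ∧
      ∫⁻ θ in Ioo (-Real.pi) Real.pi,
        ENNReal.ofReal r * g (z₀ + r * Complex.exp (θ * Complex.I)) < ENNReal.ofReal ε := by
  by_contra hcon
  push Not at hcon
  refine hgi (top_unique ?_)
  let G : ℝ → ℝ → ℝ≥0∞ := fun r θ => g (z₀ + r * Complex.exp (θ * Complex.I))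
  have hG : Measurable (Function.uncurry G) := by
    refine hg.comp ?_
    have : Continuous fun q : ℝ × ℝ => z₀ + (q.1 : ℂ) * Complex.exp (q.2 * Complex.I) := by
      fun_prop
    exact this.measurable
  have hpolar : ∫⁻ z, g z ^ 2 =
      ∫⁻ r in Ioi (0 : ℝ), ∫⁻ θ in Ioo (-Real.pi) Real.pi, ENNReal.ofReal r * G r θ ^ 2 := by
    rw [← lintegral_add_left_eq_self (fun z => g z ^ 2) z₀,
      ← Complex.lintegral_comp_polarCoord_symm, polarCoord_target, Measure.volume_eq_prod,
      ← Measure.prod_restrict, lintegral_prod]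
    · refine lintegral_congr fun r => lintegral_congr fun θ => ?_
      simp only [G, smul_eq_mul, Complex.polarCoord_symm_apply, Complex.exp_mul_I,
        Complex.ofReal_cos, Complex.ofReal_sin]
    · refine Measurable.aemeasurable ?_
      have : (fun q : ℝ × ℝ => ENNReal.ofReal q.1 • g (z₀ + Complex.polarCoord.symm q) ^ 2) =
          fun q => ENNReal.ofReal q.1 * Function.uncurry G q ^ 2 := by
        ext q
        simp only [G, smul_eq_mul, Complex.polarCoord_symm_apply, Complex.exp_mul_I,
          Complex.ofReal_cos, Complex.ofReal_sin, Function.uncurry]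
      rw [this]
      fun_prop
  set c : ℝ := ε ^ 2 / (2 * Real.pi) with hc
  have hpi := Real.pi_pos
  have hc0 : 0 < c := by positivity
  have hkey : ∀ᵐ r ∂(volume.restrict (Ioo 0 δ)), ENNReal.ofReal c * ENNReal.ofReal r⁻¹ ≤
      ∫⁻ θ in Ioo (-Real.pi) Real.pi, ENNReal.ofReal r * G r θ ^ 2 := by
    filter_upwards [ae_restrict_mem measurableSet_Ioo, ae_restrict_of_ae hp] with r hr hpr
    have hr0 : 0 < r := hr.1
    have hGr : Measurable (G r) := hG.comp measurable_prodMk_left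
    have h1 := hcon r hr hpr
    have h2 := sq_lintegral_le_measure_univ_mul (volume.restrict (Ioo (-Real.pi) Real.pi))
      (h := fun θ => ENNReal.ofReal r * G r θ) (hGr.const_mul _).aemeasurable
    rw [Measure.restrict_apply_univ, Real.volume_Ioo] at h2
    have h3 : ∫⁻ θ in Ioo (-Real.pi) Real.pi, (ENNReal.ofReal r * G r θ) ^ 2 =
        ENNReal.ofReal r * ∫⁻ θ in Ioo (-Real.pi) Real.pi, ENNReal.ofReal r * G r θ ^ 2 := by
      rw [← lintegral_const_mul _ (by fun_prop)]
      refine lintegral_congr fun θ => ?_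
      ring
    rw [h3] at h2
    have h4 : ENNReal.ofReal (ε ^ 2) ≤ ENNReal.ofReal (2 * Real.pi * r) *
        ∫⁻ θ in Ioo (-Real.pi) Real.pi, ENNReal.ofReal r * G r θ ^ 2 := by
      rw [ENNReal.ofReal_pow hε.le, ENNReal.ofReal_mul (by positivity), mul_assoc,
        two_mul]
      refine le_trans (pow_le_pow_left' h1 2) (h2.trans_eq ?_)
      rw [sub_neg_eq_add]
    have hcr : c * r⁻¹ = (2 * Real.pi * r)⁻¹ * ε ^ 2 := by rw [hc]; field_simp
    rw [← ENNReal.ofReal_mul hc0.le, hcr, ENNReal.ofReal_mul (by positivity),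
      ENNReal.ofReal_inv_of_pos (by positivity)]
    refine (mul_le_mul_right h4 _).trans_eq ?_
    rw [← mul_assoc, ENNReal.inv_mul_cancel, one_mul]
    · exact (ENNReal.ofReal_pos.2 (by positivity)).ne'
    · exact ENNReal.ofReal_ne_top
  calc (⊤ : ℝ≥0∞) = ENNReal.ofReal c * ∫⁻ r in Ioo 0 δ, ENNReal.ofReal r⁻¹ := by
        rw [lintegral_inv_Ioo_zero hδ, ENNReal.mul_top (ENNReal.ofReal_pos.2 hc0).ne']
    _ = ∫⁻ r in Ioo 0 δ, ENNReal.ofReal c * ENNReal.ofReal r⁻¹ := by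
        rw [lintegral_const_mul _ (by fun_prop)]
    _ ≤ ∫⁻ r in Ioo 0 δ, ∫⁻ θ in Ioo (-Real.pi) Real.pi, ENNReal.ofReal r * G r θ ^ 2 :=
        lintegral_mono_ae hkey
    _ ≤ _ := by
        rw [hpolar]
        exact lintegral_mono_set Ioo_subset_Ioi_self

/-- The projection of the image of a circle is at most as long as the image itself. -/
theorem volume_image_inter_sphere_le {D : Set ℂ} {φ : ℂ → ℂ} (hD : IsOpen D)
    (hφ : DifferentiableOn ℂ φ D) {u : ℂ →L[ℝ] ℝ} (hu : ‖u‖ ≤ 1) (z₀ : ℂ) {r : ℝ} (hr : 0 < r) :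
    volume ((fun z => u (φ z)) '' (D ∩ sphere z₀ r)) ≤
      ∫⁻ θ in Ioo (-Real.pi) Real.pi, ENNReal.ofReal r *
        D.indicator (fun z => ‖deriv φ z‖ₑ) (z₀ + r * Complex.exp (θ * Complex.I)) := by
  let c : ℝ → ℂ := fun θ => z₀ + r * Complex.exp (θ * Complex.I)
  have hc : Continuous c := by fun_prop
  have hc' : ∀ θ : ℝ, HasDerivAt c (r * (Complex.exp (θ * Complex.I) * Complex.I)) θ := by
    intro θ
    have h1 : HasDerivAt (fun θ : ℝ => (θ : ℂ) * Complex.I) Complex.I θ := by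
      simpa using (Complex.ofRealCLM.hasDerivAt (x := θ)).mul_const Complex.I
    exact ((h1.cexp).const_mul (r : ℂ)).const_add z₀
  let T : Set ℝ := c ⁻¹' D
  have hT : IsOpen T := hD.preimage hc
  have hder : ∀ θ ∈ T ∩ Ioo (-Real.pi) Real.pi, HasFDerivWithinAt (fun θ => u (φ (c θ)))
      (ContinuousLinearMap.toSpanSingleton ℝ
        (u (deriv φ (c θ) * (r * (Complex.exp (θ * Complex.I) * Complex.I)))))
      (T ∩ Ioo (-Real.pi) Real.pi) θ := by
    intro θ hθ
    have h1 := (hφ.differentiableAt (hD.mem_nhds hθ.1)).hasDerivAt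
    have h2 : HasDerivAt (fun θ => φ (c θ))
        (deriv φ (c θ) * (r * (Complex.exp (θ * Complex.I) * Complex.I))) θ :=
      h1.comp_of_eq θ (hc' θ) rfl
    exact (u.hasFDerivAt.comp_hasDerivAt θ h2).hasFDerivAt.hasFDerivWithinAt
  have hle := addHaar_image_le_lintegral_abs_det_fderiv volume
    (hT.measurableSet.inter measurableSet_Ioo) hder
  have hsub : (fun z => u (φ z)) '' (D ∩ sphere z₀ r) ⊆
      ((fun θ => u (φ (c θ))) '' (T ∩ Ioo (-Real.pi) Real.pi)) ∪ {u (φ (c Real.pi))} := by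
    rintro _ ⟨z, ⟨hzD, hz⟩, rfl⟩
    have hcz : c (Complex.arg (z - z₀)) = z := by
      have := Complex.norm_mul_exp_arg_mul_I (z - z₀)
      rw [← dist_eq_norm, mem_sphere.1 hz] at this
      simp only [c, this, add_sub_cancel]
    rcases (Complex.arg_le_pi (z - z₀)).eq_or_lt with h | h
    · right
      rw [mem_singleton_iff, ← h, hcz]
    · left
      refine ⟨Complex.arg (z - z₀), ⟨?_, Complex.neg_pi_lt_arg _, h⟩, ?_⟩
      · simpa only [T, mem_preimage, hcz] using hzD
      · simp only [hcz]
  calc volume ((fun z => u (φ z)) '' (D ∩ sphere z₀ r))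
      ≤ volume ((fun θ => u (φ (c θ))) '' (T ∩ Ioo (-Real.pi) Real.pi)) +
          volume {u (φ (c Real.pi))} := (measure_mono hsub).trans (measure_union_le _ _)
    _ ≤ ∫⁻ θ in T ∩ Ioo (-Real.pi) Real.pi, ENNReal.ofReal r * ‖deriv φ (c θ)‖ₑ := by
        rw [Real.volume_singleton, add_zero]
        refine hle.trans (lintegral_mono fun θ => ?_)
        rw [ContinuousLinearMap.det_toSpanSingleton, ← ofReal_norm, ← ENNReal.ofReal_mul hr.le]
        refine ENNReal.ofReal_le_ofReal ?_
        rw [← Real.norm_eq_abs]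
        refine (u.le_of_opNorm_le hu _).trans_eq ?_
        simp [abs_of_pos hr, mul_comm]
    _ = ∫⁻ θ in Ioo (-Real.pi) Real.pi,
          T.indicator (fun θ => ENNReal.ofReal r * ‖deriv φ (c θ)‖ₑ) θ := by
        rw [lintegral_indicator hT.measurableSet, Measure.restrict_restrict hT.measurableSet]
    _ = _ := by
        refine lintegral_congr fun θ => ?_
        by_cases h : c θ ∈ D
        · rw [indicator_of_mem (show θ ∈ T from h), indicator_of_mem h]
        · rw [indicator_of_notMem (show θ ∉ T from h), indicator_of_notMem h, mul_zero]

/-! ### The oscillation estimate -/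

/-- A conformal homeomorphism has a continuous inverse. -/
theorem IsConformalHomeoOnto.exists_isHomeoPair {D Ω : Set ℂ} {φ : ℂ → ℂ} (hD : IsPlanarDomain D)
    (hφ : IsConformalHomeoOnto φ D Ω) : ∃ ψ, IsHomeoPair φ ψ D Ω := by
  obtain ⟨hdiff, hbij⟩ := hφ
  have hinv := hbij.invOn_invFunOn
  have hmaps : MapsTo (Function.invFunOn φ D) Ω D := hbij.surjOn.mapsTo_invFunOn
  have hopen : ∀ s ⊆ D, IsOpen s → IsOpen (φ '' s) := by
    rcases (hdiff.analyticOnNhd hD.2.1).is_constant_or_isOpen hD.2.2.isPreconnected with h | h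
    · obtain ⟨c, hc⟩ := h
      obtain ⟨x, hx⟩ := hD.1
      have hsub : D ⊆ {x} := fun y hy => hbij.injOn hy hx ((hc y hy).trans (hc x hx).symm)
      exact absurd ((finite_singleton x).subset hsub)
        (infinite_of_mem_nhds x (hD.2.1.mem_nhds hx))
    · exact h
  refine ⟨Function.invFunOn φ D, hdiff.continuousOn, ?_, hbij.mapsTo, hmaps, hinv.1, hinv.2⟩
  have hΩ : IsOpen Ω := hbij.image_eq ▸ hopen D subset_rfl hD.2.1
  rw [continuousOn_open_iff hΩ]
  intro t ht
  have : Ω ∩ Function.invFunOn φ D ⁻¹' t = φ '' (D ∩ t) := by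
    ext w
    constructor
    · rintro ⟨hw, hwt⟩
      exact ⟨_, ⟨hmaps hw, hwt⟩, hinv.2 hw⟩
    · rintro ⟨x, ⟨hx, hxt⟩, rfl⟩
      exact ⟨hbij.mapsTo hx, by rwa [mem_preimage, hinv.1 hx]⟩
  rw [this]
  exact hopen _ inter_subset_left (hD.2.1.inter ht)

/-- Cluster sets are upper semicontinuous. -/
theorem exists_forall_isClusterValue_mem {φ : ℂ → ℂ} {D P O : Set ℂ} {z₀ : ℂ}
    (hb : Bornology.IsBounded (φ '' D)) (hP : IsCompact P) (hO : IsOpen O) (hPO : P ⊆ O)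
    (h : ∀ w, IsClusterValue φ D z₀ w → w ∈ P) :
    ∃ δ > 0, ∀ z ∈ ball z₀ δ, ∀ w, IsClusterValue φ D z w → w ∈ O := by
  obtain ⟨V, hV, hPV, hVO, -⟩ := exists_open_between_and_isCompact_closure hP hO hPO
  have hz : z₀ ∉ closure (D ∩ φ ⁻¹' Vᶜ) := by
    intro hz
    obtain ⟨w, hw, hcl⟩ := exists_isClusterValue_of_mem_closure inter_subset_left hz
      (hb.subset (image_mono inter_subset_left))
    have : w ∈ Vᶜ := by
      refine hV.isClosed_compl.closure_subset (closure_mono ?_ hw)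
      rintro _ ⟨x, hx, rfl⟩
      exact hx.2
    exact this (hPV (h w hcl))
  obtain ⟨δ, hδ, hball⟩ := Metric.isOpen_iff.1 isClosed_closure.isOpen_compl z₀ hz
  refine ⟨δ, hδ, fun z hz w hw => hVO (Metric.mem_closure_iff.2 fun ε hε => ?_)⟩
  obtain ⟨x, hxD, hx, hxw⟩ := hw.exists_mem (isOpen_ball.mem_nhds hz) (Metric.ball_mem_nhds w hε)
  refine ⟨φ x, ?_, by rwa [dist_comm]⟩
  by_contra hxV
  exact hball hx (subset_closure ⟨hxD, hxV⟩)

theorem isClosed_connectedComponentIn {K : Set ℂ} (hK : IsClosed K) (x : ℂ) :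
    IsClosed (connectedComponentIn K x) := by
  by_cases hx : x ∈ K
  · refine isClosed_of_closure_subset (isPreconnected_connectedComponentIn.closure
      |>.subset_connectedComponentIn (subset_closure (mem_connectedComponentIn hx)) ?_)
    exact closure_minimal (connectedComponentIn_subset _ _) hK
  · rw [connectedComponentIn_eq_empty hx]
    exact isClosed_empty

/-- The distance between the images of two points on a circle is controlled by the length of the
image of the circle and the diameters of the boundary components met by an arc of the circle. -/
theorem IsHomeoPair.edist_le_lintegral_add_tsum {φ ψ : ℂ → ℂ} {D Ω : Set ℂ}
    (h : IsHomeoPair φ ψ D Ω) (hDo : IsOpen D) (hD : IsConnected D) (hΩo : IsOpen Ω)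
    (hΩb : Bornology.IsBounded Ω) (hφ : DifferentiableOn ℂ φ D) {z₀ : ℂ} {r : ℝ} (hr : 0 < r)
    (hcount : (frontier D ∩ sphere z₀ r).Countable) {γ : ℝ → ℂ} (hγ : Continuous γ)
    (h0 : γ 0 ∈ D) (h1 : γ 1 ∈ D) (hγr : ∀ t, dist (γ t) z₀ = r) {ι : Type*} [Countable ι]
    (X : ι → Set ℂ)
    (hX : ∀ t ∈ Icc (0 : ℝ) 1, γ t ∈ frontier D → ∀ w, IsClusterValue φ D (γ t) w →
      (connectedComponentIn (frontier Ω) w).Subsingleton ∨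
        ∃ i, connectedComponentIn (frontier Ω) w = X i) :
    edist (φ (γ 0)) (φ (γ 1)) ≤ (∫⁻ θ in Ioo (-Real.pi) Real.pi, ENNReal.ofReal r *
        D.indicator (fun z => ‖deriv φ z‖ₑ) (z₀ + r * Complex.exp (θ * Complex.I))) +
      ∑' i, ediam (X i) := by
  obtain ⟨u, hu, hux⟩ := exists_dual_vector'' ℝ (φ (γ 1) - φ (γ 0))
  let W : ℂ → Set ℝ := fun z => {t | ∃ w, IsClusterValue φ D z w ∧
    (connectedComponentIn (frontier Ω) w).Subsingleton ∧
      t ∈ u '' connectedComponentIn (frontier Ω) w}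
  have hW : ∀ z ∈ frontier D ∩ sphere z₀ r, volume (W z) = 0 := by
    intro z hz
    have hzD : z ∈ Dᶜ := by
      have := hz.1.2
      rwa [hDo.interior_eq] at this
    refine Set.Subsingleton.measure_zero ?_ volume
    rintro _ ⟨w₁, hw₁, hs, x₁, hx₁, rfl⟩ _ ⟨w₂, hw₂, -, x₂, hx₂, rfl⟩
    have hw := h.mem_boundaryComponent hDo hD hΩo hΩb isPreconnected_singleton
      (singleton_subset_iff.2 hzD) (mem_singleton z) (mem_singleton z) hw₁ hw₂
    rw [← connectedComponentIn_eq hw] at hx₂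
    rw [hs hx₁ hx₂]
  have hsub : Icc (u (φ (γ 0))) (u (φ (γ 1))) ⊆
      ((fun z => u (φ z)) '' (D ∩ sphere z₀ r) ∪ ⋃ z ∈ frontier D ∩ sphere z₀ r, W z) ∪
        ⋃ i, u '' X i := by
    intro t ht
    rcases h.exists_eq_or_mem_image_component hDo hD hΩo hΩb hγ u.continuous zero_le_one h0 h1
      ht.1 ht.2 with ⟨s, -, hs, hst⟩ | ⟨s, hs, hsD, w, hw, htw⟩
    · exact Or.inl (Or.inl ⟨γ s, ⟨hs, hγr s⟩, hst⟩)
    · rcases hX s hs hsD w hw with hsing | ⟨i, hi⟩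
      · exact Or.inl (Or.inr (mem_biUnion (x := γ s) ⟨hsD, hγr s⟩ ⟨w, hw, hsing, htw⟩))
      · exact Or.inr (mem_iUnion.2 ⟨i, hi ▸ htw⟩)
  calc edist (φ (γ 0)) (φ (γ 1)) = volume (Icc (u (φ (γ 0))) (u (φ (γ 1)))) := by
        rw [Real.volume_Icc, ← map_sub, hux, edist_comm, edist_dist, dist_eq_norm]
        rfl
    _ ≤ volume ((fun z => u (φ z)) '' (D ∩ sphere z₀ r)) +
          volume (⋃ z ∈ frontier D ∩ sphere z₀ r, W z) + volume (⋃ i, u '' X i) :=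
        (measure_mono hsub).trans ((measure_union_le _ _).trans
          (add_le_add_left (measure_union_le _ _) _))
    _ ≤ _ := by
        rw [(measure_biUnion_null_iff hcount).2 hW, add_zero]
        refine add_le_add (volume_image_inter_sphere_le hDo hφ hu z₀ hr)
          ((measure_iUnion_le _).trans (ENNReal.tsum_le_tsum fun i => ?_))
        refine (Real.volume_le_diam _).trans ?_
        have hL : LipschitzWith 1 u := u.lipschitz.weaken (by exact_mod_cast hu)
        simpa using hL.ediam_image_le (X i)

theorem oscLiminfZero_of_forall_exists {φ : ℂ → ℂ} {D : Set ℂ} {z₀ : ℂ}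
    (hb : Bornology.IsBounded (φ '' D))
    (h : ∀ ε > 0, ∀ δ > 0, ∃ r ∈ Ioo 0 δ, oscDiam φ D z₀ r ≤ ε) : OscLiminfZero φ D z₀ := by
  have hbdd : ∀ r, oscDiam φ D z₀ r ≤ diam (φ '' D) := fun r =>
    Metric.diam_mono (image_mono inter_subset_left) hb
  have hlow : IsBoundedUnder (· ≥ ·) (𝓝[>] (0 : ℝ)) (oscDiam φ D z₀) :=
    isBoundedUnder_of ⟨0, fun r => diam_nonneg⟩
  have hup : IsCoboundedUnder (· ≥ ·) (𝓝[>] (0 : ℝ)) (oscDiam φ D z₀) :=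
    IsBoundedUnder.isCoboundedUnder_ge (isBoundedUnder_of ⟨_, hbdd⟩)
  refine le_antisymm (le_of_forall_pos_le_add fun ε hε => ?_)
    (le_liminf_of_le hup (Eventually.of_forall fun r => diam_nonneg))
  rw [zero_add]
  refine liminf_le_of_frequently_le ?_ hlow
  rw [frequently_nhdsWithin_iff, (nhds_basis_Ioo_pos (0 : ℝ)).frequently_iff]
  intro δ hδ
  obtain ⟨r, hr, hle⟩ := h ε hε δ hδ
  exact ⟨r, ⟨by linarith [hr.1], by linarith [hr.2]⟩, hle, hr.1⟩

/-- There are arbitrarily small circles about a boundary point with small oscillation. -/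
theorem exists_oscDiam_le {D Ω : Set ℂ} {φ : ℂ → ℂ} (hD : IsCircleDomain D)
    (hDσ : SigmaFiniteH1 (frontier D)) (hΩ : IsPlanarDomain Ω) (hΩb : Bornology.IsBounded Ω)
    (hφ : IsConformalHomeoOnto φ D Ω) (hcount : (NondegComponents (frontier Ω)).Countable)
    {p : ℂ} (hp : p ∈ frontier Ω) {U : Set ℂ} (hU : IsOpen U)
    (hpU : connectedComponentIn (frontier Ω) p ⊆ U)
    (hsum : ∑' X : {X : Set ℂ // X ∈ NondegComponents (frontier Ω) ∧ X ⊆ U},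
      ediam (X : Set ℂ) ≠ ⊤)
    {z₀ : ℂ} (hz₀ : z₀ ∈ frontier D)
    (hz₀p : ∀ w, IsClusterValue φ D z₀ w → w ∈ connectedComponentIn (frontier Ω) p)
    {ε δ : ℝ} (hε : 0 < ε) (hδ : 0 < δ) : ∃ r ∈ Ioo 0 δ, oscDiam φ D z₀ r ≤ ε := by
  obtain ⟨ψ, h⟩ := hφ.exists_isHomeoPair hD.1
  have hDo := hD.1.2.1
  have hΩo := hΩ.2.1
  have himg : φ '' D = Ω := hφ.2.image_eq
  have hfD : frontier D ⊆ Dᶜ := by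
    rw [frontier, hDo.interior_eq]
    exact fun x hx => hx.2
  have hfΩ : frontier Ω ⊆ Ωᶜ := by
    rw [frontier, hΩo.interior_eq]
    exact fun x hx => hx.2
  have hK : IsCompact (frontier Ω) := hΩb.isCompact_closure.of_isClosed_subset isClosed_frontier
    frontier_subset_closure
  have hcomp : ∀ x, IsClosed (connectedComponentIn (frontier Ω) x) := fun x =>
    isClosed_connectedComponentIn isClosed_frontier x
  set P := connectedComponentIn (frontier Ω) p with hP
  have hPK : P ⊆ frontier Ω := connectedComponentIn_subset _ _
  have hPc : IsCompact P := hK.of_isClosed_subset (hcomp p) hPK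
  obtain ⟨w₀, -, hw₀⟩ := exists_isClusterValue_of_mem_closure (φ := φ) (subset_refl D)
    (frontier_subset_closure hz₀) (himg ▸ hΩb)
  set C := connectedComponentIn Dᶜ z₀ with hC
  have hz₀C : z₀ ∈ C := mem_connectedComponentIn (hfD hz₀)
  have hCD : C ⊆ Dᶜ := connectedComponentIn_subset _ _
  have hoff : ∀ z, z ∉ C → ∀ w, IsClusterValue φ D z w → w ∉ P := by
    intro z hz w hw hwP
    refine hz (connectedComponentIn_mono z₀ hfD ?_)
    exact h.symm.mem_boundaryComponent hΩo hΩ.2.2 hDo hD.2.1 isPreconnected_connectedComponentIn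
      (hPK.trans hfΩ) (hz₀p w₀ hw₀) hwP (h.isClusterValue_symm hw₀) (h.isClusterValue_symm hw)
  let T := {X : Set ℂ // X ∈ NondegComponents (frontier Ω) ∧ X ⊆ U}
  have hT : Countable T := (hcount.mono fun X (hX : X ∈ NondegComponents (frontier Ω) ∧ X ⊆ U) =>
    hX.1).to_subtype
  have hε2 : 0 < ENNReal.ofReal (ε / 2) := ENNReal.ofReal_pos.2 (half_pos hε)
  obtain ⟨s, hs⟩ := ((ENNReal.tendsto_tsum_compl_atTop_zero
    (f := fun X : T => ediam (X : Set ℂ)) hsum).eventually_lt_const hε2).exists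
  obtain ⟨F₁, F₂, hF₁, hF₂, hFd, hFu, hpF, hFU⟩ :=
    exists_isClosed_split_of_connectedComponentIn_subset hK hp hU hpU
  have hF : ∀ w ∈ F₁, connectedComponentIn (frontier Ω) w ⊆ F₁ := by
    intro w hw
    have hwK : w ∈ frontier Ω := hFu ▸ Or.inl hw
    have hwX := mem_connectedComponentIn hwK
    refine (isPreconnected_iff_subset_of_disjoint_closed.1 isPreconnected_connectedComponentIn
      F₁ F₂ hF₁ hF₂ (hFu ▸ connectedComponentIn_subset _ _)
      (by rw [hFd.inter_eq, inter_empty])).resolve_right fun hsub => ?_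
    exact Set.disjoint_left.1 hFd hw (hsub hwX)
  let O : Set ℂ := F₂ᶜ ∩ ⋂ X ∈ s, {w | (X : Set ℂ) = P ∨ w ∉ (X : Set ℂ)}
  have hO : IsOpen O := by
    refine hF₂.isOpen_compl.inter (isOpen_biInter_finset fun X _ => ?_)
    obtain ⟨⟨x, -, hx⟩, -⟩ := X.2.1
    refine isOpen_const.union ?_
    rw [hx]
    exact (hcomp x).isOpen_compl
  have hPO : P ⊆ O := by
    refine fun w hw => ⟨fun hwF => Set.disjoint_left.1 hFd (hF p hpF hw) hwF,
      mem_iInter₂.2 fun X _ => or_iff_not_imp_right.2 fun hwX => ?_⟩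
    obtain ⟨⟨x, -, hx⟩, -⟩ := X.2.1
    rw [not_not, hx] at hwX
    rw [hx, connectedComponentIn_eq hwX, hP, connectedComponentIn_eq hw]
  obtain ⟨δ', hδ', hloc⟩ :=
    exists_forall_isClusterValue_mem (himg ▸ hΩb) hPc hO hPO hz₀p
  have hg : Measurable (D.indicator fun z => ‖deriv φ z‖ₑ) :=
    (measurable_deriv φ).enorm.indicator hDo.measurableSet
  have hgi : ∫⁻ z, (D.indicator (fun z => ‖deriv φ z‖ₑ) z) ^ 2 ≠ ⊤ := by
    have : (fun z => (D.indicator (fun z => ‖deriv φ z‖ₑ) z) ^ 2) =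
        D.indicator fun z => ‖deriv φ z‖ₑ ^ 2 := by
      ext z
      by_cases hz : z ∈ D <;> simp [hz]
    rw [this, lintegral_indicator hDo.measurableSet,
      lintegral_enorm_deriv_sq_eq_volume_image hDo hφ.1 hφ.2.injOn, himg]
    exact hΩb.measure_lt_top.ne
  obtain ⟨r, hr, hrc, hri⟩ := exists_radius_lintegral_circle_lt hg hgi z₀
    (hDσ.ae_countable_inter_sphere z₀) (lt_min hδ hδ') (half_pos hε)
  refine ⟨r, ⟨hr.1, hr.2.trans_le (min_le_left _ _)⟩, Metric.diam_le_of_forall_dist_le hε.le ?_⟩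
  rintro _ ⟨a, ⟨haD, har⟩, rfl⟩ _ ⟨b, ⟨hbD, hbr⟩, rfl⟩
  obtain ⟨γ, hγ, rfl, rfl, hγr, hγC⟩ := (hD.isCircleShape (hfD hz₀)).exists_arc hz₀C hr.1 har hbr
    (fun ha => hCD ha haD) (fun hb => hCD hb hbD)
  have hle := h.edist_le_lintegral_add_tsum hDo hD.1.2.2 hΩo hΩb hφ.1 hr.1 hrc hγ haD hbD hγr
    (fun X : {X : T // X ∉ s} => ((X : T) : Set ℂ)) (by
      intro t ht htD w hw
      have hwK : w ∈ frontier Ω := h.mem_frontier hΩo (hfD htD) hw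
      have hwP : w ∉ P := hoff _ (hγC t ht) w hw
      have hwO : w ∈ O := hloc _ (mem_ball.2 ((hγr t).trans_lt
        (hr.2.trans_le (min_le_right _ _)))) w hw
      have hwF : w ∈ F₁ := (hFu.symm ▸ hwK : w ∈ F₁ ∪ F₂).resolve_right hwO.1
      refine or_iff_not_imp_left.2 fun hns => ?_
      refine ⟨⟨⟨connectedComponentIn (frontier Ω) w, ⟨⟨w, hwK, rfl⟩, not_subsingleton_iff.1 hns⟩,
        (hF w hwF).trans hFU⟩, fun hXs => ?_⟩, rfl⟩
      have hwX : w ∈ connectedComponentIn (frontier Ω) w := mem_connectedComponentIn hwK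
      rcases mem_iInter₂.1 hwO.2 _ hXs with hX | hX
      · exact hwP (hX ▸ hwX)
      · exact hX hwX)
  have hlt := hle.trans_lt (ENNReal.add_lt_add hri hs)
  rw [← ENNReal.ofReal_add (half_pos hε).le (half_pos hε).le, add_halves, edist_dist] at hlt
  exact ((ENNReal.ofReal_lt_ofReal_iff hε).1 hlt).le

/-- Oscillation estimate for a conformal map of a circle domain whose boundary has
σ-finite linear measure, second approach. -/
theorem stmt_17 (D Ω : Set ℂ) (φ : ℂ → ℂ)
    (hD : IsCircleDomain D)
    (hDσ : SigmaFiniteH1 (frontier D))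
    (hΩ : IsPlanarDomain Ω) (hΩb : Bornology.IsBounded Ω)
    (hφ : IsConformalHomeoOnto φ D Ω)
    (hcount : (NondegComponents (frontier Ω)).Countable)
    (P : Set ℂ) (hP : P ∈ NondegComponents (frontier Ω))
    (Q : Set ℂ) (hQ : ∃ x ∈ frontier D, Q = connectedComponentIn (frontier D) x)
    (hQP : boundaryComp φ D Q = P)
    (U : Set ℂ) (hUopen : IsOpen U) (hPU : P ⊆ U)
    (hsum : ∑' Q' : {Q' : Set ℂ // Q' ∈ NondegComponents (frontier Ω) ∧ Q' ⊆ U},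
              EMetric.diam (Q' : Set ℂ) < ⊤) :
    ∀ z₀ ∈ Q, OscLiminfZero φ D z₀ := by
  intro z₀ hz₀
  obtain ⟨⟨p, hp, rfl⟩, -⟩ := hP
  have hz₀D : z₀ ∈ frontier D := by
    obtain ⟨x, -, rfl⟩ := hQ
    exact connectedComponentIn_subset _ _ hz₀
  have hz₀p : ∀ w, IsClusterValue φ D z₀ w → w ∈ connectedComponentIn (frontier Ω) p :=
    fun w hw => hQP ▸ mem_biUnion hz₀ (mem_clusterSet_iff.2 hw)
  refine oscLiminfZero_of_forall_exists (hφ.2.image_eq.symm ▸ hΩb) fun ε hε δ hδ => ?_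
  exact exists_oscDiam_le hD hDσ hΩ hΩb hφ hcount hp hUopen hPU hsum.ne hz₀D hz₀p hε hδ
end
end
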